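/- arXiv:1702.06448 — 2 statements merged into one kernel-verified Lean document; each statement's English description precedes it below -/
import Mathlib

section
/- G has solvable word problem: with respect to a natural encoding of the elements of the free group on the countable generating set V(T) ∪ {a} ∪ B ∪ {t}, the set of words representing the identity element of G under the presentation map is computable (decidable). In particular, G is a finitely generated computable group. -/
/-- Generators of the group `K`: tree vertices `(n,τ)`, the letter `a`, and letters `bᵢ`. -/
inductive KGen : Type
  | vert : ℕ → List ℤ → KGen
  | a : KGen
  | b : ℤ → KGen
  deriving DecidableEq

/-- The parent `(n,τ)⁻` of a vertex `(n,τ)` of the tree `T`. -/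
def parent : ℕ → List ℤ → ℕ × List ℤ
  | n, [] => (n + 1, [])
  | n, τ => (n, τ.dropLast)

/-- Words over an alphabet `α` (a letter together with `true` for the letter itself,
`false` for its formal inverse). -/
abbrev Word (α : Type) := List (α × Bool)

/-- The word `u(x,y) = x y x² y x³ y ⋯ x¹⁰⁰ y`. -/
def uWord {α : Type} (x y : α) : Word α :=
  (List.range 100).flatMap fun k => List.replicate (k + 1) (x, true) ++ [(y, true)]

/-- The relator words of the presentation of `K`:
`u((n,τ),a) ((n,τ)⁻)⁻¹` and `u((n,τ),bᵢ) ((n,τ⌢⟨i⟩))⁻¹`. -/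
def KRelWords : Set (Word KGen) :=
  { w | (∃ (n : ℕ) (τ : List ℤ), w = uWord (KGen.vert n τ) KGen.a ++ [(KGen.vert (parent n τ).1 (parent n τ).2, false)]) ∨
        (∃ (n : ℕ) (τ : List ℤ) (i : ℤ), w = uWord (KGen.vert n τ) (KGen.b i) ++ [(KGen.vert n (τ ++ [i]), false)]) }

/-- The relators of `K` as elements of the free group. -/
def KRels : Set (FreeGroup KGen) := FreeGroup.mk '' KRelWords

/-- The group `K`. -/
abbrev K := PresentedGroup KRels

/-- Generators of `G`: the generators of `K` together with the stable letter `t = none`. -/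
abbrev GGen := Option KGen

/-- The relator words of the presentation of `G = ⟨K, t ∣ t bᵢ t⁻¹ = b_{i+1}⟩`:
the relators of `K` together with `t bᵢ t⁻¹ b_{i+1}⁻¹`. -/
def GRelWords : Set (Word GGen) :=
  (fun w : Word KGen => w.map fun p => (some p.1, p.2)) '' KRelWords ∪
    { w | ∃ i : ℤ, w = [((none : GGen), true), (some (KGen.b i), true), ((none : GGen), false),
        (some (KGen.b (i + 1)), false)] }

/-- The relators of `G` as elements of the free group. -/
def GRels : Set (FreeGroup GGen) := FreeGroup.mk '' GRelWords

/-- The group `G`, the HNN extension of `K` along `bᵢ ↦ b_{i+1}`. -/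
abbrev G := PresentedGroup GRels

/-- The vertex `(n,τ)` as an element of `G`. -/
def gvert (n : ℕ) (τ : List ℤ) : G := PresentedGroup.of (some (KGen.vert n τ))

/-- `a` as an element of `G`. -/
def ga : G := PresentedGroup.of (some KGen.a)

/-- `bᵢ` as an element of `G`. -/
def gb (i : ℤ) : G := PresentedGroup.of (some (KGen.b i))

/-- The stable letter `t` as an element of `G`. -/
def gt' : G := PresentedGroup.of (none : GGen)

/-- The subgroup `H` of `G` generated by `(1,⟨⟩)`, `a`, `b₀` and `t`. -/
def H : Subgroup G := Subgroup.closure {gvert 1 [], ga, gb 0, gt'}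


/-- An explicit equivalence used to endow `KGen` with a natural encoding. -/
def KGenEquiv : KGen ≃ ((ℕ × List ℤ) ⊕ (Unit ⊕ ℤ)) where
  toFun g := match g with
    | .vert n τ => .inl (n, τ)
    | .a => .inr (.inl ())
    | .b i => .inr (.inr i)
  invFun x := match x with
    | .inl (n, τ) => .vert n τ
    | .inr (.inl _) => .a
    | .inr (.inr i) => .b i
  left_inv g := by cases g <;> rfl
  right_inv x := by rcases x with ⟨n, τ⟩ | ⟨⟩ | i <;> rfl

/-- A natural encoding of the generators. -/
instance : Primcodable KGen := Primcodable.ofEquiv _ KGenEquiv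

/-- The formal inverse of a letter. -/
def negLetter {α : Type} (x : α × Bool) : α × Bool := (x.1, !x.2)

@[simp] theorem negLetter_negLetter {α : Type} (x : α × Bool) : negLetter (negLetter x) = x := by
  simp [negLetter]

theorem negLetter_injective {α : Type} : Function.Injective (negLetter (α := α)) :=
  Function.LeftInverse.injective negLetter_negLetter

/-- A set of periodic biinfinite reduced words satisfying a small cancellation condition:
two of them that agree on `P` consecutive positions are equal. -/
structure SmallCancel (α : Type) where
  /-- the biinfinite words -/
  lines : Set (ℤ → α × Bool)
  /-- an orientation of the biinfinite words -/
  pos : (ℤ → α × Bool) → Prop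
  /-- the common period -/
  L : ℕ
  /-- a strict bound for the length of pieces -/
  P : ℕ
  /-- the closing threshold -/
  θ : ℕ
  two_le : 2 ≤ P
  two_mul_le : 2 * P ≤ θ
  le_period : θ + 4 * P ≤ L
  shift : ∀ s ∈ lines, ∀ c : ℤ, (fun j => s (j + c)) ∈ lines
  rev : ∀ s ∈ lines, ∀ c : ℤ, (fun j => negLetter (s (c - j))) ∈ lines
  pos_rev : ∀ s ∈ lines, ∀ c : ℤ, pos (fun j => negLetter (s (c - j))) ↔ ¬ pos s
  period : ∀ s ∈ lines, ∀ j : ℤ, s (j + L) = s j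
  reduced : ∀ s ∈ lines, ∀ j : ℤ, s (j + 1) ≠ negLetter (s j)
  piece : ∀ s ∈ lines, ∀ s' ∈ lines, (∀ j : ℤ, 0 ≤ j → j < P → s j = s' j) → s = s'

/-- A folded graph with edges labelled by letters. -/
structure FoldedGraph (α : Type) where
  /-- the vertices -/
  V : Type
  /-- the labelled edges -/
  E : V → α × Bool → V → Prop
  symm : ∀ {p σ q}, E p σ q → E q (negLetter σ) p
  det : ∀ {p σ q q'}, E p σ q → E p σ q' → q = q'

namespace FoldedGraph

variable {α : Type} (D : SmallCancel α) (Γ : FoldedGraph α)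

/-- `f` traces the word `s` on the interval `[a, b]`. -/
def IsPath (s : ℤ → α × Bool) (f : ℤ → Γ.V) (a b : ℤ) : Prop :=
  ∀ j, a ≤ j → j < b → Γ.E (f j) (s j) (f (j + 1))

/-- The word `s` read from `x` closes up after one period. -/
def Closed (s : ℤ → α × Bool) (x : Γ.V) : Prop :=
  ∃ g : ℤ → Γ.V, g 0 = x ∧ (∀ j, g (j + D.L) = g j) ∧ ∀ j, Γ.E (g j) (s j) (g (j + 1))

/-- Every sufficiently long path labelled by a line lies on a closed cycle. -/
def Good : Prop :=
  ∀ s ∈ D.lines, ∀ f, Γ.IsPath s f 0 D.θ → Γ.Closed D s (f 0)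

variable {D Γ}

theorem IsPath.unique {s : ℤ → α × Bool} {f g : ℤ → Γ.V} {a b : ℤ} (hf : Γ.IsPath s f a b)
    (hg : Γ.IsPath s g a b) (h : f a = g a) (j : ℤ) (ha : a ≤ j) (hb : j ≤ b) : f j = g j := by
  induction j, ha using Int.leInduction with
  | base => exact h
  | succ j hj ih =>
    have e := hf j hj (by lia)
    rw [ih (by lia)] at e
    exact Γ.det e (hg j hj (by lia))

theorem IsPath.rev {s : ℤ → α × Bool} {f : ℤ → Γ.V} {a b : ℤ} (hf : Γ.IsPath s f a b) (c : ℤ) :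
    Γ.IsPath (fun j => negLetter (s (c - 1 - j))) (fun j => f (c - j)) (c - b) (c - a) := by
  intro j h1 h2
  have := Γ.symm (hf (c - 1 - j) (by lia) (by lia))
  rw [show c - 1 - j + 1 = c - j by ring] at this
  simpa [show c - (j + 1) = c - 1 - j by ring] using this

theorem IsPath.unique' {s : ℤ → α × Bool} {f g : ℤ → Γ.V} {a b : ℤ} (hf : Γ.IsPath s f a b)
    (hg : Γ.IsPath s g a b) (h : f b = g b) (j : ℤ) (ha : a ≤ j) (hb : j ≤ b) : f j = g j := by
  have := (hf.rev b).unique (hg.rev b) (by simpa using h) (b - j) (by lia) (by lia)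
  simpa using this

theorem IsPath.shift {s : ℤ → α × Bool} {f : ℤ → Γ.V} {a b : ℤ} (hf : Γ.IsPath s f a b) (c : ℤ) :
    Γ.IsPath (fun j => s (j + c)) (fun j => f (j + c)) (a - c) (b - c) := by
  intro j h1 h2
  have := hf (j + c) (by lia) (by lia)
  simpa [show j + 1 + c = j + c + 1 by ring] using this

theorem Closed.of_shift {s : ℤ → α × Bool} {f : ℤ → Γ.V} {a b : ℤ} (hf : Γ.IsPath s f a b)
    {c : ℤ} (hac : a ≤ c) (hcb : c ≤ b) (ha : a ≤ 0) (hb : 0 ≤ b)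
    (h : Γ.Closed D (fun j => s (j + c)) (f c)) : Γ.Closed D s (f 0) := by
  obtain ⟨g, g0, gp, ge⟩ := h
  have hg : Γ.IsPath s (fun j => g (j - c)) a b := by
    intro j _ _
    have := ge (j - c)
    simpa [show j + 1 - c = j - c + 1 by ring] using this
  refine ⟨fun j => g (j - c), ?_, fun j => ?_, fun j => ?_⟩
  · rcases le_total c 0 with hc | hc
    · have h1 : Γ.IsPath s f c b := fun j _ _ => hf j (by lia) (by lia)
      have h2 : Γ.IsPath s (fun j => g (j - c)) c b := fun j _ _ => hg j (by lia) (by lia)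
      exact (h1.unique h2 (by simp [g0]) 0 hc hb).symm
    · have h1 : Γ.IsPath s f a c := fun j _ _ => hf j (by lia) (by lia)
      have h2 : Γ.IsPath s (fun j => g (j - c)) a c := fun j _ _ => hg j (by lia) (by lia)
      exact (h1.unique' h2 (by simp [g0]) 0 ha hc).symm
  · have := gp (j - c)
    simpa [show j + D.L - c = j - c + D.L by ring] using this
  · have := ge (j - c)
    simpa [show j + 1 - c = j - c + 1 by ring] using this

theorem Closed.of_rev {s : ℤ → α × Bool} {x : Γ.V}
    (h : Γ.Closed D (fun j => negLetter (s (-1 - j))) x) : Γ.Closed D s x := by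
  obtain ⟨g, g0, gp, ge⟩ := h
  refine ⟨fun j => g (-j), by simpa using g0, fun j => ?_, fun j => ?_⟩
  · have := gp (-j - D.L)
    simp only [sub_add_cancel] at this
    simp [show -(j + (D.L : ℤ)) = -j - D.L by ring, this]
  · have := Γ.symm (ge (-j - 1))
    simpa [show -1 - (-j - 1) = j by ring, show -(j + 1) = -j - 1 by ring] using this

/-- The line `s`, reversed so that it starts `n` steps before the origin. -/
def revLine (s : ℤ → α × Bool) (n : ℕ) : ℤ → α × Bool := fun j => negLetter (s (-n - 1 - j))

@[simp] theorem revLine_revLine (s : ℤ → α × Bool) (n : ℕ) : revLine (revLine s n) n = s := by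
  funext j
  simp [revLine, show -(n : ℤ) - 1 - (-n - 1 - j) = j by ring]

variable (D Γ) in
/-- The line `s` traverses `Γ` from `q` to `p` in `n` steps, leaving it at both ends. -/
def Arc (p : Γ.V) (s : ℤ → α × Bool) (n : ℕ) (q : Γ.V) : Prop :=
  s ∈ D.lines ∧ D.θ - 2 * D.P ≤ n ∧ n < D.θ ∧ (∀ y, ¬ Γ.E p (s 0) y) ∧
    (∀ y, ¬ Γ.E q (revLine s n 0) y) ∧ ∃ f, f 0 = p ∧ f (-n) = q ∧ Γ.IsPath s f (-n) 0

theorem Arc.rev {p q : Γ.V} {s : ℤ → α × Bool} {n : ℕ} (h : Γ.Arc D p s n q) :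
    Γ.Arc D q (revLine s n) n p := by
  obtain ⟨h1, h2, h3, h4, h5, f, f0, fn, hf⟩ := h
  refine ⟨D.rev s h1 _, h2, h3, h5, by simpa using h4, fun j => f (-n - j), by simpa using fn,
    by simpa using f0, ?_⟩
  have := hf.rev (-n)
  rw [sub_neg_eq_add, neg_add_cancel, sub_zero] at this
  exact this

theorem Arc.unique {p q q' : Γ.V} {s : ℤ → α × Bool} {n n' : ℕ} (h : Γ.Arc D p s n q)
    (h' : Γ.Arc D p s n' q') : n = n' ∧ q = q' := by
  have key : ∀ {q q' : Γ.V} {n n' : ℕ}, Γ.Arc D p s n q → Γ.Arc D p s n' q' → n ≤ n' := by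
    intro q q' n n' h h'
    by_contra hlt
    obtain ⟨-, -, -, -, -, f, f0, fn, hf⟩ := h
    obtain ⟨-, -, -, -, h5, f', f0', fn', hf'⟩ := h'
    have hf2 : Γ.IsPath s f (-n') 0 := fun j _ _ => hf j (by lia) (by lia)
    have e := hf2.unique' hf' (by rw [f0, f0']) (-n') (by lia) (by lia)
    have := Γ.symm (hf (-n' - 1) (by lia) (by lia))
    rw [sub_add_cancel, e, fn'] at this
    exact h5 _ (by simpa [revLine] using this)
  obtain rfl : n = n' := le_antisymm (key h h') (key h' h)
  refine ⟨rfl, ?_⟩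
  obtain ⟨-, -, -, -, -, f, f0, fn, hf⟩ := h
  obtain ⟨-, -, -, -, h5, f', f0', fn', hf'⟩ := h'
  rw [← fn, ← fn']
  exact hf.unique' hf' (by rw [f0, f0']) (-n) (by lia) (by lia)

open Classical in
variable (D) in
/-- The number of vertices of the missing part of the cycle assigned to the first end. -/
noncomputable def cut (s : ℤ → α × Bool) (n : ℕ) : ℕ :=
  if D.pos s then D.L - n - 1 - 2 * D.P else 2 * D.P

theorem Arc.cut_add {p q : Γ.V} {s : ℤ → α × Bool} {n : ℕ} (h : Γ.Arc D p s n q) :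
    cut D s n + cut D (revLine s n) n + 1 + n = D.L := by
  have := D.pos_rev s h.1 (-n - 1)
  have h3 := h.2.2.1
  have := D.le_period
  unfold cut
  by_cases hp : D.pos s
  · have : ¬ D.pos (revLine s n) := by unfold revLine; tauto
    rw [if_pos hp, if_neg this]; lia
  · have : D.pos (revLine s n) := by unfold revLine; tauto
    rw [if_neg hp, if_pos this]; lia

theorem Arc.le_cut {p q : Γ.V} {s : ℤ → α × Bool} {n : ℕ} (h : Γ.Arc D p s n q) :
    2 * D.P ≤ cut D s n := by
  have h3 := h.2.2.1
  have := D.le_period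
  unfold cut
  split_ifs <;> lia

/-- The first `k` letters of a line. -/
def tk (s : ℤ → α × Bool) (k : ℕ) : List (α × Bool) := (List.range k).map fun j : ℕ => s j

@[simp] theorem length_tk (s : ℤ → α × Bool) (k : ℕ) : (tk s k).length = k := by simp [tk]

theorem tk_succ (s : ℤ → α × Bool) (k : ℕ) : tk s (k + 1) = tk s k ++ [s k] := by
  simp [tk, List.range_succ]

theorem tk_eq {s s' : ℤ → α × Bool} {k : ℕ} : tk s k = tk s' k ↔ ∀ j < k, s (j : ℤ) = s' j := by
  simp [tk]

theorem tk_append {s : ℤ → α × Bool} {k k' : ℕ} {w : List (α × Bool)} (h : tk s k = tk s k' ++ w) :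
    w = tk (fun j => s (j + k')) (k - k') := by
  have hl := congrArg List.length h
  simp only [length_tk, List.length_append] at hl
  obtain ⟨m, rfl⟩ := Nat.exists_eq_add_of_le (show k' ≤ k by lia)
  simp only [tk, List.range_add, List.map_append, List.append_cancel_left_eq, List.map_map] at h
  rw [← h]
  simp [tk, Function.comp_def, add_comm]

theorem tk_eq_append {s : ℤ → α × Bool} {k : ℕ} {u w : List (α × Bool)} (h : tk s k = u ++ w) :
    u = tk s u.length ∧ u.length ≤ k := by
  have hl := congrArg List.length h
  simp only [length_tk, List.length_append] at hl
  refine ⟨?_, by lia⟩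
  have := congrArg (List.take u.length) h
  rw [List.take_left] at this
  conv_lhs => rw [← this, tk, ← List.map_take, List.take_range, min_eq_left (by lia)]
  rfl

theorem eq_of_tk_eq {s s' : ℤ → α × Bool} {k : ℕ} (hs : s ∈ D.lines) (hs' : s' ∈ D.lines)
    (hk : D.P ≤ k) (h : tk s k = tk s' k) : s = s' := by
  refine D.piece s hs s' hs' fun j h0 hj => ?_
  obtain ⟨j, rfl⟩ := Int.eq_ofNat_of_zero_le h0
  exact tk_eq.1 h j (by lia)

variable (D Γ) in
/-- The words labelling the new vertices hanging off `p`. -/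
def Code (p : Γ.V) (w : List (α × Bool)) : Prop :=
  w = [] ∨ (∃ σ, w = [σ] ∧ ∀ y, ¬ Γ.E p σ y) ∨
    ∃ s n q k, Γ.Arc D p s n q ∧ k ≤ cut D s n ∧ w = tk s k

theorem Code.exists_arc {p : Γ.V} {w : List (α × Bool)} (h : Γ.Code D p w) (hw : 2 ≤ w.length) :
    ∃ s n q, Γ.Arc D p s n q ∧ w.length ≤ cut D s n ∧ w = tk s w.length := by
  rcases h with rfl | ⟨σ, rfl, -⟩ | ⟨s, n, q, k, h1, h2, rfl⟩
  · simp at hw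
  · simp at hw
  · exact ⟨s, n, q, h1, by simpa, by simp⟩

theorem Arc.code {p q : Γ.V} {s : ℤ → α × Bool} {n k : ℕ} (h : Γ.Arc D p s n q)
    (hk : k ≤ cut D s n) : Γ.Code D p (tk s k) := .inr (.inr ⟨s, n, q, k, h, hk, rfl⟩)

theorem Arc.of_code_append {p q : Γ.V} {s : ℤ → α × Bool} {n k : ℕ} {w : List (α × Bool)}
    (h : Γ.Arc D p s n q)
    (hk : D.P ≤ k) (hc : Γ.Code D p (tk s k ++ w)) :
    w = tk (fun j => s (j + k)) w.length ∧ k + w.length ≤ cut D s n := by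
  have h2 := D.two_le
  obtain ⟨s', n', q', h', hk', e⟩ := hc.exists_arc (by simp; lia)
  have e1 := tk_eq_append e.symm
  rw [length_tk] at e1
  obtain rfl := eq_of_tk_eq h.1 h'.1 hk e1.1
  obtain ⟨rfl, rfl⟩ := h.unique h'
  refine ⟨?_, by simpa using hk'⟩
  have := tk_append e.symm
  simpa using this

/-- The edges of the extended graph. -/
inductive ExtE (D : SmallCancel α) (Γ : FoldedGraph α) : Γ.V × List (α × Bool) → α × Bool →
    Γ.V × List (α × Bool) → Prop
  | base {p σ q} : Γ.E p σ q → ExtE D Γ (p, []) σ (q, [])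
  | up {p σ w} : Γ.Code D p w → Γ.Code D p (w ++ [σ]) → ExtE D Γ (p, w) σ (p, w ++ [σ])
  | down {p σ w} : Γ.Code D p w → Γ.Code D p (w ++ [σ]) →
      ExtE D Γ (p, w ++ [σ]) (negLetter σ) (p, w)
  | cross {p s n q} : Γ.Arc D p s n q → ExtE D Γ (p, tk s (cut D s n)) (s (cut D s n))
      (q, tk (revLine s n) (cut D (revLine s n) n))

theorem ExtE.symm {x y : Γ.V × List (α × Bool)} {σ : α × Bool} (h : ExtE D Γ x σ y) :
    ExtE D Γ y (negLetter σ) x := by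
  cases h with
  | base h => exact .base (Γ.symm h)
  | up h1 h2 => exact .down h1 h2
  | down h1 h2 => simpa using ExtE.up h1 h2
  | @cross p s n q h =>
    have := ExtE.cross h.rev
    have hc := h.cut_add
    have e : revLine s n (cut D (revLine s n) n) = negLetter (s (cut D s n)) := by
      have := D.period s h.1 (-n - 1 - cut D (revLine s n) n)
      rw [revLine, ← this]
      congr 2
      lia
    simpa [e] using this

/-- A word with a code has no edge of `Γ` labelled by its first letter. -/
theorem Code.exit {p : Γ.V} {w : List (α × Bool)} {σ : α × Bool} (h : Γ.Code D p (σ :: w)) (y : Γ.V) :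
    ¬ Γ.E p σ y := by
  rcases h with h | ⟨σ, h, h'⟩ | ⟨s, n, q, k, h1, h2, h3⟩
  · simp at h
  · simp only [List.cons.injEq] at h
    exact h.1 ▸ h' y
  · cases k with
    | zero => simp [tk] at h3
    | succ k =>
      rw [tk, List.range_succ_eq_map] at h3
      simp only [List.map_cons, List.cons.injEq] at h3
      rw [h3.1]
      exact h1.2.2.2.1 y

theorem Code.reduced {p : Γ.V} {w : List (α × Bool)} {σ τ : α × Bool}
    (h : Γ.Code D p (w ++ [σ] ++ [τ])) : τ ≠ negLetter σ := by
  obtain ⟨s, n, q, h1, -, h3⟩ := h.exists_arc (by simp)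
  simp only [List.length_append, List.length_cons, List.length_nil, zero_add, tk_succ] at h3
  have e2 := List.append_inj' h3 rfl
  have e3 := List.append_inj' e2.1 rfl
  simp only [List.cons.injEq, and_true] at e2 e3
  rw [e2.2, e3.2]
  push_cast
  exact D.reduced s h1.1 _

theorem Arc.cut_pos {p q : Γ.V} {s : ℤ → α × Bool} {n : ℕ} (h : Γ.Arc D p s n q) :
    ∃ k, cut D s n = k + 1 :=
  ⟨cut D s n - 1, by have := h.le_cut; have := D.two_le; lia⟩

theorem ExtE.det {x y y' : Γ.V × List (α × Bool)} {σ : α × Bool} (h : ExtE D Γ x σ y)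
    (h' : ExtE D Γ x σ y') : y = y' := by
  have up_down : ∀ {p : Γ.V} {w : List (α × Bool)} {τ : α × Bool}, Γ.Code D p (w ++ [τ]) →
      Γ.Code D p (w ++ [τ] ++ [negLetter τ]) → False := fun _ h2 => h2.reduced rfl
  have up_cross : ∀ {p q : Γ.V} {s : ℤ → α × Bool} {n : ℕ} {τ : α × Bool}, Γ.Arc D p s n q →
      Γ.Code D p (tk s (cut D s n) ++ [τ]) → False := by
    intro p q s n τ h1 h2
    have := (h1.of_code_append (by have := h1.le_cut; lia) h2).2
    simp at this
  have down_cross : ∀ {p q : Γ.V} {s : ℤ → α × Bool} {n : ℕ} {τ : α × Bool} {w : List (α × Bool)},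
      Γ.Arc D p s n q → w ++ [τ] = tk s (cut D s n) → negLetter τ = s (cut D s n) → False := by
    intro p q s n τ w h1 h2 h3
    obtain ⟨k, hk⟩ := h1.cut_pos
    rw [hk, tk_succ] at h2
    have := (List.append_inj' h2 rfl).2
    simp only [List.cons.injEq, and_true] at this
    rw [this, hk] at h3
    exact D.reduced s h1.1 k (by rw [h3]; push_cast; rfl)
  generalize hx : x = x' at h'
  generalize hσ : σ = σ' at h'
  cases h with
  | base h =>
    cases h' with
    | base h' => cases hx; cases hσ; rw [Γ.det h h']
    | up h1 h2 => cases hx; cases hσ; exact absurd h (h2.exit _)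
    | down h1 h2 => simp at hx
    | cross h' =>
      obtain ⟨k, hk⟩ := h'.cut_pos
      rw [hk, tk_succ] at hx
      simp at hx
  | up h1 h2 =>
    cases h' with
    | base h' => cases hx; cases hσ; exact absurd h' (h2.exit _)
    | up h1' h2' => cases hx; cases hσ; rfl
    | down h1' h2' => cases hx; cases hσ; exact (up_down h1 h2).elim
    | cross h' => cases hx; exact (up_cross h' h2).elim
  | down h1 h2 =>
    cases h' with
    | base h' => simp at hx
    | up h1' h2' => cases hx; cases hσ; exact (up_down h1' h2').elim
    | down h1' h2' =>
      rw [Prod.mk.injEq] at hx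
      rw [hx.1, (List.append_inj' hx.2 rfl).1]
    | cross h' =>
      rw [Prod.mk.injEq] at hx
      exact (down_cross h' hx.2 hσ).elim
  | cross h =>
    cases h' with
    | base h' =>
      obtain ⟨k, hk⟩ := h.cut_pos
      rw [hk, tk_succ] at hx
      simp at hx
    | up h1 h2 => cases hx; exact (up_cross h h2).elim
    | down h1 h2 =>
      rw [Prod.mk.injEq] at hx
      exact (down_cross h hx.2.symm hσ.symm).elim
    | @cross p' s' n' q' h' =>
      rw [Prod.mk.injEq] at hx
      obtain ⟨rfl, hx⟩ := hx
      have hl := congrArg List.length hx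
      simp only [length_tk] at hl
      rw [hl] at hx
      obtain rfl := eq_of_tk_eq h.1 h'.1 (by have := h'.le_cut; lia) hx
      obtain ⟨rfl, rfl⟩ := h.unique h'
      rfl

variable (D Γ) in
/-- The extension of `Γ` by hairs at all vertices and by the missing parts of the cycles that
have a long part in `Γ`. -/
abbrev ext : FoldedGraph α where
  V := Γ.V × List (α × Bool)
  E := ExtE D Γ
  symm := ExtE.symm
  det := ExtE.det

theorem ext_complete (p : Γ.V) (σ : α × Bool) : ∃ y, (ext D Γ).E (p, []) σ y := by
  by_cases h : ∃ y, Γ.E p σ y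
  · obtain ⟨y, hy⟩ := h
    exact ⟨_, .base hy⟩
  · push Not at h
    exact ⟨_, .up (.inl rfl) (.inr (.inl ⟨σ, rfl, h⟩))⟩

end FoldedGraph

namespace FoldedGraph

variable {α : Type} {D : SmallCancel α} {Γ : FoldedGraph α}

theorem Arc.exists_loop {p q : Γ.V} {s : ℤ → α × Bool} {n : ℕ} (h : Γ.Arc D p s n q) :
    ∃ g : ℤ → (ext D Γ).V, (∀ j, g (j + D.L) = g j) ∧ (∀ j, (ext D Γ).E (g j) (s j) (g (j + 1))) ∧
      (∀ k : ℕ, k ≤ cut D s n → g k = (p, tk s k)) ∧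
      ∀ k : ℕ, k ≤ cut D (revLine s n) n → g (D.L - n - k) = (q, tk (revLine s n) k) := by
  obtain ⟨f, f0, fn, hf⟩ := h.2.2.2.2.2
  have hcut := h.cut_add
  have hLpos : (0 : ℤ) < D.L := by lia
  let g₀ : ℤ → (ext D Γ).V := fun k =>
    if k ≤ cut D s n then (p, tk s k.toNat)
    else if k ≤ D.L - n then (q, tk (revLine s n) (D.L - n - k).toNat) else (f (k - D.L), [])
  have g1 : ∀ k : ℕ, k ≤ cut D s n → g₀ k = (p, tk s k) := by
    intro k hk
    simp [g₀, hk]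
  have g2 : ∀ k : ℕ, k ≤ cut D (revLine s n) n → g₀ (D.L - n - k) = (q, tk (revLine s n) k) := by
    intro k hk
    simp only [g₀]
    rw [if_neg (by lia), if_pos (by lia)]
    congr 2
    lia
  have g3 : ∀ k : ℤ, D.L - n ≤ k → k ≤ D.L → g₀ k = (f (k - D.L), []) := by
    intro k hk _
    rcases hk.eq_or_lt with rfl | hk
    · have := g2 0 (by lia)
      rw [show (D.L : ℤ) - n - (0 : ℕ) = D.L - n by simp] at this
      rw [this, ← fn, show (D.L : ℤ) - n - D.L = -n by ring]
      rfl
    · simp only [g₀]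
      rw [if_neg (by lia), if_neg (by lia)]
  have g4 : g₀ D.L = g₀ 0 := by
    rw [g3 _ (by lia) le_rfl, sub_self, f0]
    exact (g1 0 (by lia)).symm
  have edge : ∀ k : ℤ, 0 ≤ k → k < D.L → ExtE D Γ (g₀ k) (s k) (g₀ (k + 1)) := by
    intro k h0 hk
    obtain ⟨m, rfl⟩ := Int.eq_ofNat_of_zero_le h0
    rcases lt_trichotomy m (cut D s n) with hm | rfl | hm
    · have := g1 (m + 1) hm
      push_cast at this
      rw [g1 m hm.le, this, tk_succ]
      refine .up (h.code hm.le) ?_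
      rw [← tk_succ]
      exact h.code hm
    · have := g2 _ le_rfl
      rw [show (D.L : ℤ) - n - cut D (revLine s n) n = cut D s n + 1 by lia] at this
      rw [g1 _ le_rfl, this]
      exact .cross h
    · by_cases hm' : m < D.L - n
      · obtain ⟨i, rfl⟩ : ∃ i, m = D.L - n - (i + 1) := ⟨D.L - n - m - 1, by lia⟩
        have e1 := g2 (i + 1) (by lia)
        have e2 := g2 i (by lia)
        rw [show ((D.L - n - (i + 1) : ℕ) : ℤ) = D.L - n - (i + 1 : ℕ) by lia, e1,
          show (D.L : ℤ) - n - (i + 1 : ℕ) + 1 = D.L - n - i by lia, e2, tk_succ]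
        have : s (D.L - n - (i + 1 : ℕ)) = negLetter (revLine s n i) := by
          rw [revLine, negLetter_negLetter, ← D.period s h.1 (-n - 1 - i)]
          congr 1
          push_cast
          ring
        rw [this]
        refine .down (h.rev.code (by lia)) ?_
        rw [← tk_succ]
        exact h.rev.code (by lia)
      · rw [g3 _ (by lia) (by lia), g3 _ (by lia) (by lia)]
        have := hf (m - D.L) (by lia) (by lia)
        rw [show (m : ℤ) - D.L + 1 = m + 1 - D.L by ring, ← D.period s h.1, sub_add_cancel] at this
        exact .base this
  have hs : ∀ j : ℤ, s (j % D.L) = s j := by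
    have hp : Function.Periodic s (D.L : ℤ) := D.period s h.1
    intro j
    have := hp.int_mul (j / D.L) (j % D.L)
    rw [← this]
    congr 1
    simpa [mul_comm] using (Int.emod_add_mul_ediv j D.L)
  have hm : ∀ j : ℤ, 0 ≤ j → j ≤ D.L → g₀ (j % D.L) = g₀ j := by
    intro j h0 hj
    rcases hj.eq_or_lt with rfl | hj
    · rw [Int.emod_self, g4]
    · rw [Int.emod_eq_of_lt h0 hj]
  refine ⟨fun j => g₀ (j % D.L), fun j => by simp, fun j => ?_, fun k hk => ?_, fun k hk => ?_⟩
  · have := edge (j % D.L) (Int.emod_nonneg _ hLpos.ne') (Int.emod_lt_of_pos _ hLpos)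
    rw [hs, ← hm (j % D.L + 1) (by have := Int.emod_nonneg j hLpos.ne'; lia)
      (by have := Int.emod_lt_of_pos j hLpos; lia)] at this
    rwa [Int.emod_add_emod] at this
  · rw [← g1 k hk]
    exact hm _ (by lia) (by lia)
  · rw [← g2 k hk]
    exact hm _ (by lia) (by lia)

/-- The edges at `x` that lead away from `Γ`. -/
def Outward (D : SmallCancel α) (Γ : FoldedGraph α) (x : Γ.V × List (α × Bool)) (σ : α × Bool) :
    Prop :=
  Γ.Code D x.1 (x.2 ++ [σ]) ∨
    ∃ s n q, Γ.Arc D x.1 s n q ∧ x.2 = tk s (cut D s n) ∧ σ = s (cut D s n)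

theorem ExtE.code {x y : Γ.V × List (α × Bool)} {σ : α × Bool} (h : ExtE D Γ x σ y) :
    Γ.Code D x.1 x.2 := by
  cases h with
  | base h => exact .inl rfl
  | up h _ => exact h
  | down _ h => exact h
  | cross h => exact h.code le_rfl

theorem ExtE.outward_or {p : Γ.V} {w : List (α × Bool)} {τ : α × Bool}
    {y : Γ.V × List (α × Bool)} {σ : α × Bool} (h : ExtE D Γ (p, w ++ [τ]) σ y) :
    Outward D Γ (p, w ++ [τ]) σ ∨ σ = negLetter τ := by
  generalize hx : (p, w ++ [τ]) = x at h
  cases h with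
  | base h => simp at hx
  | up _ h => exact .inl (.inl h)
  | down _ h =>
    rw [Prod.mk.injEq] at hx
    have := (List.append_inj' hx.2 rfl).2
    simp only [List.cons.injEq, and_true] at this
    exact .inr (by rw [this])
  | cross h => exact .inl (.inr ⟨_, _, _, h, rfl, rfl⟩)

theorem ExtE.of_nil {p q : Γ.V} {σ : α × Bool} (h : ExtE D Γ (p, []) σ (q, [])) : Γ.E p σ q := by
  generalize hx : (p, ([] : List (α × Bool))) = x at h
  generalize hy : (q, ([] : List (α × Bool))) = y at h
  cases h with
  | base h => cases hx; cases hy; exact h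
  | up => simp at hy
  | down => simp at hx
  | cross h =>
    obtain ⟨k, hk⟩ := h.cut_pos
    rw [hk, tk_succ] at hx
    simp at hx

theorem Arc.outward {p q : Γ.V} {s : ℤ → α × Bool} {n k : ℕ} {σ : α × Bool} (h : Γ.Arc D p s n q)
    (hk : D.P ≤ k) (ho : Outward D Γ (p, tk s k) σ) : σ = s k := by
  rcases ho with ho | ⟨s', n', q', h', h1, h2⟩
  · have := (h.of_code_append hk ho).1
    simpa [tk] using this
  · have hl := congrArg List.length h1
    simp only [length_tk] at hl
    simp only at h' h1
    rw [← hl] at h1 h2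
    rw [h2, eq_of_tk_eq h.1 h'.1 hk h1]

theorem Arc.edge_mid {p q : Γ.V} {s : ℤ → α × Bool} {n k : ℕ} {σ : α × Bool}
    {y : Γ.V × List (α × Bool)} (h : Γ.Arc D p s n q) (hk : D.P ≤ k)
    (e : ExtE D Γ (p, tk s k) σ y) : σ = s k ∨ σ = negLetter (s (k - 1)) := by
  obtain ⟨m, rfl⟩ : ∃ m, k = m + 1 := ⟨k - 1, by have := D.two_le; lia⟩
  rw [tk_succ] at e
  rcases e.outward_or with h' | h'
  · rw [← tk_succ] at h'
    exact .inl (h.outward hk h')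
  · right
    simpa using h'

/-- A path of length `P` starting with an outward edge lies on a closed cycle. -/
theorem closed_of_outward {s : ℤ → α × Bool} (hs : s ∈ D.lines) {f : ℤ → (ext D Γ).V}
    (hf : (ext D Γ).IsPath s f 0 D.P) (ho : Outward D Γ (f 0) (s 0)) :
    (ext D Γ).Closed D s (f 0) := by
  have h2 := D.two_le
  have key : ∀ p q s₀ n d, Γ.Arc D p s₀ n q → d ≤ cut D s₀ n → f 0 = (p, tk s₀ d) →
      s = (fun j => s₀ (j + d)) → (ext D Γ).Closed D s (f 0) := by
    rintro p q s₀ n d h hd hf0 rfl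
    obtain ⟨g, gp, ge, gk, -⟩ := h.exists_loop
    refine ⟨fun j => g (j + d), by simp [gk d hd, hf0], fun j => ?_, fun j => ?_⟩
    · have := gp (j + d)
      rwa [add_right_comm] at this
    · have := ge (j + d)
      rwa [add_right_comm] at this
  obtain ⟨p, u, hpu⟩ : ∃ p u, f 0 = (p, u) := ⟨_, _, rfl⟩
  by_cases hu : D.P ≤ u.length
  · have hc : Γ.Code D p u := by simpa [hpu] using (hf 0 le_rfl (by lia)).code
    obtain ⟨s₀, n, q, h, hd, hus⟩ := hc.exists_arc (by lia)
    generalize u.length = d at *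
    subst hus
    have hs0 : s 0 = s₀ d := h.outward hu (hpu ▸ ho)
    refine key p q s₀ n d h hd hpu ?_
    obtain ⟨g, gp, ge, gk, gk'⟩ := h.exists_loop
    have claim : ∀ j : ℕ, j < D.P → f j = g (d + j) ∧ s j = s₀ (d + j) := by
      intro j
      induction j with
      | zero =>
        intro _
        simp [hpu, gk d hd, hs0]
      | succ j ih =>
        intro hj
        obtain ⟨i1, i2⟩ := ih (by lia)
        have e1 := hf j (by lia) (by lia)
        rw [i1, i2] at e1
        have e2 := (ext D Γ).det e1 (ge _)
        push_cast
        rw [← add_assoc]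
        refine ⟨e2, ?_⟩
        have e3 := hf (j + 1) (by lia) (by lia)
        rw [e2] at e3
        have hcut := h.cut_add
        have hcut' := h.rev.le_cut
        have hr := D.reduced s hs j
        have : s (j + 1) = s₀ (d + j + 1) ∨ s (j + 1) = negLetter (s₀ (d + j)) := by
          by_cases hk : d + j + 1 ≤ cut D s₀ n
          · have e4 := gk (d + j + 1) hk
            push_cast at e4
            rw [e4] at e3
            have := h.edge_mid (by lia) e3
            simpa using this
          · obtain ⟨k, hk⟩ : ∃ k : ℕ, k = D.L - n - (d + j + 1) := ⟨_, rfl⟩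
            have e4 := gk' k (by lia)
            rw [show (D.L : ℤ) - n - k = d + j + 1 by lia] at e4
            rw [e4] at e3
            have e5 := h.rev.edge_mid (by lia) e3
            have e6 : ∀ i : ℤ, s₀ (-n - 1 - i) = s₀ (D.L - n - 1 - i) := by
              intro i
              rw [← D.period s₀ h.1]
              congr 1
              ring
            simp only [revLine, negLetter_negLetter, e6] at e5
            rw [show (D.L : ℤ) - n - 1 - k = d + j by lia,
              show (D.L : ℤ) - n - 1 - (k - 1) = d + j + 1 by lia] at e5
            exact e5.symm
        rcases this with this | this
        · exact this
        · rw [this, i2] at hr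
          exact absurd rfl hr
    refine D.piece _ hs _ (D.shift _ h.1 _) fun j h0 hj => ?_
    obtain ⟨j, rfl⟩ := Int.eq_ofNat_of_zero_le h0
    rw [(claim j (by lia)).2, add_comm]
  · have claim : ∀ j : ℕ, j < D.P → Γ.Code D p (u ++ tk s (j + 1)) := by
      have step : ∀ j : ℕ, j < D.P → f j = (p, u ++ tk s j) → Outward D Γ (f j) (s j) →
          Γ.Code D p (u ++ tk s (j + 1)) := by
        intro j hj h1 ho
        rw [h1] at ho
        rcases ho with ho | ⟨s', n, q, h, h3, -⟩
        · simpa [tk_succ] using ho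
        · have h4 := congrArg List.length h3
          have := h.le_cut
          simp only [List.length_append, length_tk] at h4
          omega
      have : ∀ j : ℕ, j < D.P → f j = (p, u ++ tk s j) ∧ Γ.Code D p (u ++ tk s (j + 1)) := by
        intro j
        induction j with
        | zero =>
          intro h0
          have : f (0 : ℕ) = (p, u ++ tk s 0) := by simpa [tk] using hpu
          exact ⟨this, step 0 h0 this ho⟩
        | succ j ih =>
          intro hj
          obtain ⟨i1, i2⟩ := ih (by lia)
          have e1 := hf j (by lia) (by lia)
          have e2 : f (j + 1) = (p, u ++ tk s (j + 1)) := by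
            rw [tk_succ, ← List.append_assoc] at i2 ⊢
            rw [i1] at e1
            refine (ext D Γ).det e1 (.up ?_ i2)
            exact e1.code
          have e3 := hf (j + 1) (by lia) (by lia)
          rw [e2, tk_succ, ← List.append_assoc] at e3
          have e4 : f ((j + 1 : ℕ) : ℤ) = (p, u ++ tk s (j + 1)) := by push_cast; exact e2
          refine ⟨e4, step _ hj e4 ?_⟩
          rw [e4, tk_succ, ← List.append_assoc]
          push_cast
          exact e3.outward_or.resolve_right (D.reduced s hs j)
      exact fun j hj => (this j hj).2
    have hc := claim (D.P - 1) (by lia)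
    rw [show D.P - 1 + 1 = D.P by lia] at hc
    obtain ⟨s₀, n, q, h, hd, hus⟩ := hc.exists_arc (by simp; lia)
    have e1 := tk_eq_append hus.symm
    rw [e1.1] at hus
    have e2 := tk_append hus.symm
    simp only [List.length_append, length_tk, add_tsub_cancel_left] at e2 hd
    refine key p q s₀ n u.length h (by lia) (by rw [hpu, ← e1.1]) ?_
    exact eq_of_tk_eq hs (D.shift _ h.1 _) le_rfl e2

theorem exists_maximal_path (s : ℤ → α × Bool) (p : Γ.V) (N : ℕ) :
    (∃ f, f 0 = p ∧ Γ.IsPath s f 0 N) ∨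
      ∃ n < N, ∃ f, f 0 = p ∧ Γ.IsPath s f 0 n ∧ ∀ y, ¬ Γ.E (f n) (s n) y := by
  induction N with
  | zero => exact .inl ⟨fun _ => p, rfl, fun j _ _ => by lia⟩
  | succ N ih =>
    rcases ih with ⟨f, f0, hf⟩ | ⟨n, hn, h⟩
    · by_cases h : ∃ y, Γ.E (f N) (s N) y
      · obtain ⟨y, hy⟩ := h
        left
        refine ⟨fun j => if j ≤ N then f j else y, by simp [f0], fun j h0 hj => ?_⟩
        push_cast at hj
        simp only
        rcases (show j ≤ N by lia).eq_or_lt with rfl | hj'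
        · rw [if_pos le_rfl, if_neg (by lia)]
          exact hy
        · rw [if_pos hj'.le, if_pos (by lia)]
          exact hf j h0 hj'
      · push Not at h
        exact .inr ⟨N, by lia, f, f0, hf, h⟩
    · exact .inr ⟨n, by lia, h⟩

/-- A long path labelled by a line is part of a cycle or of a maximal path. -/
theorem Good.closed_or_arc (hΓ : Γ.Good D) {s : ℤ → α × Bool} (hs : s ∈ D.lines) {f : ℤ → Γ.V}
    {N : ℕ} (hN : D.θ - 2 * D.P ≤ N)
    (hf : Γ.IsPath s f 0 N) : Γ.Closed D s (f 0) ∨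
      ∃ (m : ℕ) (g : ℤ → Γ.V) (n : ℕ) (q : Γ.V), g 0 = f 0 ∧ Γ.IsPath s g 0 m ∧
        Γ.Arc D (g m) (fun j => s (j + m)) n q := by
  have maxi : ∀ (s : ℤ → α × Bool) (f g : ℤ → Γ.V) (n N : ℕ), Γ.IsPath s f 0 N → f 0 = g 0 →
      Γ.IsPath s g 0 n → (∀ y, ¬ Γ.E (g n) (s n) y) → N ≤ n := by
    intro s f g n N hf h0 hg hn
    by_contra hlt
    have hf' : Γ.IsPath s f 0 n := fun j _ _ => hf j (by lia) (by lia)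
    have := hf n (by lia) (by lia)
    rw [hf'.unique hg h0 n (by lia) le_rfl] at this
    exact hn _ this
  rcases exists_maximal_path (Γ := Γ) s (f 0) D.θ with ⟨g, g0, hg⟩ | ⟨m, hm, g, g0, hg, hm'⟩
  · exact .inl (g0 ▸ hΓ s hs g hg)
  right
  have hmN := maxi s f g m N hf g0.symm hg hm'
  set s₁ : ℤ → α × Bool := fun j => negLetter (s (m - 1 - j)) with hs₁
  have hs₁mem : s₁ ∈ D.lines := D.rev s hs _
  have hgr := hg.rev m
  rw [sub_self, sub_zero] at hgr
  refine ⟨m, g, ?_⟩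
  rcases exists_maximal_path (Γ := Γ) s₁ (g m) D.θ with ⟨k, k0, hk⟩ | ⟨n, hn, k, k0, hk, hn'⟩
  · exfalso
    have := hΓ s₁ hs₁mem k hk
    have h3 : Γ.Closed D (fun j => s (j + m)) (k 0) := by
      apply Closed.of_rev
      convert this using 4
      ring
    obtain ⟨c, c0, -, ce⟩ := h3
    have := ce 0
    rw [c0, k0, zero_add] at this
    exact hm' _ (by simpa using this)
  · have hmn := maxi s₁ _ k n m hgr (by simp [k0]) hk hn'
    refine ⟨n, k n, g0, hg, D.shift s hs m, by lia, hn, by simpa using hm', ?_, fun j => k (-j),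
      by simpa using k0, by simp, ?_⟩
    · convert hn' using 3
      simp only [revLine, hs₁]
      congr 2
      ring
    · have := hk.rev 0
      rw [sub_zero] at this
      convert this using 1
      · funext j
        simp only [hs₁, negLetter_negLetter]
        congr 1
        ring
      · funext j
        simp
      · simp

theorem Closed.ext {s : ℤ → α × Bool} {x : Γ.V} (h : Γ.Closed D s x) :
    (ext D Γ).Closed D s (x, []) := by
  obtain ⟨g, g0, gp, ge⟩ := h
  exact ⟨fun j => (g j, []), by simp [g0], fun j => by simp [gp], fun j => .base (ge j)⟩

theorem Good.ext (hΓ : Γ.Good D) : (FoldedGraph.ext D Γ).Good D := by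
  intro s hs f hf
  have h2 := D.two_le
  have h3 := D.two_mul_le
  by_cases h : ∃ i : ℤ, D.P ≤ i ∧ i ≤ D.θ - D.P ∧ (f i).2 ≠ []
  · obtain ⟨i, h1, h4, h5⟩ := h
    refine Closed.of_shift hf (c := i) (by lia) (by lia) le_rfl (by lia) ?_
    obtain ⟨w, τ, hw⟩ : ∃ w τ, (f i).2 = w ++ [τ] :=
      ⟨_, _, (List.dropLast_append_getLast h5).symm⟩
    obtain ⟨p, hp⟩ : ∃ p, f i = (p, w ++ [τ]) := ⟨(f i).1, Prod.ext rfl hw⟩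
    have e1 := hf i (by lia) (by lia)
    have e2 := ExtE.symm (hf (i - 1) (by lia) (by lia))
    rw [sub_add_cancel, hp] at e2
    rw [hp] at e1
    have hr := D.reduced s hs (i - 1)
    rw [sub_add_cancel] at hr
    rcases e1.outward_or with o | o
    · have := closed_of_outward (D.shift s hs i) (f := fun j => f (j + i))
        (fun j h h' => by
          have := hf (j + i) (by lia) (by lia)
          rwa [add_right_comm] at this) (by simpa [hp] using o)
      simpa using this
    · have o' := e2.outward_or.resolve_right (fun h => hr (by rw [o, ← negLetter_injective h]))
      have := closed_of_outward (D.rev s hs (i - 1)) (f := fun j => f (i - j))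
        (fun j h h' => hf.rev i j (by lia) (by lia)) (by simpa [hp] using o')
      apply Closed.of_rev
      convert this using 4
      · ring
      · ring
  · push Not at h
    have hb : Γ.IsPath (fun j => s (j + D.P)) (fun j => (f (j + D.P)).1) 0 (D.θ - 2 * D.P : ℕ) := by
      intro j h0 hj
      have e := hf (j + D.P) (by lia) (by lia)
      have e1 : f (j + D.P) = ((f (j + D.P)).1, []) := Prod.ext rfl (h _ (by lia) (by lia))
      have e2 : f (j + D.P + 1) = ((f (j + D.P + 1)).1, []) :=
        Prod.ext rfl (h _ (by lia) (by lia))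
      rw [e1, e2] at e
      simpa [add_right_comm] using ExtE.of_nil e
    have e1 : f D.P = ((f D.P).1, []) := Prod.ext rfl (h _ (by lia) (by lia))
    refine Closed.of_shift hf (c := D.P) (by lia) (by lia) le_rfl (by lia) ?_
    rcases hΓ.closed_or_arc (D.shift s hs _) le_rfl hb with hc | ⟨m, g, n, q, g0, hg, ha⟩
    · simpa [← e1] using hc.ext
    · obtain ⟨l, lp, le, lk, -⟩ := ha.exists_loop
      have hg' : (FoldedGraph.ext D Γ).IsPath (fun j => s (j + D.P)) (fun j => (g j, [])) 0 m :=
        fun j h h' => .base (hg j h h')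
      have := Closed.of_shift (D := D) hg' (c := m) (by lia) le_rfl le_rfl (by lia)
        ⟨l, by simpa [tk] using lk 0 (by lia), lp, le⟩
      simpa [g0, ← e1] using this

end FoldedGraph

namespace FoldedGraph

variable {α : Type} {D : SmallCancel α} {Γ Γ' : FoldedGraph α}

/-- The word `w` labels a walk from `p` to `q`. -/
def Walk (Γ : FoldedGraph α) : List (α × Bool) → Γ.V → Γ.V → Prop
  | [], p, q => p = q
  | σ :: w, p, q => ∃ r, Γ.E p σ r ∧ Walk Γ w r q

theorem walk_append {w w' : List (α × Bool)} {p q : Γ.V} :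
    Γ.Walk (w ++ w') p q ↔ ∃ r, Γ.Walk w p r ∧ Γ.Walk w' r q := by
  induction w generalizing p with
  | nil => simp [Walk]
  | cons σ w ih =>
    simp only [List.cons_append, Walk, ih]
    constructor
    · rintro ⟨r, h1, r', h2, h3⟩
      exact ⟨r', ⟨r, h1, h2⟩, h3⟩
    · rintro ⟨r', ⟨r, h1, h2⟩, h3⟩
      exact ⟨r, h1, r', h2, h3⟩

theorem Walk.unique {w : List (α × Bool)} {p q q' : Γ.V} (h : Γ.Walk w p q) (h' : Γ.Walk w p q') :
    q = q' := by
  induction w generalizing p with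
  | nil => exact h.symm.trans h'
  | cons σ w ih =>
    obtain ⟨r, h1, h2⟩ := h
    obtain ⟨r', h1', h2'⟩ := h'
    obtain rfl := Γ.det h1 h1'
    exact ih h2 h2'

theorem Walk.symm {w : List (α × Bool)} {p q : Γ.V} (h : Γ.Walk w p q) :
    Γ.Walk (FreeGroup.invRev w) q p := by
  induction w generalizing p with
  | nil => exact Eq.symm h
  | cons σ w ih =>
    obtain ⟨r, h1, h2⟩ := h
    have : FreeGroup.invRev (σ :: w) = FreeGroup.invRev w ++ [negLetter σ] := by
      simp [FreeGroup.invRev, negLetter]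
    rw [this, walk_append]
    exact ⟨r, ih h2, p, Γ.symm h1, rfl⟩

theorem Walk.red {w w' : List (α × Bool)} {p q : Γ.V} (h : Γ.Walk w p q)
    (hr : FreeGroup.Red w w') : Γ.Walk w' p q := by
  induction hr with
  | refl => exact h
  | tail _ h2 ih =>
    cases h2 with
    | @not L₁ L₂ x b =>
      rw [walk_append] at ih ⊢
      obtain ⟨r, h1, r', h2, r'', h3, h4⟩ := ih
      obtain rfl := Γ.det (Γ.symm h2) h3
      exact ⟨r, h1, h4⟩

theorem Walk.map {f : Γ.V → Γ'.V} (hf : ∀ p σ q, Γ.E p σ q → Γ'.E (f p) σ (f q))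
    {w : List (α × Bool)} {p q : Γ.V} (h : Γ.Walk w p q) : Γ'.Walk w (f p) (f q) := by
  induction w generalizing p with
  | nil => exact congrArg f h
  | cons σ w ih =>
    obtain ⟨r, h1, h2⟩ := h
    exact ⟨f r, hf _ _ _ h1, ih h2⟩

theorem walk_tk {s : ℤ → α × Bool} {f : ℤ → Γ.V} (hf : ∀ j, Γ.E (f j) (s j) (f (j + 1))) (n : ℕ) :
    Γ.Walk (tk s n) (f 0) (f n) := by
  induction n with
  | zero => rfl
  | succ n ih =>
    rw [tk_succ, walk_append]
    exact ⟨f n, ih, f (n + 1), hf n, rfl⟩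

theorem Walk.exists_isPath {s : ℤ → α × Bool} {n : ℕ} {p q : Γ.V} (h : Γ.Walk (tk s n) p q) :
    ∃ f, f 0 = p ∧ f n = q ∧ Γ.IsPath s f 0 n := by
  induction n generalizing q with
  | zero => exact ⟨fun _ => p, rfl, h, fun j _ _ => by lia⟩
  | succ n ih =>
    rw [tk_succ, walk_append] at h
    obtain ⟨r, h1, r', h2, rfl⟩ := h
    obtain ⟨f, f0, fn, hf⟩ := ih h1
    refine ⟨fun j => if j ≤ n then f j else r', by simp [f0], by simp, fun j h0 hj => ?_⟩
    push_cast at hj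
    simp only
    rcases (show j ≤ n by lia).eq_or_lt with rfl | hj'
    · rw [if_pos le_rfl, if_neg (by lia), fn]
      exact h2
    · rw [if_pos hj'.le, if_pos (by lia)]
      exact hf j h0 hj'

variable (D) in
/-- `Γ'` is a good graph containing `Γ`. -/
structure Extends (Γ Γ' : FoldedGraph α) (f : Γ.V → Γ'.V) : Prop where
  inj : Function.Injective f
  good : Γ'.Good D
  edge : ∀ p σ q, Γ.E p σ q → Γ'.E (f p) σ (f q)

theorem Extends.refl (h : Γ.Good D) : Extends D Γ Γ id :=
  ⟨Function.injective_id, h, fun _ _ _ h => h⟩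

theorem Extends.trans {Γ'' : FoldedGraph α} {f : Γ.V → Γ'.V} {g : Γ'.V → Γ''.V}
    (hf : Extends D Γ Γ' f) (hg : Extends D Γ' Γ'' g) : Extends D Γ Γ'' (g ∘ f) :=
  ⟨hg.inj.comp hf.inj, hg.good, fun _ _ _ h => hg.edge _ _ _ (hf.edge _ _ _ h)⟩

theorem Extends.ext (h : Γ.Good D) : Extends D Γ (FoldedGraph.ext D Γ) fun p => (p, []) :=
  ⟨fun _ _ h => (Prod.mk.inj h).1, h.ext, fun _ _ _ h => .base h⟩

theorem exists_walk (h : Γ.Good D) (w : List (α × Bool)) (p : Γ.V) :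
    ∃ Γ' f q, Extends D Γ Γ' f ∧ Γ'.Walk w (f p) q := by
  induction w generalizing Γ with
  | nil => exact ⟨Γ, id, p, .refl h, rfl⟩
  | cons σ w ih =>
    obtain ⟨y, hy⟩ := ext_complete (D := D) p σ
    obtain ⟨Γ', f, q, hf, hq⟩ := ih h.ext y
    exact ⟨Γ', _, q, (Extends.ext h).trans hf, f y, hf.edge _ _ _ hy, hq⟩

/-- Words that label closed walks everywhere, up to extending the graph. -/
def Trivial (D : SmallCancel α) (w : List (α × Bool)) : Prop :=
  ∀ (Γ : FoldedGraph α) (p : Γ.V), Γ.Good D →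
    ∃ Γ' f, Extends D Γ Γ' f ∧ Γ'.Walk w (f p) (f p)

theorem trivial_tk {s : ℤ → α × Bool} (hs : s ∈ D.lines) : Trivial D (tk s D.L) := by
  intro Γ p h
  obtain ⟨Γ', f, q, hf, hq⟩ := exists_walk h (tk s D.θ) p
  refine ⟨Γ', f, hf, ?_⟩
  obtain ⟨g, g0, -, hg⟩ := hq.exists_isPath
  obtain ⟨k, k0, kp, hk⟩ := hf.good s hs g hg
  have := walk_tk hk D.L
  have h2 := kp 0
  rw [zero_add] at h2
  rwa [h2, k0, g0] at this

/-- The elements of the free group represented by trivial words. -/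
def trivialSubgroup (D : SmallCancel α) : Subgroup (FreeGroup α) where
  carrier := {x | ∃ w, FreeGroup.mk w = x ∧ Trivial D w}
  one_mem' := ⟨[], rfl, fun Γ _ h => ⟨Γ, id, .refl h, rfl⟩⟩
  mul_mem' := by
    rintro _ _ ⟨w, rfl, hw⟩ ⟨w', rfl, hw'⟩
    refine ⟨w ++ w', by simp, fun Γ p h => ?_⟩
    obtain ⟨Γ', f, hf, h1⟩ := hw Γ p h
    obtain ⟨Γ'', g, hg, h2⟩ := hw' Γ' (f p) hf.good
    exact ⟨Γ'', _, hf.trans hg, walk_append.2 ⟨_, h1.map hg.edge, h2⟩⟩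
  inv_mem' := by
    rintro _ ⟨w, rfl, hw⟩
    refine ⟨FreeGroup.invRev w, by simp, fun Γ p h => ?_⟩
    obtain ⟨Γ', f, hf, h1⟩ := hw Γ p h
    exact ⟨Γ', f, hf, h1.symm⟩

instance (D : SmallCancel α) : (trivialSubgroup D).Normal where
  conj_mem := by
    rintro _ ⟨w, rfl, hw⟩ x
    obtain ⟨v, rfl⟩ : ∃ v, FreeGroup.mk v = x := Quot.exists_rep x
    refine ⟨v ++ w ++ FreeGroup.invRev v, by simp, fun Γ p h => ?_⟩
    obtain ⟨Γ', f, q, hf, h1⟩ := exists_walk h v p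
    obtain ⟨Γ'', g, hg, h2⟩ := hw Γ' q hf.good
    exact ⟨Γ'', _, hf.trans hg, walk_append.2 ⟨_, walk_append.2 ⟨_, h1.map hg.edge, h2⟩,
      (h1.map hg.edge).symm⟩⟩

/-- The segment graph labelled by a reduced word. -/
def segment (w : List (α × Bool)) (hw : FreeGroup.IsReduced w) : FoldedGraph α where
  V := ℕ
  E i σ j := (j = i + 1 ∧ w[i]? = some σ) ∨ (i = j + 1 ∧ w[j]? = some (negLetter σ))
  symm := by
    rintro p σ q (⟨h1, h2⟩ | ⟨h1, h2⟩)
    · exact .inr ⟨h1, by simpa using h2⟩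
    · exact .inl ⟨h1, h2⟩
  det := by
    have key : ∀ i σ, w[i]? = some (negLetter σ) → w[i + 1]? = some σ → False := by
      intro i σ h1 h2
      rw [List.getElem?_eq_some_iff] at h1 h2
      obtain ⟨_, h1⟩ := h1
      obtain ⟨h, h2⟩ := h2
      have := List.isChain_iff_getElem.1 hw i h
      rw [h1, h2] at this
      simp [negLetter] at this
    rintro p σ q q' (⟨rfl, h2⟩ | ⟨rfl, h2⟩) (⟨rfl, h2'⟩ | ⟨h1, h2'⟩)
    · rfl
    · subst h1
      exact (key _ _ h2' h2).elim
    · exact (key _ _ h2 h2').elim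
    · lia

theorem infix_of_getElem? {w : List (α × Bool)} {s : ℤ → α × Bool} {n i : ℕ}
    (h : ∀ j < n, w[i + j]? = some (s (j : ℤ))) : tk s n <:+: w := by
  suffices tk s n = (w.drop i).take n from
    this ▸ (List.take_prefix _ _).isInfix.trans (List.drop_suffix _ _).isInfix
  apply List.ext_getElem?
  intro j
  by_cases hj : j < n
  · rw [List.getElem?_take_of_lt hj, List.getElem?_drop, h j hj]
    simp [tk, hj]
  · rw [List.getElem?_eq_none (by simpa using hj), List.getElem?_eq_none (by simp; lia)]

theorem segment_good {w : List (α × Bool)} (hw : FreeGroup.IsReduced w)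
    (h : ∀ s ∈ D.lines, ¬ tk s D.θ <:+: w) : (segment w hw).Good D := by
  intro s hs f hf
  exfalso
  have h2 := D.two_le
  have h3 := D.two_mul_le
  have back : ∀ j : ℤ, 0 ≤ j → j + 1 < D.θ → f (j + 1 + 1) ≠ f j := by
    intro j h0 hj e
    have e1 := (segment w hw).symm (hf j h0 (by lia))
    have e2 := hf (j + 1) (by lia) (by lia)
    have : s (j + 1) = negLetter (s j) := by
      rw [e] at e2
      rcases e1 with ⟨e3, e4⟩ | ⟨e3, e4⟩ <;> rcases e2 with ⟨e5, e6⟩ | ⟨e5, e6⟩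
      · rw [e4] at e6
        exact (Option.some.inj e6).symm
      · exact absurd e3 (by rw [e5]; exact (Nat.lt_succ_of_lt (Nat.lt_succ_self _)).ne)
      · exact absurd e3 (by rw [e5]; exact (Nat.lt_succ_of_lt (Nat.lt_succ_self _)).ne)
      · rw [e4] at e6
        exact (negLetter_injective (Option.some.inj e6)).symm
    exact D.reduced s hs j this
  let F : ℤ → ℕ := f
  rcases hf 0 le_rfl (by lia) with ⟨e1, e2⟩ | ⟨e1, e2⟩
  · have up : ∀ j : ℕ, j < D.θ → F (j + 1) = F j + 1 ∧ w[F j]? = some (s j) := by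
      intro j
      induction j with
      | zero => exact fun _ => ⟨e1, e2⟩
      | succ j ih =>
        intro hj
        have i1 := (ih (by lia)).1
        have b : F (j + 1 + 1) ≠ F j := back j (by lia) (by lia)
        push_cast
        rcases hf (j + 1) (by lia) (by lia) with ⟨e3, e4⟩ | ⟨e3, e4⟩
        · exact ⟨e3, e4⟩
        · exact absurd (Nat.succ.inj (e3.symm.trans i1)) b
    have pos : ∀ j : ℕ, j < D.θ → F j = F 0 + j := by
      intro j
      induction j with
      | zero => exact fun _ => rfl
      | succ j ih =>
        intro hj
        have := (up j (by lia)).1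
        rw [ih (by lia)] at this
        push_cast
        rw [this]
        rfl
    refine h s hs (infix_of_getElem? (i := F 0) fun j hj => ?_)
    rw [← pos j hj]
    exact (up j hj).2
  · have up : ∀ j : ℕ, j < D.θ → F j = F (j + 1) + 1 ∧ w[F (j + 1)]? = some (negLetter (s j)) := by
      intro j
      induction j with
      | zero => exact fun _ => ⟨e1, e2⟩
      | succ j ih =>
        intro hj
        have i1 := (ih (by lia)).1
        have b : F (j + 1 + 1) ≠ F j := back j (by lia) (by lia)
        push_cast
        rcases hf (j + 1) (by lia) (by lia) with ⟨e3, e4⟩ | ⟨e3, e4⟩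
        · exact absurd (e3.trans i1.symm) b
        · exact ⟨e3, e4⟩
    have pos : ∀ j : ℕ, j ≤ D.θ → F j + j = F 0 := by
      intro j
      induction j with
      | zero => exact fun _ => rfl
      | succ j ih =>
        intro hj
        have := (up j (by lia)).1
        have := ih (by lia)
        push_cast
        lia
    have pθ := pos D.θ le_rfl
    refine h _ (D.rev s hs (D.θ - 1)) (infix_of_getElem? (i := F D.θ) fun j hj => ?_)
    have p1 := pos (D.θ - j) (by lia)
    have := (up (D.θ - 1 - j) (by lia)).2
    rw [show ((D.θ - 1 - j : ℕ) : ℤ) + 1 = ((D.θ - j : ℕ) : ℤ) by lia,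
      show F ((D.θ - j : ℕ) : ℤ) = F D.θ + j by lia,
      show ((D.θ - 1 - j : ℕ) : ℤ) = D.θ - 1 - j by lia] at this
    exact this

theorem segment_walk {w : List (α × Bool)} (hw : FreeGroup.IsReduced w) :
    (segment w hw).Walk w (0 : ℕ) w.length := by
  have : ∀ u v : List (α × Bool), w = u ++ v →
      (segment w hw).Walk v u.length w.length := by
    intro u v
    induction v generalizing u with
    | nil => rintro rfl; simp only [List.append_nil]; rfl
    | cons σ v ih =>
      rintro h
      refine ⟨(u.length + 1 : ℕ), .inl ⟨rfl, by simp [h]⟩, ?_⟩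
      simpa using ih (u ++ [σ]) (by simpa using h)
  exact this [] w rfl

/-- A nontrivial reduced word without a long factor of a relator is not a consequence of the
relators. -/
theorem notMem_normalClosure [DecidableEq α] {R : Set (FreeGroup α)}
    (hR : ∀ r ∈ R, ∃ s ∈ D.lines, FreeGroup.mk (tk s D.L) = r)
    {w : List (α × Bool)} (hw : FreeGroup.IsReduced w) (hw0 : w ≠ [])
    (h : ∀ s ∈ D.lines, ¬ tk s D.θ <:+: w) : FreeGroup.mk w ∉ Subgroup.normalClosure R := by
  intro hmem
  have hle : Subgroup.normalClosure R ≤ trivialSubgroup D := by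
    refine Subgroup.normalClosure_le_normal fun r hr => ?_
    obtain ⟨s, hs, rfl⟩ := hR r hr
    exact ⟨_, rfl, trivial_tk hs⟩
  obtain ⟨v, hv, ht⟩ := hle hmem
  obtain ⟨Γ', f, hf, h1⟩ := ht (segment w hw) (0 : ℕ) (segment_good hw h)
  have hred : FreeGroup.Red v w := by
    have := FreeGroup.reduce.sound hv
    rw [hw.reduce_eq] at this
    exact this ▸ FreeGroup.reduce.red
  have := (h1.red hred).unique ((segment_walk hw).map hf.edge)
  exact hw0 (List.length_eq_zero_iff.1 (hf.inj this).symm)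

end FoldedGraph

/-- The kinds of letters in a relator of `K`. -/
inductive Kind : Type
  | base : Kind
  | edge : Kind
  | target : Kind
  deriving DecidableEq

/-- The sequence of kinds of letters of a relator of `K`. -/
def kinds : List Kind :=
  ((List.range 100).flatMap fun k => List.replicate (k + 1) Kind.base ++ [Kind.edge]) ++ [Kind.target]

theorem length_kinds : kinds.length = 5151 := by decide +kernel

/-- The periodic sequence of kinds. -/
def kindAt (j : ℤ) : Kind := kinds.getD (j % 5151).toNat Kind.base

theorem kindAt_add_period (j : ℤ) : kindAt (j + 5151) = kindAt j := by
  simp [kindAt]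

theorem kindAt_eq {j : ℕ} (hj : j < 5151) : kindAt j = kinds[j]'(length_kinds ▸ hj) := by
  have : ((j : ℤ) % 5151).toNat = j := by lia
  rw [kindAt, this, List.getD_eq_getElem _ _ (length_kinds ▸ hj)]

theorem kindAt_of_emod_eq {i j : ℤ} (h : i % 5151 = j % 5151) : kindAt i = kindAt j := by
  rw [kindAt, h, kindAt]

/-- The number with the given binary digits. -/
def bitsNat : List Bool → ℕ
  | [] => 0
  | b :: l => Nat.bit b (bitsNat l)

theorem testBit_bitsNat (l : List Bool) (k : ℕ) : (bitsNat l).testBit k = l.getD k false := by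
  induction l generalizing k with
  | nil => simp [bitsNat]
  | cons b l ih =>
    cases k with
    | zero => simp [bitsNat]
    | succ k => simp [bitsNat, Nat.testBit_bit_succ, ih]

/-- The positions of the letters of the kinds selected by `f` in two periods. -/
def kindBits (f : Kind → Bool) : ℕ := bitsNat ((kinds ++ kinds).map f)

theorem testBit_kindBits (f : Kind → Bool) {k : ℕ} (hk : k < 10302) :
    (kindBits f).testBit k = f (kindAt k) := by
  have hl := length_kinds
  rw [kindBits, testBit_bitsNat, List.getD_eq_getElem _ _ (by simp [hl, hk]), List.getElem_map]
  congr 1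
  rcases lt_or_ge k 5151 with h | h
  · rw [kindAt_eq h, List.getElem_append_left]
  · obtain ⟨m, rfl⟩ := Nat.exists_eq_add_of_le' h
    push_cast
    rw [kindAt_add_period, kindAt_eq (by lia), List.getElem_append_right (by lia)]
    simp [hl]

/-- The part of `kindBits f` seen through a window of length `400` starting at `i`. -/
def window (f : Kind → Bool) (i : ℕ) : ℕ := (kindBits f >>> i) % 2 ^ 400

theorem testBit_window (f : Kind → Bool) {i j : ℕ} (hi : i < 5151) (hj : j < 400) :
    (window f i).testBit j = f (kindAt (j + i)) := by
  rw [window, Nat.testBit_mod_two_pow, Nat.testBit_shiftRight, testBit_kindBits _ (by lia)]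
  simp [hj, add_comm]

/-- The position of the lowest nonzero binary digit. -/
def lowBit (n : ℕ) : ℕ := Nat.log2 (n ^^^ (n - 1))

/-- The position in the relator recovered from a window. -/
def locate (w : ℕ) : ℕ :=
  let p := lowBit w
  let q := lowBit (w >>> (p + 1))
  (match q with
    | 0 => 10300
    | 1 => 10301
    | q + 2 => 5151 + (q + 1) * (q + 4) / 2 - 1) - p

theorem locate_window : (List.range 5151).all
    (fun i => locate (window (fun k => !decide (k = Kind.base)) i) % 5151 == i) = true := by
  decide +kernel

theorem window_ne_zero : (List.range 5151).all (fun i =>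
    !(window (fun k => decide (k = Kind.base)) i == 0) &&
      !(window (fun k => decide (k = Kind.edge)) i == 0)) = true := by
  decide +kernel

theorem exists_shift_mem_range (c : ℤ) : ∃ i : ℕ, i < 5151 ∧ ∀ j : ℤ, kindAt (j + c) = kindAt (j + i) :=
  ⟨(c % 5151).toNat, by lia, fun j => kindAt_of_emod_eq (by lia)⟩

theorem exists_kindAt {t : Kind} (ht : t = .base ∨ t = .edge) (c : ℤ) :
    ∃ j : ℤ, 0 ≤ j ∧ j < 400 ∧ kindAt (j + c) = t := by
  obtain ⟨i, hi, h⟩ := exists_shift_mem_range c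
  have h0 : window (fun k => decide (k = t)) i ≠ 0 := by
    have := List.all_eq_true.1 window_ne_zero i (List.mem_range.2 hi)
    simp only [Bool.and_eq_true, Bool.not_eq_true', beq_eq_false_iff_ne] at this
    rcases ht with rfl | rfl
    · exact this.1
    · exact this.2
  obtain ⟨j, hj⟩ := Nat.exists_testBit_of_ne_zero h0
  have hj' : j < 400 := by
    by_contra hlt
    rw [window, Nat.testBit_mod_two_pow] at hj
    simp [hlt] at hj
  rw [testBit_window _ hi hj'] at hj
  exact ⟨j, by lia, by lia, by rw [h]; simpa using hj⟩

theorem kindAt_injective {c c' : ℤ}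
    (h : ∀ j : ℤ, 0 ≤ j → j < 400 → kindAt (j + c) = kindAt (j + c')) (j : ℤ) :
    kindAt (j + c) = kindAt (j + c') := by
  obtain ⟨i, hi, h1⟩ := exists_shift_mem_range c
  obtain ⟨i', hi', h1'⟩ := exists_shift_mem_range c'
  suffices i = i' by rw [h1, h1', this]
  have hw : window (fun k => !decide (k = Kind.base)) i =
      window (fun k => !decide (k = Kind.base)) i' := by
    apply Nat.eq_of_testBit_eq
    intro j
    by_cases hj : j < 400
    · rw [testBit_window _ hi hj, testBit_window _ hi' hj, ← h1, ← h1', h j (by lia) (by lia)]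
    · rw [window, window, Nat.testBit_mod_two_pow, Nat.testBit_mod_two_pow]
      simp [hj]
  have h2 := List.all_eq_true.1 locate_window i (List.mem_range.2 hi)
  have h2' := List.all_eq_true.1 locate_window i' (List.mem_range.2 hi')
  rw [beq_iff_eq] at h2 h2'
  rw [← h2, ← h2', hw]

theorem edge_not_consecutive : (kindBits (fun k => decide (k = Kind.edge)) &&&
    kindBits (fun k => decide (k = Kind.edge)) >>> 1) = 0 := by
  decide +kernel

theorem kindAt_edge {c : ℤ} (h : kindAt c = .edge) : kindAt (c + 1) ≠ .edge := by
  intro h'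
  obtain ⟨i, hi, h1⟩ := exists_shift_mem_range c
  have h2 := h1 0
  have h3 := h1 1
  rw [zero_add] at h2
  rw [add_comm, h'] at h3
  rw [h, zero_add] at h2
  have := congrArg (Nat.testBit · i) edge_not_consecutive
  simp only [Nat.testBit_land, Nat.testBit_shiftRight, Nat.zero_testBit] at this
  rw [testBit_kindBits _ (by lia), testBit_kindBits _ (by lia)] at this
  push_cast at this
  rw [← h2, ← h3] at this
  simp at this

/-- The data determining a relator of `K`: a vertex and an edge letter. -/
abbrev RelData := (ℕ × List ℤ) × Option ℤ

/-- The letter `x` of the relator `u(x, y) z⁻¹`. -/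
def RelData.base (d : RelData) : KGen := .vert d.1.1 d.1.2

/-- The letter `y` of the relator `u(x, y) z⁻¹`. -/
def RelData.edge (d : RelData) : KGen := d.2.elim .a .b

/-- The letter `z` of the relator `u(x, y) z⁻¹`. -/
def RelData.target (d : RelData) : KGen :=
  d.2.elim (.vert (parent d.1.1 d.1.2).1 (parent d.1.1 d.1.2).2) fun i => .vert d.1.1 (d.1.2 ++ [i])

theorem RelData.ext {d d' : RelData} (h : d.base = d'.base) (h' : d.edge = d'.edge) : d = d' := by
  obtain ⟨⟨n, τ⟩, o⟩ := d
  obtain ⟨⟨n', τ'⟩, o'⟩ := d'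
  cases o <;> cases o' <;> simp_all [RelData.base, RelData.edge]

theorem RelData.target_ne_base (d : RelData) : d.target ≠ d.base := by
  obtain ⟨⟨n, τ⟩, o⟩ := d
  cases o with
  | some i => simp [RelData.base, RelData.target]
  | none =>
    cases τ with
    | nil => simp [RelData.base, RelData.target, parent]
    | cons i τ =>
      simp only [RelData.base, RelData.target, parent, Option.elim, ne_eq, KGen.vert.injEq, true_and]
      intro h
      have := congrArg List.length h
      simp at this

/-- The letter of the given kind. -/
def RelData.letter (d : RelData) : Kind → KGen × Bool
  | .base => (d.base, true)
  | .edge => (d.edge, true)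
  | .target => (d.target, false)

theorem exists_target_eq (d : RelData) : ∃ n τ, d.target = .vert n τ := by
  obtain ⟨⟨n, τ⟩, o⟩ := d
  cases o <;> exact ⟨_, _, rfl⟩

theorem edge_ne_vert (d : RelData) (n : ℕ) (τ : List ℤ) : d.edge ≠ .vert n τ := by
  obtain ⟨⟨n, τ⟩, o⟩ := d
  cases o <;> simp [RelData.edge]

theorem kind_eq_of_letter_eq {d d' : RelData} {t t' : Kind} (h : d.letter t = d'.letter t') :
    t = t' := by
  have h1 : d.base ≠ d'.edge := (edge_ne_vert d' _ _).symm
  have h2 : d.edge ≠ d'.base := edge_ne_vert d _ _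
  cases t <;> cases t' <;> simp_all [RelData.letter]

theorem letter_ne_neg (d : RelData) (t t' : Kind) : d.letter t ≠ negLetter (d.letter t') := by
  have h1 := d.target_ne_base
  have h2 : d.edge ≠ d.target := by
    obtain ⟨n, τ, h⟩ := exists_target_eq d
    rw [h]
    exact edge_ne_vert d _ _
  cases t <;> cases t' <;> simp [RelData.letter, negLetter, h1, h1.symm, h2, h2.symm]

theorem letter_edge_ne_neg (d d' : RelData) (t : Kind) : d.letter .edge ≠ negLetter (d'.letter t) := by
  obtain ⟨n, τ, h⟩ := exists_target_eq d'
  have := edge_ne_vert d n τ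
  cases t <;> simp [RelData.letter, negLetter, h, this]

/-- The relator word of `K` with the given data. -/
def RelData.rel (d : RelData) : Word KGen := uWord d.base d.edge ++ [(d.target, false)]

theorem RelData.rel_eq (d : RelData) : d.rel = kinds.map d.letter := by
  simp [RelData.rel, uWord, kinds, List.map_flatMap, RelData.letter]

theorem mem_KRelWords {w : Word KGen} : w ∈ KRelWords ↔ ∃ d : RelData, w = d.rel := by
  constructor
  · rintro (⟨n, τ, rfl⟩ | ⟨n, τ, i, rfl⟩)
    · exact ⟨((n, τ), none), rfl⟩
    · exact ⟨((n, τ), some i), rfl⟩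
  · rintro ⟨⟨⟨n, τ⟩, _ | i⟩, rfl⟩
    · exact .inl ⟨n, τ, rfl⟩
    · exact .inr ⟨n, τ, i, rfl⟩

/-- The biinfinite periodic word of a relator. -/
def RelData.line (d : RelData) (j : ℤ) : KGen × Bool := d.letter (kindAt j)

theorem exists_kindAt_line {d d' : RelData} {c c' : ℤ}
    (h : ∀ j : ℤ, 0 ≤ j → j < 400 → d.line (j + c) = d'.line (j + c')) (j : ℤ) :
    d.line (j + c) = d'.line (j + c') := by
  have hk : ∀ j : ℤ, 0 ≤ j → j < 400 → kindAt (j + c) = kindAt (j + c') :=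
    fun j h0 hj => kind_eq_of_letter_eq (h j h0 hj)
  have hd : d = d' := by
    obtain ⟨j, h0, hj, e⟩ := exists_kindAt (.inl rfl) c
    obtain ⟨j', h0', hj', e'⟩ := exists_kindAt (.inr rfl) c
    have h1 := h j h0 hj
    have h2 := h j' h0' hj'
    rw [RelData.line, RelData.line, ← hk _ h0 hj, e] at h1
    rw [RelData.line, RelData.line, ← hk _ h0' hj', e'] at h2
    exact RelData.ext (Prod.mk.inj h1).1 (Prod.mk.inj h2).1
  rw [hd, RelData.line, RelData.line, kindAt_injective hk j]

/-- The small cancellation data of the presentation of `K`. -/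
def kCancel : SmallCancel KGen where
  lines := {s | (∃ (d : RelData) (c : ℤ), s = fun j => d.line (j + c)) ∨
    ∃ (d : RelData) (c : ℤ), s = fun j => negLetter (d.line (c - j))}
  pos s := ∃ (d : RelData) (c : ℤ), s = fun j => d.line (j + c)
  L := 5151
  P := 400
  θ := 3000
  two_le := by norm_num
  two_mul_le := by norm_num
  le_period := by norm_num
  shift := by
    rintro _ (⟨d, c', rfl⟩ | ⟨d, c', rfl⟩) c
    · exact .inl ⟨d, c + c', by simp only [add_assoc]⟩
    · exact .inr ⟨d, c' - c, by funext j; ring_nf⟩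
  rev := by
    rintro _ (⟨d, c', rfl⟩ | ⟨d, c', rfl⟩) c
    · exact .inr ⟨d, c + c', by funext j; ring_nf⟩
    · exact .inl ⟨d, c' - c, by funext j; simp only [negLetter_negLetter]; congr 1; ring⟩
  pos_rev := by
    have key : ∀ (d d' : RelData) (c c' : ℤ),
        (fun j => d.line (j + c)) ≠ fun j => negLetter (d'.line (c' - j)) := by
      intro d d' c c' h
      obtain ⟨j, -, -, e⟩ := exists_kindAt (.inr rfl) c
      have := congrFun h j
      simp only [RelData.line, e] at this
      exact letter_edge_ne_neg _ _ _ this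
    rintro _ (⟨d, c', rfl⟩ | ⟨d, c', rfl⟩) c
    · constructor
      · rintro ⟨d', c'', h⟩
        refine (key d' d c'' (c + c') (h.symm.trans ?_)).elim
        funext j; ring_nf
      · intro h
        exact absurd ⟨d, c', rfl⟩ h
    · constructor
      · rintro - ⟨d', c'', h⟩
        exact key _ _ _ _ h.symm
      · intro h
        exact ⟨d, c' - c, by funext j; simp only [negLetter_negLetter]; congr 1; ring⟩
  period := by
    rintro _ (⟨d, c, rfl⟩ | ⟨d, c, rfl⟩) j
    · simp only [RelData.line]
      congr 1
      exact kindAt_of_emod_eq (by push_cast; lia)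
    · simp only [RelData.line]
      congr 2
      exact kindAt_of_emod_eq (by push_cast; lia)
  reduced := by
    rintro _ (⟨d, c, rfl⟩ | ⟨d, c, rfl⟩) j
    · exact letter_ne_neg _ _ _
    · rw [negLetter_injective.ne_iff]
      exact letter_ne_neg _ _ _
  piece := by
    have key : ∀ (d d' : RelData) (c c' : ℤ),
        ¬ ∀ j : ℤ, 0 ≤ j → j < (400 : ℕ) → d.line (j + c) = negLetter (d'.line (c' - j)) := by
      intro d d' c c' h
      obtain ⟨j, h0, hj, e⟩ := exists_kindAt (.inr rfl) c
      have := h j h0 hj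
      simp only [RelData.line, e] at this
      exact letter_edge_ne_neg _ _ _ this
    rintro _ (⟨d, c, rfl⟩ | ⟨d, c, rfl⟩) _ (⟨d', c', rfl⟩ | ⟨d', c', rfl⟩) h
    · funext j
      exact exists_kindAt_line h j
    · exact (key _ _ _ _ h).elim
    · exact (key _ _ _ _ fun j h0 hj => (h j h0 hj).symm).elim
    · funext j
      congr 1
      have := exists_kindAt_line (d := d) (d' := d') (c := c - 399) (c' := c' - 399)
        (fun j h0 hj => ?_) (399 - j)
      · simpa [sub_add_sub_cancel', add_comm] using this
      · have := negLetter_injective (h (399 - j) (by lia) (by push_cast; lia))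
        simpa [← sub_add, sub_add_eq_add_sub, add_comm, add_sub_assoc] using this

theorem tk_infix_append {α : Type} {s : ℤ → α × Bool} {n : ℕ} {u v : List (α × Bool)}
    (h : FoldedGraph.tk s n <:+: u ++ v) : ∃ m ≤ n, FoldedGraph.tk s m <:+: u ∧
      FoldedGraph.tk (fun j => s (j + m)) (n - m) <:+: v := by
  suffices ∃ l₁ l₂, FoldedGraph.tk s n = l₁ ++ l₂ ∧ l₁ <:+: u ∧ l₂ <:+: v by
    obtain ⟨l₁, l₂, e, h1, h2⟩ := this
    obtain ⟨e1, e2⟩ := FoldedGraph.tk_eq_append e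
    rw [e1] at e h1
    have e3 := FoldedGraph.tk_append e
    exact ⟨_, e2, h1, e3 ▸ h2⟩
  obtain ⟨a, b, h⟩ := h
  rw [List.append_assoc] at h
  rcases List.append_eq_append_iff.1 h with ⟨c, rfl, h2⟩ | ⟨c, rfl, h2⟩
  · rcases List.append_eq_append_iff.1 h2 with ⟨d, rfl, h3⟩ | ⟨d, h3, h4⟩
    · exact ⟨FoldedGraph.tk s n, [], by simp, ⟨a, d, by simp⟩, List.nil_infix⟩
    · exact ⟨c, d, h3, ⟨a, [], by simp⟩, ⟨[], b, by simp [h4]⟩⟩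
  · exact ⟨[], FoldedGraph.tk s n, rfl, List.nil_infix, ⟨c, b, by simp [h2]⟩⟩

theorem tk_prefix_tk {α : Type} (s : ℤ → α × Bool) {m n : ℕ} (h : m ≤ n) :
    FoldedGraph.tk s m <+: FoldedGraph.tk s n := by
  obtain ⟨k, rfl⟩ := Nat.exists_eq_add_of_le h
  simp [FoldedGraph.tk, List.range_add]

open FoldedGraph

/-- The letter is one of the `bᵢ` or its inverse. -/
def IsB (x : KGen × Bool) : Prop := ∃ i, x.1 = .b i

theorem not_isB_letter {d : RelData} {t : Kind} (h : IsB (d.letter t)) : t = .edge := by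
  obtain ⟨i, h⟩ := h
  obtain ⟨n, τ, h'⟩ := exists_target_eq d
  cases t <;> simp_all [RelData.letter, RelData.base]

theorem isB_negLetter {x : KGen × Bool} : IsB (negLetter x) ↔ IsB x := Iff.rfl

theorem not_isB_isB {s : ℤ → KGen × Bool} (hs : s ∈ kCancel.lines) (j : ℤ) (h : IsB (s j)) :
    ¬ IsB (s (j + 1)) := by
  intro h'
  rcases hs with ⟨d, c, rfl⟩ | ⟨d, c, rfl⟩
  · exact kindAt_edge (not_isB_letter h) (by simpa [add_right_comm] using not_isB_letter h')
  · have h1 := not_isB_letter (isB_negLetter.1 h)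
    have h2 := not_isB_letter (isB_negLetter.1 h')
    exact kindAt_edge h2 (by simpa [← sub_sub] using h1)

theorem RelData.rel_eq_tk (d : RelData) : d.rel = tk d.line 5151 := by
  rw [d.rel_eq]
  apply List.ext_getElem (by simp [length_kinds])
  intro i h1 h2
  simp only [length_tk] at h2
  simp [tk, RelData.line, kindAt_eq h2]

/-- The element of `K` represented by a word. -/
abbrev kVal (w : Word KGen) : K := QuotientGroup.mk (FreeGroup.mk w)

theorem kVal_append (u v : Word KGen) : kVal (u ++ v) = kVal u * kVal v := by
  rw [kVal, ← FreeGroup.mul_mk]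
  rfl

/-- The word contains no long segment of a relator. -/
def NoSeg (m : ℕ) (w : Word KGen) : Prop := ∀ s ∈ kCancel.lines, ¬ tk s m <:+: w

theorem NoSeg.subword {m : ℕ} {w w' : Word KGen} (h : NoSeg m w) (h' : w' <:+: w) : NoSeg m w' :=
  fun s hs h2 => h s hs (h2.trans h')

theorem kVal_ne_one {w : Word KGen} (hw : FreeGroup.IsReduced w) (hw0 : w ≠ [])
    (h : NoSeg 3000 w) : kVal w ≠ 1 := by
  intro h1
  refine notMem_normalClosure (D := kCancel) (R := KRels) ?_ hw hw0 h
    ((QuotientGroup.eq_one_iff _).1 h1)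
  rintro _ ⟨w, hw, rfl⟩
  obtain ⟨d, rfl⟩ := mem_KRelWords.1 hw
  exact ⟨d.line, .inl ⟨d, 0, by simp⟩, by rw [d.rel_eq_tk]; rfl⟩

theorem kVal_append_ne_one {k v : Word KGen} (h : FreeGroup.IsReduced (k ++ v)) (h0 : k ++ v ≠ [])
    (hk : NoSeg 2600 k) (hv : ∀ x ∈ v, IsB x) : kVal (k ++ v) ≠ 1 := by
  refine kVal_ne_one h h0 fun s hs hi => ?_
  obtain ⟨m, hm, h1, h2⟩ := tk_infix_append hi
  have hm' : m < 2600 := by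
    by_contra hlt
    exact hk s hs ((tk_prefix_tk s (by lia)).isInfix.trans h1)
  have hb : ∀ i < 3000 - m, IsB (s (i + m)) := fun i hi =>
    hv _ (h2.subset (List.mem_map.2 ⟨i, List.mem_range.2 hi, rfl⟩))
  have b0 := hb 0 (by lia)
  have b1 := hb 1 (by lia)
  refine not_isB_isB hs m (by simpa using b0) (by simpa [add_comm] using b1)

/-- The homomorphism from the free group on the `bᵢ` to `K`. -/
def bHom : FreeGroup ℤ →* K := FreeGroup.lift fun i => PresentedGroup.of (.b i)

/-- The word in the `bᵢ` corresponding to a word in the indices. -/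
def bWord (v : Word ℤ) : Word KGen := v.map fun x => (.b x.1, x.2)

theorem bHom_mk (v : Word ℤ) : bHom (FreeGroup.mk v) = kVal (bWord v) := by
  have : bHom = (QuotientGroup.mk' _).comp (FreeGroup.map KGen.b) := by
    ext i
    simp [bHom]
    rfl
  rw [this]
  rfl

theorem isB_of_mem_bWord {v : Word ℤ} {x : KGen × Bool} (hx : x ∈ bWord v) : IsB x := by
  obtain ⟨y, -, rfl⟩ := List.mem_map.1 hx
  exact ⟨_, rfl⟩

theorem isReduced_bWord {v : Word ℤ} (h : FreeGroup.IsReduced v) : FreeGroup.IsReduced (bWord v) := by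
  unfold FreeGroup.IsReduced bWord at *
  rw [List.isChain_map]
  simpa using h

theorem bHom_injective : Function.Injective bHom := by
  rw [injective_iff_map_eq_one]
  intro x hx
  by_contra h
  have hx' : bHom (FreeGroup.mk x.toWord) = 1 := by rw [FreeGroup.mk_toWord, hx]
  rw [bHom_mk] at hx'
  refine kVal_append_ne_one (k := []) (v := bWord x.toWord)
    (isReduced_bWord FreeGroup.isReduced_toWord) ?_ ?_ (fun _ => isB_of_mem_bWord) hx'
  · simpa [bWord] using h
  · intro s hs hi
    have := hi.length_le
    simp at this

theorem isB_of_mem_range {k : Word KGen} (hk : FreeGroup.IsReduced k) (hs : NoSeg 2600 k)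
    (hr : kVal k ∈ bHom.range) : ∀ x ∈ k, IsB x := by
  induction k using List.reverseRecOn with
  | nil => simp
  | append_singleton k x ih =>
    have hb : IsB x := by
      by_contra hx
      obtain ⟨v, hv⟩ := hr
      have h1 : bHom (FreeGroup.mk v⁻¹.toWord) = bHom v⁻¹ := by rw [FreeGroup.mk_toWord]
      rw [bHom_mk, map_inv] at h1
      refine kVal_append_ne_one (k := k ++ [x]) (v := bWord v⁻¹.toWord) ?_ (by simp) hs
        (fun _ => isB_of_mem_bWord) (by rw [kVal_append, h1, hv, mul_inv_cancel])
      refine List.IsChain.append hk (isReduced_bWord FreeGroup.isReduced_toWord) ?_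
      intro a ha b hb' hab
      simp only [List.getLast?_append, List.getLast?_singleton, Option.some_or, Option.mem_def,
        Option.some.injEq] at ha
      subst ha
      obtain ⟨i, hi⟩ := isB_of_mem_bWord (List.mem_of_mem_head? hb')
      exact absurd ⟨i, hab.trans hi⟩ hx
    have hx : kVal [x] ∈ bHom.range := by
      obtain ⟨i, hi⟩ := hb
      refine ⟨FreeGroup.mk [(i, x.2)], ?_⟩
      rw [bHom_mk, bWord, List.map_singleton, ← hi]
    rw [kVal_append] at hr
    have := ih (hk.infix (List.prefix_append _ _).isInfix) (hs.subword (List.prefix_append _ _).isInfix)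
      ((Subgroup.mul_mem_cancel_right _ hx).1 hr)
    intro y hy
    rcases List.mem_append.1 hy with hy | hy
    · exact this y hy
    · rw [List.mem_singleton.1 hy]
      exact hb

/-- The element of `G` represented by a word. -/
abbrev gVal (w : Word GGen) : G := QuotientGroup.mk (FreeGroup.mk w)

theorem gVal_append (u v : Word GGen) : gVal (u ++ v) = gVal u * gVal v := by
  rw [gVal, ← FreeGroup.mul_mk]
  rfl

/-- A word in the generators of `K` as a word in the generators of `G`. -/
def kWord (w : Word KGen) : Word GGen := w.map fun p => (some p.1, p.2)

@[simp] theorem kWord_append (u v : Word KGen) : kWord (u ++ v) = kWord u ++ kWord v :=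
  List.map_append

@[simp] theorem length_kWord (w : Word KGen) : (kWord w).length = w.length := List.length_map _

/-- The canonical homomorphism from `K` to `G`. -/
def kToG : K →* G := PresentedGroup.toGroup (f := fun x => PresentedGroup.of (some x)) (by
  have : (FreeGroup.lift fun x : KGen => (PresentedGroup.of (some x) : G)) =
      (QuotientGroup.mk' _).comp (FreeGroup.map some) := by
    ext x
    simp
    rfl
  rintro _ ⟨w, hw, rfl⟩
  rw [this]
  exact (QuotientGroup.eq_one_iff _).2 (Subgroup.subset_normalClosure ⟨kWord w, .inl ⟨w, hw, rfl⟩, rfl⟩))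

theorem kToG_of (x : KGen) : kToG (PresentedGroup.of x) = PresentedGroup.of (some x) :=
  PresentedGroup.toGroup.of ..

theorem kToG_kVal (w : Word KGen) : kToG (kVal w) = gVal (kWord w) := by
  have : kToG.comp (QuotientGroup.mk' _) = (QuotientGroup.mk' _).comp (FreeGroup.map some) := by
    ext x
    exact kToG_of x
  exact DFunLike.congr_fun this (FreeGroup.mk w)

theorem kVal_rel (d : RelData) : kVal d.rel = 1 :=
  (QuotientGroup.eq_one_iff _).2
    (Subgroup.subset_normalClosure ⟨_, mem_KRelWords.2 ⟨d, rfl⟩, rfl⟩)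

theorem tk_add {α : Type} (s : ℤ → α × Bool) (m n : ℕ) :
    tk s (m + n) = tk s m ++ tk (fun j => s (j + m)) n := by
  simp [tk, List.range_add, Function.comp_def, add_comm]

theorem kVal_invRev (w : Word KGen) : kVal (FreeGroup.invRev w) = (kVal w)⁻¹ := by
  rw [kVal, ← FreeGroup.inv_mk]
  rfl

theorem kVal_line (d : RelData) (c : ℤ) : kVal (tk (fun j => d.line (j + c)) 5151) = 1 := by
  obtain ⟨n, hn⟩ : ∃ n : ℕ, (fun j => d.line (j + c)) = fun j => d.line (j + n) :=
    ⟨(c % 5151).toNat, by funext j; exact congrArg d.letter (kindAt_of_emod_eq (by lia))⟩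
  have h1 := tk_add d.line n 5151
  rw [add_comm, tk_add] at h1
  have hp : (fun j => d.line (j + (5151 : ℕ))) = d.line :=
    funext fun j => congrArg d.letter (kindAt_of_emod_eq (by push_cast; lia))
  have h2 := congrArg kVal h1
  rw [kVal_append, kVal_append, ← d.rel_eq_tk, hp, kVal_rel, one_mul, eq_comm, mul_eq_left] at h2
  rw [hn, h2]

theorem tk_neg {α : Type} (s : ℤ → α × Bool) (c : ℤ) (n : ℕ) :
    tk (fun j => negLetter (s (c - j))) n =
      FreeGroup.invRev (tk (fun j => s (j + (c - n + 1))) n) := by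
  apply List.ext_getElem (by simp [FreeGroup.invRev_length])
  intro i h1 h2
  simp only [length_tk] at h1
  simp only [tk, FreeGroup.invRev, List.getElem_map, List.getElem_range, List.getElem_reverse,
    List.length_map, List.length_range, negLetter]
  rw [show ((n - 1 - i : ℕ) : ℤ) + (c - n + 1) = c - i by lia]

theorem kVal_tk_period {s : ℤ → KGen × Bool} (hs : s ∈ kCancel.lines) : kVal (tk s 5151) = 1 := by
  rcases hs with ⟨d, c, rfl⟩ | ⟨d, c, rfl⟩
  · exact kVal_line d c
  · rw [tk_neg, kVal_invRev, kVal_line, inv_one]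

theorem exists_shorter_of_seg {a b : Word GGen} {s : ℤ → KGen × Bool} (hs : s ∈ kCancel.lines) :
    ∃ w : Word GGen, w.length < (a ++ kWord (tk s 2600) ++ b).length ∧
      gVal w = gVal (a ++ kWord (tk s 2600) ++ b) := by
  have h := tk_add s 2600 2551
  have h1 := congrArg kVal h
  rw [kVal_append, kVal_tk_period hs, eq_comm, mul_eq_one_iff_eq_inv, ← kVal_invRev] at h1
  refine ⟨a ++ kWord (FreeGroup.invRev (tk (fun j => s (j + (2600 : ℕ))) 2551)) ++ b, ?_, ?_⟩
  · simp [FreeGroup.invRev_length]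
  · simp only [gVal_append, ← kToG_kVal, h1]

theorem gt_conj (i : ℤ) : gt' * gb i * gt'⁻¹ = gb (i + 1) := by
  have : FreeGroup.mk [((none : GGen), true), (some (KGen.b i), true), ((none : GGen), false),
      (some (KGen.b (i + 1)), false)] ∈ Subgroup.normalClosure GRels :=
    Subgroup.subset_normalClosure ⟨_, .inr ⟨i, rfl⟩, rfl⟩
  have h := (QuotientGroup.eq_one_iff _).2 this
  rw [← mul_inv_eq_one]
  exact h

theorem gt_conj_bHom (x : FreeGroup ℤ) : gt' * kToG (bHom x) * gt'⁻¹ =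
    kToG (bHom (FreeGroup.map (· + 1) x)) := by
  have : (MulAut.conj gt').toMonoidHom.comp (kToG.comp bHom) =
      (kToG.comp bHom).comp (FreeGroup.map (· + 1)) := by
    ext i
    have h : ∀ i, kToG (bHom (FreeGroup.of i)) = gb i := fun i => by
      rw [bHom, FreeGroup.lift_apply_of]
      exact kToG_of _
    simpa [h] using gt_conj i
  exact DFunLike.congr_fun this x

theorem kToG_bHom_mk (v : Word ℤ) : kToG (bHom (FreeGroup.mk v)) = gVal (kWord (bWord v)) := by
  rw [bHom_mk, kToG_kVal]

theorem gVal_pinch (ε : Bool) (v : Word ℤ) : ∃ v' : Word ℤ, v'.length = v.length ∧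
    gVal ((none, ε) :: kWord (bWord v) ++ [(none, !ε)]) = gVal (kWord (bWord v')) := by
  have ht : gVal [(none, true)] = gt' := rfl
  have ht' : gVal [(none, false)] = gt'⁻¹ := rfl
  rw [← List.singleton_append, gVal_append, gVal_append, ← kToG_bHom_mk]
  cases ε with
  | true =>
    refine ⟨v.map fun x => (x.1 + 1, x.2), by simp, ?_⟩
    rw [Bool.not_true, ht, ht', gt_conj_bHom, ← kToG_bHom_mk]
    rfl
  | false =>
    refine ⟨v.map fun x => (x.1 - 1, x.2), by simp, ?_⟩
    have := gt_conj_bHom (FreeGroup.mk (v.map fun x => (x.1 - 1, x.2)))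
    rw [FreeGroup.map.mk, List.map_map] at this
    simp only [Function.comp_def, sub_add_cancel, Prod.mk.eta, List.map_id'] at this
    rw [Bool.not_false, ht, ht', ← this, ← kToG_bHom_mk]
    group

theorem exists_bWord {v : Word KGen} (hv : ∀ x ∈ v, IsB x) : ∃ u, v = bWord u := by
  induction v with
  | nil => exact ⟨[], rfl⟩
  | cons x v ih =>
    obtain ⟨i, hi⟩ := hv x (by simp)
    obtain ⟨u, rfl⟩ := ih fun y hy => hv y (by simp [hy])
    exact ⟨(i, x.2) :: u, by simp [bWord, ← hi]⟩

/-- Words in the generators of `G` to which no length-reducing rewriting step applies. -/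
structure Irr (w : Word GGen) : Prop where
  reduced : FreeGroup.IsReduced w
  noSeg : ∀ s ∈ kCancel.lines, ¬ kWord (tk s 2600) <:+: w
  noPinch : ∀ (ε : Bool) (v : Word KGen), (∀ x ∈ v, IsB x) →
    ¬ (none, ε) :: kWord v ++ [(none, !ε)] <:+: w

theorem exists_irr (w : Word GGen) : ∃ w', Irr w' ∧ gVal w' = gVal w := by
  induction hn : w.length using Nat.strong_induction_on generalizing w with
  | _ n ih =>
    subst hn
    by_cases h : ∃ w' : Word GGen, w'.length < w.length ∧ gVal w' = gVal w
    · obtain ⟨w', h1, h2⟩ := h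
      obtain ⟨w'', h3, h4⟩ := ih _ h1 w' rfl
      exact ⟨w'', h3, h4.trans h2⟩
    · refine ⟨w, ⟨?_, ?_, ?_⟩, rfl⟩
      · refine FreeGroup.isReduced_iff_not_step.2 fun w' hw' => h ⟨w', ?_, ?_⟩
        · have := hw'.length
          lia
        · exact congrArg (QuotientGroup.mk : FreeGroup GGen → G) (Quot.sound hw').symm
      · rintro s hs ⟨a, b, rfl⟩
        exact h (exists_shorter_of_seg hs)
      · rintro ε v hv ⟨a, b, rfl⟩
        obtain ⟨u, rfl⟩ := exists_bWord hv
        obtain ⟨u', h1, h2⟩ := gVal_pinch ε u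
        refine h ⟨a ++ kWord (bWord u') ++ b, ?_, ?_⟩
        · simp [bWord, h1]
        · rw [gVal_append, gVal_append, ← h2, ← gVal_append, ← gVal_append]

section

open FoldedGraph HNNExtension

/-- The automorphism `bᵢ ↦ b_{i+1}` of the subgroup of `K` generated by the `bᵢ`. -/
noncomputable def bShift : bHom.range ≃* bHom.range :=
  (MonoidHom.ofInjective bHom_injective).symm.trans
    ((FreeGroup.freeGroupCongr (Equiv.addRight (1 : ℤ))).trans (MonoidHom.ofInjective bHom_injective))

theorem bShift_bHom (x : FreeGroup ℤ) :
    (bShift ⟨bHom x, x, rfl⟩ : K) = bHom (FreeGroup.map (· + 1) x) := by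
  have : (MonoidHom.ofInjective bHom_injective).symm ⟨bHom x, x, rfl⟩ = x :=
    (MulEquiv.symm_apply_eq _).2 rfl
  simp only [bShift, MulEquiv.trans_apply, this]
  rfl

/-- `G` as an HNN extension in the sense of Mathlib. -/
abbrev GHNN := HNNExtension K bHom.range bHom.range bShift

theorem gToHNN_aux (w : Word KGen) :
    FreeGroup.lift (fun x : GGen => x.elim (t : GHNN) fun y => of (PresentedGroup.of y))
      (FreeGroup.mk (kWord w)) = of (kVal w) := by
  have : (FreeGroup.lift (fun x : GGen => x.elim (t : GHNN) fun y => of (PresentedGroup.of y))).comp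
      (FreeGroup.map some) = (of : K →* GHNN).comp (QuotientGroup.mk' _) := by
    ext x
    simp
    rfl
  exact DFunLike.congr_fun this (FreeGroup.mk w)

/-- The homomorphism from `G` to the HNN extension. -/
noncomputable def gToHNN : G →* GHNN :=
  PresentedGroup.toGroup (f := fun x : GGen => x.elim (t : GHNN) fun y => of (PresentedGroup.of y)) (by
    rintro _ ⟨_, ⟨w, hw, rfl⟩ | ⟨i, rfl⟩, rfl⟩
    · obtain ⟨d, rfl⟩ := mem_KRelWords.1 hw
      exact (gToHNN_aux d.rel).trans (by rw [kVal_rel, map_one])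
    · have h := equiv_eq_conj (φ := bShift) ⟨bHom (FreeGroup.of i), _, rfl⟩
      rw [bShift_bHom] at h
      simp only [bHom, FreeGroup.map.of, FreeGroup.lift_apply_of] at h
      refine Eq.trans ?_ (mul_inv_eq_one.2 h.symm)
      simp [← mul_assoc]
      rfl)

theorem gToHNN_kWord (w : Word KGen) : gToHNN (gVal (kWord w)) = of (kVal w) := gToHNN_aux w

theorem gToHNN_none (ε : Bool) :
    gToHNN (gVal [(none, ε)]) = t ^ (((if ε then 1 else -1 : ℤˣ)) : ℤ) := by
  have : gToHNN gt' = t := PresentedGroup.toGroup.of ..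
  cases ε
  · exact (map_inv gToHNN gt').trans (by simp [this])
  · exact this.trans (by simp)

/-- The word `h t^ε₁ k₁ t^ε₂ k₂ ⋯`. -/
def brittonWord (h : Word KGen) (l : List (Bool × Word KGen)) : Word GGen :=
  kWord h ++ l.flatMap fun p => (none, p.1) :: kWord p.2

theorem exists_brittonWord (w : Word GGen) : ∃ h l, w = brittonWord h l := by
  induction w with
  | nil => exact ⟨[], [], rfl⟩
  | cons x w ih =>
    obtain ⟨h, l, rfl⟩ := ih
    obtain ⟨_ | y, ε⟩ := x
    · exact ⟨[], (ε, h) :: l, rfl⟩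
    · exact ⟨(y, ε) :: h, l, rfl⟩

theorem gToHNN_brittonWord (h : Word KGen) (l : List (Bool × Word KGen)) :
    gToHNN (gVal (brittonWord h l)) = of (kVal h) *
      (l.map fun p => (t : GHNN) ^ (((if p.1 then 1 else -1 : ℤˣ)) : ℤ) * of (kVal p.2)).prod := by
  rw [brittonWord, gVal_append, map_mul, gToHNN_kWord]
  congr 1
  induction l with
  | nil => exact map_one _
  | cons p l ih =>
    rw [List.flatMap_cons, gVal_append, map_mul, ih, List.map_cons, List.prod_cons,
      ← List.singleton_append, gVal_append, map_mul, gToHNN_none, gToHNN_kWord]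

theorem Irr.isReduced_subword {w : Word GGen} (hw : Irr w) {k : Word KGen} (hk : kWord k <:+: w) :
    FreeGroup.IsReduced k := by
  have := hw.reduced.infix hk
  unfold FreeGroup.IsReduced kWord at this
  rw [List.isChain_map] at this
  simp only [Option.some.injEq] at this
  exact this

theorem kWord_subword {u v : Word KGen} (h : u <:+: v) : kWord u <:+: kWord v := h.map _

theorem Irr.noSeg_subword {w : Word GGen} (hw : Irr w) {k : Word KGen} (hk : kWord k <:+: w) :
    NoSeg 2600 k := fun s hs hi => hw.noSeg s hs ((kWord_subword hi).trans hk)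

theorem brittonWord_chain {h : Word KGen} {l : List (Bool × Word KGen)} (hw : Irr (brittonWord h l)) :
    l.IsChain fun p q => kVal p.2 ∈ bHom.range → p.1 = q.1 := by
  rw [List.isChain_iff_forall_rel_of_append_cons_cons]
  rintro ⟨ε, k⟩ ⟨δ, k'⟩ l₁ l₂ rfl hk
  by_contra hne
  have hδ : δ = !ε := by cases ε <;> cases δ <;> simp_all
  have hpin : (none, ε) :: kWord k ++ [(none, !ε)] <:+:
      brittonWord h (l₁ ++ (ε, k) :: (δ, k') :: l₂) := by
    refine ⟨brittonWord h l₁, kWord k' ++ l₂.flatMap fun p => (none, p.1) :: kWord p.2, ?_⟩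
    simp [brittonWord, hδ]
  have hkw : kWord k <:+: brittonWord h (l₁ ++ (ε, k) :: (δ, k') :: l₂) :=
    List.IsInfix.trans ⟨[(none, ε)], [(none, !ε)], rfl⟩ hpin
  exact hw.noPinch ε k (isB_of_mem_range (hw.isReduced_subword hkw) (hw.noSeg_subword hkw) hk) hpin

theorem irr_ne_one {w : Word GGen} (hw : Irr w) (hw0 : w ≠ []) : gVal w ≠ 1 := by
  intro h1
  obtain ⟨h, l, rfl⟩ := exists_brittonWord w
  have h2 := gToHNN_brittonWord h l
  rw [h1, map_one] at h2
  let W : NormalWord.ReducedWord K bHom.range bHom.range :=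
    { head := kVal h
      toList := l.map fun p => (if p.1 then 1 else -1, kVal p.2)
      chain := by
        rw [List.isChain_map]
        refine (brittonWord_chain hw).imp fun p q hpq hp => ?_
        rw [hpq]
        simpa [toSubgroup] using hp }
  have hW : W.prod bShift = 1 := by
    rw [h2]
    simp [W, NormalWord.ReducedWord.prod, Function.comp_def]
  have hnil := ReducedWord.toList_eq_nil_of_mem_of_range bShift W (hW ▸ one_mem _)
  obtain rfl : l = [] := by simpa [W] using hnil
  rw [List.map_nil, List.prod_nil, mul_one, eq_comm, ← map_one of] at h2
  have hk : kWord h <:+: brittonWord h [] := by simp [brittonWord]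
  refine kVal_ne_one (hw.isReduced_subword hk) ?_ ?_ (of_injective bShift h2)
  · rintro rfl
    exact hw0 rfl
  · exact fun s hs hi => hw.noSeg_subword hk s hs (((tk_prefix_tk s (by norm_num)).isInfix).trans hi)

end

theorem primrec_int_succ : Primrec fun i : ℤ => i + 1 := by
  rw [← Primrec.encode_iff]
  have h : Primrec fun i : ℤ =>
      if Encodable.encode i % 2 = 0 then Encodable.encode i + 2 else Encodable.encode i - 2 :=
    .ite (Primrec.eq.comp (Primrec.nat_mod.comp .encode (.const 2)) (.const 0))
      (Primrec.nat_add.comp .encode (.const 2)) (Primrec.nat_sub.comp .encode (.const 2))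
  have h1 : ∀ n : ℕ, Encodable.encode (n : ℤ) = 2 * n := fun _ => rfl
  have h2 : ∀ n : ℕ, Encodable.encode (Int.negSucc n) = 2 * n + 1 := fun _ => rfl
  refine h.of_eq fun i => ?_
  rcases i with n | n
  · rw [Int.ofNat_eq_natCast, show (n : ℤ) + 1 = (n + 1 : ℕ) by simp, h1, h1]
    lia
  · rw [h2]
    rcases n with _ | n
    · rfl
    · rw [show Int.negSucc (n + 1) + 1 = Int.negSucc n by lia, h2]
      lia

theorem primrec_vert : Primrec fun v : ℕ × List ℤ => KGen.vert v.1 v.2 :=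
  (Primrec.of_equiv_symm (e := KGenEquiv)).comp .sumInl

theorem primrec_b : Primrec KGen.b :=
  (Primrec.of_equiv_symm (e := KGenEquiv)).comp (Primrec.sumInr.comp .sumInr)

theorem parent_eq (v : ℕ × List ℤ) :
    parent v.1 v.2 = if v.2 = [] then (v.1 + 1, []) else (v.1, v.2.reverse.tail.reverse) := by
  obtain ⟨n, _ | ⟨i, τ⟩⟩ := v
  · rfl
  · simp [parent, List.tail_reverse, -List.reverse_cons]

theorem primrec_parent : Primrec fun v : ℕ × List ℤ => parent v.1 v.2 := by
  simp only [parent_eq]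
  exact .ite (Primrec.eq.comp .snd (.const [])) ((Primrec.succ.comp .fst).pair (.const []))
    (Primrec.fst.pair (Primrec.list_reverse.comp (Primrec.list_tail.comp
      (Primrec.list_reverse.comp .snd))))

theorem primrec_relData_base : Primrec RelData.base := primrec_vert.comp .fst

theorem primrec_relData_edge : Primrec RelData.edge :=
  (Primrec.option_casesOn .snd (.const KGen.a) (primrec_b.comp .snd).to₂).of_eq fun d => by
    obtain ⟨_, _ | _⟩ := d <;> rfl

theorem primrec_relData_target : Primrec RelData.target :=
  (Primrec.option_casesOn .snd (primrec_vert.comp (primrec_parent.comp .fst))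
    (primrec_vert.comp ((Primrec.fst.comp (Primrec.fst.comp .fst)).pair
      (Primrec.list_concat.comp (Primrec.snd.comp (Primrec.fst.comp .fst)) .snd))).to₂).of_eq
    fun d => by obtain ⟨_, _ | _⟩ := d <;> rfl

/-- An auxiliary encoding of letter kinds. -/
def kindEquiv : Kind ≃ Option Bool where
  toFun
    | .base => none
    | .edge => some false
    | .target => some true
  invFun
    | none => .base
    | some false => .edge
    | some true => .target
  left_inv k := by cases k <;> rfl
  right_inv k := by rcases k with _ | _ | _ <;> rfl

instance : Primcodable Kind := Primcodable.ofEquiv _ kindEquiv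

theorem primrec_relData_letter : Primrec₂ RelData.letter := by
  have h : Primrec₂ fun (d : RelData) (k : Kind) =>
      if k = .base then (d.base, true) else if k = .edge then (d.edge, true) else (d.target, false) :=
    .ite (Primrec.eq.comp .snd (.const _)) ((primrec_relData_base.comp .fst).pair (.const true))
      (.ite (Primrec.eq.comp .snd (.const _)) ((primrec_relData_edge.comp .fst).pair (.const true))
        ((primrec_relData_target.comp .fst).pair (.const false)))
  exact h.of_eq fun d k => by cases k <;> rfl

theorem primrec_kWord : Primrec kWord :=
  Primrec.list_map .id ((Primrec.option_some.comp (Primrec.fst.comp .snd)).pair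
    (Primrec.snd.comp .snd)).to₂

theorem primrec_map_letter : Primrec₂ fun (d : RelData) (l : List Kind) => kWord (l.map d.letter) :=
  primrec_kWord.comp (Primrec.list_map .snd
    (primrec_relData_letter.comp (Primrec.fst.comp .fst) .snd).to₂)

theorem primrec_invRev {α : Type} [Primcodable α] : Primrec (FreeGroup.invRev (α := α)) :=
  Primrec.list_reverse.comp (Primrec.list_map .id
    ((Primrec.fst.comp .snd).pair (Primrec.not.comp (Primrec.snd.comp .snd))).to₂)

/-- One step of free reduction: put a letter in front of a reduced word. -/
def reduceCons {α : Type} [DecidableEq α] (x : α × Bool) (w : Word α) : Word α :=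
  if w.head? = some (negLetter x) then w.tail else x :: w

theorem reduce_eq_foldr {α : Type} [DecidableEq α] (w : Word α) :
    FreeGroup.reduce w = w.foldr reduceCons [] := by
  induction w with
  | nil => rfl
  | cons x w ih =>
    rw [FreeGroup.reduce.cons, List.foldr_cons, ← ih, reduceCons]
    obtain ⟨a, ε⟩ := x
    rcases FreeGroup.reduce w with _ | ⟨⟨b, δ⟩, l⟩
    · rfl
    · have : (a = b ∧ ε = !δ) ↔ (b = a ∧ δ = !ε) := by
        cases ε <;> cases δ <;> simp [eq_comm]
      simp [negLetter, this]

theorem primrec_reduce {α : Type} [DecidableEq α] [Primcodable α] :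
    Primrec (FreeGroup.reduce (α := α)) := by
  have h : Primrec₂ (reduceCons (α := α)) :=
    .ite (Primrec.eq.comp (Primrec.list_head?.comp .snd) (Primrec.option_some.comp
        ((Primrec.fst.comp .fst).pair (Primrec.not.comp (Primrec.snd.comp .fst)))))
      (Primrec.list_tail.comp .snd) (Primrec.list_cons.comp .fst .snd)
  exact (Primrec.list_foldr .id (.const []) (h.comp (Primrec.fst.comp .snd)
    (Primrec.snd.comp .snd)).to₂).of_eq fun w => (reduce_eq_foldr w).symm

/-- All contiguous subwords of a word. -/
def infixes {α : Type} (w : List α) : List (List α) :=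
  (List.range (w.length + 1)).flatMap fun i =>
    (List.range (w.length + 1)).map fun j => (w.drop i).take j

theorem mem_infixes {α : Type} {u w : List α} : u ∈ infixes w ↔ u <:+: w := by
  simp only [infixes, List.mem_flatMap, List.mem_map, List.mem_range]
  constructor
  · rintro ⟨i, -, j, -, rfl⟩
    exact (List.take_prefix _ _).isInfix.trans (List.drop_suffix _ _).isInfix
  · rintro ⟨a, b, rfl⟩
    exact ⟨a.length, by simp only [List.length_append]; lia, u.length,
      by simp only [List.length_append]; lia, by simp⟩

theorem primrec_infixes {α : Type} [Primcodable α] : Primrec (infixes (α := α)) := by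
  have h : Primrec fun w : List α => List.range (w.length + 1) :=
    Primrec.list_range.comp (Primrec.succ.comp .list_length)
  exact Primrec.list_flatMap h (Primrec.list_map (h.comp .fst) (Primrec.list_take.comp .snd
    (Primrec.list_drop.comp (Primrec.snd.comp .fst) (Primrec.fst.comp .fst))).to₂).to₂

theorem primrecRel_mem {α : Type} [Primcodable α] :
    PrimrecRel fun (a : α) (l : List α) => a ∈ l :=
  (Primrec.eq (α := α)).exists_mem_list.swap.of_eq fun a l => by
    simp [Function.swap]

/-- The vertex underlying a generator, with a junk value for other generators. -/
def vertOf : GGen → ℕ × List ℤ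
  | some (.vert n τ) => (n, τ)
  | _ => (0, [])

/-- The edge label underlying a generator, with a junk value for other generators. -/
def edgeOf : GGen → Option ℤ
  | some (.b i) => some i
  | _ => none

theorem primrec_kGenEquiv : Primrec KGenEquiv := Primrec.of_equiv (e := KGenEquiv)

theorem primrec_vertOf : Primrec vertOf :=
  (Primrec.option_casesOn .id (.const (0, [])) (Primrec.sumCasesOn (primrec_kGenEquiv.comp .snd)
    Primrec.snd.to₂ (Primrec.const (0, [])).to₂).to₂).of_eq fun x => by
    rcases x with _ | ⟨n, τ⟩ | _ | i <;> rfl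

theorem primrec_edgeOf : Primrec edgeOf :=
  (Primrec.option_casesOn .id (.const none) (Primrec.sumCasesOn (primrec_kGenEquiv.comp .snd)
    (Primrec.const none).to₂ (Primrec.sumCasesOn .snd (Primrec.const none).to₂
      (Primrec.option_some.comp .snd).to₂).to₂).to₂).of_eq fun x => by
    rcases x with _ | ⟨n, τ⟩ | _ | i <;> rfl

theorem vertOf_base (d : RelData) : vertOf (some d.base) = d.1 := rfl

theorem edgeOf_edge (d : RelData) : edgeOf (some d.edge) = d.2 := by
  obtain ⟨_, _ | _⟩ := d <;> rfl

/-- The forbidden subwords of length `2600` all of whose letters may occur in `w`. -/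
def segs (w : Word GGen) : List (Word GGen) :=
  w.flatMap fun p => w.flatMap fun q => (List.range 5151).flatMap fun c : ℕ =>
    [kWord (((List.range 2600).map fun j : ℕ => kindAt (j + c)).map
      (RelData.letter (vertOf p.1, edgeOf q.1))),
    FreeGroup.invRev (kWord (((List.range 2600).map fun j : ℕ => kindAt (j + c)).map
      (RelData.letter (vertOf p.1, edgeOf q.1))))]

theorem primrec_segs : Primrec segs := by
  obtain ⟨L, hL⟩ : ∃ L : List (List Kind),
    L = (List.range 5151).map fun c : ℕ => (List.range 2600).map fun j : ℕ => kindAt (j + c) := ⟨_, rfl⟩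
  have h1 : Primrec fun x : ((Word GGen × (GGen × Bool)) × (GGen × Bool)) × List Kind =>
      kWord (x.2.map (RelData.letter (vertOf x.1.1.2.1, edgeOf x.1.2.1))) :=
    primrec_map_letter.comp ((primrec_vertOf.comp (Primrec.fst.comp (Primrec.snd.comp
      (Primrec.fst.comp .fst)))).pair (primrec_edgeOf.comp (Primrec.fst.comp (Primrec.snd.comp .fst))))
      .snd
  refine (Primrec.list_flatMap .id (Primrec.list_flatMap .fst (Primrec.list_flatMap (.const L)
    (Primrec.list_cons.comp h1 (Primrec.list_cons.comp (primrec_invRev.comp h1)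
      (.const []))).to₂).to₂).to₂).of_eq fun w => ?_
  simp only [segs, hL, List.flatMap_map, id]

theorem kWord_invRev (w : Word KGen) : kWord (FreeGroup.invRev w) = FreeGroup.invRev (kWord w) := by
  simp [kWord, FreeGroup.invRev, Function.comp_def]

theorem tk_line_eq (d : RelData) (c : ℤ) (n : ℕ) : tk (fun j => d.line (j + c)) n =
    ((List.range n).map fun j : ℕ => kindAt (j + c)).map d.letter := by
  simp [tk, RelData.line]

theorem mem_lines_line (d : RelData) (c : ℤ) : (fun j => d.line (j + c)) ∈ kCancel.lines :=
  .inl ⟨d, c, rfl⟩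

theorem mem_lines_neg (d : RelData) (c : ℤ) :
    (fun j => negLetter (d.line (c - j))) ∈ kCancel.lines :=
  .inr ⟨d, c, rfl⟩

theorem exists_line_of_mem_segs {w u : Word GGen} (hu : u ∈ segs w) :
    ∃ s ∈ kCancel.lines, u = kWord (tk s 2600) := by
  simp only [segs, List.mem_flatMap, List.mem_cons, List.not_mem_nil, or_false] at hu
  obtain ⟨p, -, q, -, c, -, hu | hu⟩ := hu
  · exact ⟨_, mem_lines_line (vertOf p.1, edgeOf q.1) c, by rw [hu, tk_line_eq]⟩
  · refine ⟨_, mem_lines_neg (vertOf p.1, edgeOf q.1) (c + 2599), ?_⟩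
    rw [hu, tk_neg, kWord_invRev, show (c + 2599 : ℤ) - (2600 : ℕ) + 1 = c by push_cast; ring, tk_line_eq]

theorem exists_letter_mem (d : RelData) (c : ℤ) {t : Kind} (ht : t = .base ∨ t = .edge) :
    d.letter t ∈ tk (fun j => d.line (j + c)) 2600 := by
  obtain ⟨j, h0, h1, h2⟩ := exists_kindAt ht c
  lift j to ℕ using h0
  refine List.mem_map.2 ⟨j, List.mem_range.2 (by lia), ?_⟩
  exact congrArg d.letter h2

theorem mem_segs {w : Word GGen} {d : RelData} (c : ℤ) {x y : GGen × Bool} (hx : x ∈ w)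
    (hx' : x.1 = some d.base) (hy : y ∈ w) (hy' : y.1 = some d.edge) :
    kWord (tk (fun j => d.line (j + c)) 2600) ∈ segs w ∧
      FreeGroup.invRev (kWord (tk (fun j => d.line (j + c)) 2600)) ∈ segs w := by
  obtain ⟨i, hi, h⟩ := exists_shift_mem_range c
  have hd : (vertOf x.1, edgeOf y.1) = d := by rw [hx', hy', vertOf_base, edgeOf_edge]
  simp only [tk_line_eq, h, segs, List.mem_flatMap, List.mem_range]
  refine ⟨⟨x, hx, y, hy, i, hi, ?_⟩, x, hx, y, hy, i, hi, ?_⟩ <;> rw [hd] <;> simp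

theorem noSeg_iff {w : Word GGen} : (∀ s ∈ kCancel.lines, ¬ kWord (tk s 2600) <:+: w) ↔
    ¬ ∃ u ∈ segs w, u ∈ infixes w := by
  simp only [mem_infixes]
  constructor
  · rintro h ⟨u, hu, hi⟩
    obtain ⟨s, hs, hu'⟩ := exists_line_of_mem_segs hu
    exact h s hs (hu' ▸ hi)
  · rintro h _ (⟨d, c, rfl⟩ | ⟨d, c, rfl⟩) hi
    · have hm : ∀ t : Kind, t = .base ∨ t = .edge →
          ∃ x ∈ w, x.1 = some (d.letter t).1 := fun t ht =>
        ⟨_, hi.subset (List.mem_map_of_mem (exists_letter_mem d c ht)), rfl⟩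
      obtain ⟨x, hx, hx'⟩ := hm .base (.inl rfl)
      obtain ⟨y, hy, hy'⟩ := hm .edge (.inr rfl)
      exact h ⟨_, (mem_segs c hx hx' hy hy').1, hi⟩
    · rw [tk_neg, kWord_invRev] at hi
      have hm : ∀ t : Kind, t = .base ∨ t = .edge →
          ∃ x ∈ w, x.1 = some (d.letter t).1 := fun t ht =>
        ⟨_, hi.subset (List.mem_reverse.2 (List.mem_map_of_mem (List.mem_map_of_mem
          (exists_letter_mem d (c - (2600 : ℕ) + 1) ht)))), rfl⟩
      obtain ⟨x, hx, hx'⟩ := hm .base (.inl rfl)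
      obtain ⟨y, hy, hy'⟩ := hm .edge (.inr rfl)
      exact h ⟨_, (mem_segs _ hx hx' hy hy').2, hi⟩

/-- Whether a word is of the form `t^ε v t^-ε` with `v` a word in the letters `bᵢ`. -/
def IsPinch (u : Word GGen) : Prop :=
  (∃ ε ∈ [true, false], u.head? = some (none, ε) ∧ u.tail.reverse.head? = some (none, !ε)) ∧
    ∀ x ∈ u.tail.reverse.tail, (edgeOf x.1).isSome

theorem primrecPred_isPinch : PrimrecPred IsPinch := by
  have h1 : PrimrecRel fun (ε : Bool) (u : Word GGen) =>
      u.head? = some (none, ε) ∧ u.tail.reverse.head? = some (none, !ε) :=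
    (Primrec.eq.comp (Primrec.list_head?.comp .snd)
      (Primrec.option_some.comp ((Primrec.const none).pair .fst))).and
    (Primrec.eq.comp (Primrec.list_head?.comp (Primrec.list_reverse.comp (Primrec.list_tail.comp .snd)))
      (Primrec.option_some.comp ((Primrec.const none).pair (Primrec.not.comp .fst))))
  have h2 : PrimrecPred fun x : GGen × Bool => (edgeOf x.1).isSome = true :=
    Primrec.eq.comp (Primrec.option_isSome.comp (primrec_edgeOf.comp .fst)) (.const true)
  exact (h1.exists_mem_list.comp (.const [true, false]) .id).and
    (h2.forall_mem_list.comp (Primrec.list_tail.comp (Primrec.list_reverse.comp .list_tail)))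

theorem isSome_edgeOf {x : GGen} : (edgeOf x).isSome ↔ ∃ i, x = some (.b i) := by
  rcases x with _ | _ | _ | _ <;> simp [edgeOf]

theorem isPinch_iff {u : Word GGen} : IsPinch u ↔
    ∃ (ε : Bool) (v : Word KGen), (∀ x ∈ v, IsB x) ∧ u = (none, ε) :: kWord v ++ [(none, !ε)] := by
  constructor
  · rintro ⟨⟨ε, -, h1, h2⟩, h3⟩
    obtain ⟨r, rfl⟩ := List.head?_eq_some_iff.1 h1
    obtain ⟨r', h4⟩ := List.head?_eq_some_iff.1 h2
    rw [h4] at h3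
    rw [List.tail_cons, List.reverse_eq_iff, List.reverse_cons] at h4
    subst h4
    simp only [List.tail_cons, isSome_edgeOf] at h3
    have : ∀ r : Word GGen, (∀ x ∈ r, ∃ i, x.1 = some (KGen.b i)) →
        ∃ v : Word KGen, (∀ x ∈ v, IsB x) ∧ r = kWord v := by
      intro r hr
      induction r with
      | nil => exact ⟨[], by simp, rfl⟩
      | cons x r ih =>
        obtain ⟨v, hv, rfl⟩ := ih fun y hy => hr y (by simp [hy])
        obtain ⟨i, hi⟩ := hr x (by simp)
        refine ⟨(.b i, x.2) :: v, ?_, ?_⟩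
        · rintro y (_ | hy)
          · exact ⟨i, rfl⟩
          · exact hv y ‹_›
        · rw [← Prod.mk.eta (p := x), hi]
          rfl
    obtain ⟨v, hv, h5⟩ := this r'.reverse fun x hx => h3 x (List.mem_reverse.1 hx)
    exact ⟨ε, v, hv, by rw [h5, List.cons_append]⟩
  · rintro ⟨ε, v, hv, rfl⟩
    refine ⟨⟨ε, by cases ε <;> simp, by simp, by simp⟩, ?_⟩
    intro x hx
    simp only [List.cons_append, List.tail_cons, List.reverse_append, List.reverse_cons,
      List.reverse_nil, List.nil_append, List.mem_reverse] at hx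
    obtain ⟨y, hy, rfl⟩ := List.mem_map.1 hx
    obtain ⟨i, hi⟩ := hv y hy
    exact isSome_edgeOf.2 ⟨i, congrArg some hi⟩

theorem irr_iff {w : Word GGen} : Irr w ↔ FreeGroup.reduce w = w ∧
    (¬ ∃ u ∈ segs w, u ∈ infixes w) ∧ ¬ ∃ u ∈ infixes w, IsPinch u := by
  rw [← FreeGroup.isReduced_iff_reduce_eq, ← noSeg_iff]
  refine ⟨fun h => ⟨h.reduced, h.noSeg, ?_⟩, fun h => ⟨h.1, h.2.1, ?_⟩⟩
  · rintro ⟨u, hu, hp⟩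
    obtain ⟨ε, v, hv, rfl⟩ := isPinch_iff.1 hp
    exact h.noPinch ε v hv (mem_infixes.1 hu)
  · exact fun ε v hv hi => h.2.2 ⟨_, mem_infixes.2 hi, isPinch_iff.2 ⟨ε, v, hv, rfl⟩⟩

theorem primrecPred_irr : PrimrecPred Irr :=
  ((Primrec.eq.comp primrec_reduce .id).and
    ((primrecRel_mem.exists_mem_list.comp primrec_segs primrec_infixes).not.and
      (primrecPred_isPinch.exists_mem_list.comp primrec_infixes).not)).of_eq fun _ => irr_iff.symm

/-- The relator word of `G` with the given data. -/
def gRel : RelData ⊕ ℤ → Word GGen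
  | .inl d => kWord d.rel
  | .inr i => [(none, true), (some (.b i), true), (none, false), (some (.b (i + 1)), false)]

theorem mem_GRelWords {w : Word GGen} : w ∈ GRelWords ↔ ∃ r, w = gRel r := by
  constructor
  · rintro (⟨w, hw, rfl⟩ | ⟨i, rfl⟩)
    · obtain ⟨d, rfl⟩ := mem_KRelWords.1 hw
      exact ⟨.inl d, rfl⟩
    · exact ⟨.inr i, rfl⟩
  · rintro ⟨d | i, rfl⟩
    · exact .inl ⟨d.rel, mem_KRelWords.2 ⟨d, rfl⟩, rfl⟩
    · exact .inr ⟨i, rfl⟩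

theorem primrec_gRel : Primrec gRel := by
  have hb : Primrec fun i : ℤ => (some (KGen.b i) : GGen) := Primrec.option_some.comp primrec_b
  have h1 : Primrec fun d : RelData => kWord (kinds.map d.letter) :=
    primrec_map_letter.comp .id (.const kinds)
  have h2 : Primrec fun i : ℤ => gRel (.inr i) :=
    Primrec.list_cons.comp (.const _) (Primrec.list_cons.comp (hb.pair (.const _))
      (Primrec.list_cons.comp (.const _) (Primrec.list_cons.comp
        ((hb.comp primrec_int_succ).pair (.const _)) (.const _))))
  refine (Primrec.sumCasesOn .id (h1.comp .snd).to₂ (h2.comp .snd).to₂).of_eq fun r => ?_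
  rcases r with d | i
  · exact congrArg kWord d.rel_eq.symm
  · rfl

/-- A product of conjugates of relators and their inverses. -/
abbrev Cert := List ((Word GGen × (RelData ⊕ ℤ)) × Bool)

/-- The word spelled by a product of conjugates of relators and their inverses. -/
def certWord (c : Cert) : Word GGen := c.flatMap fun x =>
  x.1.1 ++ (if x.2 = true then gRel x.1.2 else FreeGroup.invRev (gRel x.1.2)) ++
    FreeGroup.invRev x.1.1

theorem primrec_certWord : Primrec certWord := by
  have h : Primrec fun x : Cert × ((Word GGen × (RelData ⊕ ℤ)) × Bool) => gRel x.2.1.2 :=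
    primrec_gRel.comp (Primrec.snd.comp (Primrec.fst.comp .snd))
  have h' : Primrec fun x : Cert × ((Word GGen × (RelData ⊕ ℤ)) × Bool) => x.2.1.1 :=
    Primrec.fst.comp (Primrec.fst.comp .snd)
  exact Primrec.list_flatMap .id (Primrec.list_append.comp (Primrec.list_append.comp h'
    (.ite (Primrec.eq.comp (Primrec.snd.comp .snd) (.const true)) h (primrec_invRev.comp h)))
    (primrec_invRev.comp h')).to₂

theorem gVal_eq_one_iff (w : Word GGen) :
    gVal w = 1 ↔ FreeGroup.mk w ∈ Subgroup.normalClosure GRels := QuotientGroup.eq_one_iff _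

theorem gVal_invRev (w : Word GGen) : gVal (FreeGroup.invRev w) = (gVal w)⁻¹ := by
  rw [gVal, ← FreeGroup.inv_mk]
  rfl

theorem gVal_gRel (r : RelData ⊕ ℤ) : gVal (gRel r) = 1 :=
  (gVal_eq_one_iff _).2 (Subgroup.subset_normalClosure ⟨_, mem_GRelWords.2 ⟨r, rfl⟩, rfl⟩)

theorem gVal_certWord (c : Cert) : gVal (certWord c) = 1 := by
  induction c with
  | nil => rfl
  | cons x c ih =>
    rw [certWord, List.flatMap_cons, gVal_append, ← certWord, ih, mul_one, gVal_append, gVal_append,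
      gVal_invRev]
    split_ifs <;> simp [gVal_invRev, gVal_gRel]

theorem exists_cert_of_mem_conjugates {x : FreeGroup GGen}
    (hx : x ∈ Group.conjugatesOfSet GRels) (ε : Bool) :
    ∃ y, FreeGroup.mk (certWord [y]) = if ε = true then x else x⁻¹ := by
  obtain ⟨_, ⟨w, hw, rfl⟩, h⟩ := Group.mem_conjugatesOfSet_iff.1 hx
  obtain ⟨r, rfl⟩ := mem_GRelWords.1 hw
  obtain ⟨g, rfl⟩ := isConj_iff.1 h
  refine ⟨((g.toWord, r), ε), ?_⟩
  cases ε <;>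
    simp [certWord, ← FreeGroup.mul_mk, ← FreeGroup.inv_mk, FreeGroup.mk_toWord, mul_assoc]

theorem exists_cert {x : FreeGroup GGen} (hx : x ∈ Subgroup.normalClosure GRels) :
    ∃ c, FreeGroup.mk (certWord c) = x := by
  rw [Subgroup.normalClosure] at hx
  induction hx using Subgroup.closure_induction_left with
  | one => exact ⟨[], rfl⟩
  | mul_left x hx y _ ih =>
    obtain ⟨c, rfl⟩ := ih
    obtain ⟨z, hz⟩ := exists_cert_of_mem_conjugates hx true
    exact ⟨z :: c, by rw [← List.singleton_append, certWord, List.flatMap_append, ← FreeGroup.mul_mk,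
      ← certWord, hz, ← certWord, if_pos rfl]⟩
  | inv_mul_cancel x hx y _ ih =>
    obtain ⟨c, rfl⟩ := ih
    obtain ⟨z, hz⟩ := exists_cert_of_mem_conjugates hx false
    exact ⟨z :: c, by rw [← List.singleton_append, certWord, List.flatMap_append, ← FreeGroup.mul_mk,
      ← certWord, hz, ← certWord, if_neg Bool.false_ne_true]⟩

/-- `x` consists of an irreducible word and a proof that it represents the same element as `w`. -/
def IsNormalization (w : Word GGen) (x : Word GGen × Cert) : Prop :=
  Irr x.1 ∧ FreeGroup.reduce (certWord x.2 ++ x.1) = FreeGroup.reduce w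

theorem IsNormalization.gVal_eq {w : Word GGen} {x : Word GGen × Cert} (h : IsNormalization w x) :
    gVal w = gVal x.1 := by
  have := congrArg (QuotientGroup.mk : FreeGroup GGen → G) (FreeGroup.reduce.exact h.2)
  change gVal _ = gVal w at this
  rw [← this, gVal_append, gVal_certWord, one_mul]

theorem exists_isNormalization (w : Word GGen) : ∃ x, IsNormalization w x := by
  obtain ⟨w', h1, h2⟩ := exists_irr w
  have h : gVal (w ++ FreeGroup.invRev w') = 1 := by
    rw [gVal_append, gVal_invRev, h2, mul_inv_cancel]
  obtain ⟨c, hc⟩ := exists_cert ((gVal_eq_one_iff _).1 h)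
  refine ⟨(w', c), h1, FreeGroup.reduce.sound ?_⟩
  rw [← FreeGroup.mul_mk, hc, ← FreeGroup.mul_mk, ← FreeGroup.inv_mk, inv_mul_cancel_right]

theorem primrecRel_isNormalization : PrimrecRel IsNormalization :=
  (primrecPred_irr.comp (Primrec.fst.comp .snd)).and
    (Primrec.eq.comp (primrec_reduce.comp (Primrec.list_append.comp
      (primrec_certWord.comp (Primrec.snd.comp .snd)) (Primrec.fst.comp .snd)))
      (primrec_reduce.comp .fst))

theorem gVal_eq_one_iff_of_isNormalization {w : Word GGen} {x : Word GGen × Cert}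
    (h : IsNormalization w x) : gVal w = 1 ↔ x.1 = [] := by
  rw [h.gVal_eq]
  constructor
  · intro h1
    by_contra h0
    exact irr_ne_one h.1 h0 h1
  · intro h0
    rw [h0]
    rfl

/-- A computable relation that is total in its second argument has a computable choice function. -/
theorem exists_computable_choice {α β : Type} [Primcodable α] [Primcodable β] {R : α → β → Prop}
    (hR : PrimrecRel R) (h : ∀ a, ∃ b, R a b) : ∃ f : α → β, Computable f ∧ ∀ a, R a (f a) := by
  classical
  let P : α → ℕ → Prop := fun a n => ∃ b ∈ (Encodable.decode (α := β) n).toList, R a b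
  have hP : PrimrecRel P := by
    refine (hR.swap.exists_mem_list.comp (Primrec.optionToList.comp (Primrec.decode.comp .snd))
      .fst).of_eq fun _ => Iff.rfl
  have hex : ∀ a, ∃ n, P a n := fun a => by
    obtain ⟨b, hb⟩ := h a
    exact ⟨Encodable.encode b, b, by simp, hb⟩
  have hf : Computable fun a => Nat.find (hex a) :=
    Computable.find (P := P) (by
      obtain ⟨_, hP⟩ := hP
      exact hP.to_comp.computablePred) hex
  choose f hf1 hf2 using fun a => Nat.find_spec (hex a)
  refine ⟨f, ?_, hf2⟩
  rw [← Computable.option_some_iff]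
  refine (Computable.decode.comp hf).of_eq fun a => ?_
  simpa using hf1 a

theorem computablePred_gVal_eq_one : ComputablePred fun w : Word GGen => gVal w = 1 := by
  obtain ⟨f, hf, h⟩ := exists_computable_choice primrecRel_isNormalization exists_isNormalization
  have h1 : PrimrecPred fun x : Word GGen × Cert => x.1 = [] := Primrec.eq.comp .fst (.const [])
  obtain ⟨_, h1⟩ := h1
  refine ComputablePred.of_eq (Computable.computablePred (h1.to_comp.comp hf) :
    ComputablePred fun w => (f w).1 = []) fun w => ?_
  exact (gVal_eq_one_iff_of_isNormalization (h w)).symm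

theorem gVal_mem {S : Subgroup G} {w : Word GGen}
    (h : ∀ x ∈ w, (PresentedGroup.of x.1 : G) ∈ S) : gVal w ∈ S := by
  induction w with
  | nil => exact one_mem S
  | cons x w ih =>
    rw [← List.singleton_append, gVal_append]
    refine mul_mem ?_ (ih fun y hy => h y (by simp [hy]))
    have hx := h x (by simp)
    obtain ⟨y, _ | _⟩ := x
    · exact inv_mem hx
    · exact hx

theorem target_mem {S : Subgroup G} (d : RelData) (hb : PresentedGroup.of (some d.base) ∈ S)
    (he : PresentedGroup.of (some d.edge) ∈ S) : PresentedGroup.of (some d.target) ∈ S := by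
  have h := gVal_gRel (.inl d)
  rw [gRel, RelData.rel, kWord_append, gVal_append, mul_eq_one_iff_eq_inv] at h
  change gVal (kWord (uWord d.base d.edge)) = (PresentedGroup.of (some d.target))⁻¹⁻¹ at h
  rw [inv_inv] at h
  rw [← h]
  refine gVal_mem fun x hx => ?_
  obtain ⟨y, hy, rfl⟩ := List.mem_map.1 hx
  simp only [uWord, List.mem_flatMap, List.mem_append, List.mem_replicate, List.mem_singleton] at hy
  obtain ⟨_, _, ⟨_, rfl⟩ | rfl⟩ := hy
  · exact hb
  · exact he

theorem gb_mem {S : Subgroup G} (ht : gt' ∈ S) (h0 : gb 0 ∈ S) (i : ℤ) : gb i ∈ S := by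
  have h : ∀ i, gb i ∈ S ↔ gb (i + 1) ∈ S := fun i => by
    rw [← gt_conj, Subgroup.mul_mem_cancel_right _ (inv_mem ht), Subgroup.mul_mem_cancel_left _ ht]
  induction i using Int.induction_on with
  | zero => exact h0
  | succ i ih => exact (h _).1 ih
  | pred i ih => exact (h _).2 (by rwa [sub_add_cancel])

theorem group_fg_G : Group.FG G := by
  rw [Group.fg_iff]
  refine ⟨{gvert 0 [], ga, gb 0, gt'}, ?_, by simp⟩
  rw [eq_top_iff]
  obtain ⟨S, hS⟩ : ∃ S, S = Subgroup.closure {gvert 0 [], ga, gb 0, gt'} := ⟨_, rfl⟩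
  have hsub : ({gvert 0 [], ga, gb 0, gt'} : Set G) ⊆ S := hS ▸ Subgroup.subset_closure
  rw [← hS]
  have hb : ∀ i, gb i ∈ S := gb_mem (hsub (by simp)) (hsub (by simp))
  have ha : ga ∈ S := hsub (by simp)
  have hroot : ∀ n, gvert n [] ∈ S := fun n => by
    induction n with
    | zero => exact hsub (by simp)
    | succ n ih => exact target_mem ((n, []), none) ih ha
  have hv : ∀ n τ, gvert n τ ∈ S := fun n τ => by
    induction τ using List.reverseRecOn with
    | nil => exact hroot n
    | append_singleton τ i ih => exact target_mem ((n, τ), some i) ih (hb i)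
  rintro x -
  obtain ⟨w, rfl⟩ : ∃ w, x = gVal w := by
    obtain ⟨y, rfl⟩ := QuotientGroup.mk_surjective x
    exact ⟨y.toWord, by rw [gVal, FreeGroup.mk_toWord]⟩
  refine gVal_mem fun y _ => ?_
  obtain ⟨_ | ⟨n, τ⟩ | _ | i, _⟩ := y
  · exact hsub (by simp [gt'])
  · exact hv n τ
  · exact hsub (by simp [ga])
  · exact hb i

/-- `G` has solvable word problem: the set of words over the generators representing the
identity of `G` is computable; and `G` is finitely generated. -/
theorem stmt13 :
    ComputablePred (fun w : Word GGen => (QuotientGroup.mk (FreeGroup.mk w) : G) = 1) ∧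
      Group.FG G :=
  ⟨computablePred_gVal_eq_one, group_fg_G⟩
end

section
/- Let R be a nontrivial finitely generated ring. Then the group ring R[G] (the monoid algebra of G over R) is self-reflective: it contains a proper subring which is isomorphic to R[G] as a ring and is existentially closed in R[G]. -/
/-- A subring `B` of a ring `A` is existentially closed in `A` if every finite system of
equations and inequations between ring terms (elements of the free ring on parameters from `B`
together with `n` variables) which has a solution in `A` already has a solution in `B`. -/
def ExistentiallyClosedSubring {A : Type*} [Ring A] (B : Subring A) : Prop :=
  ∀ (n : ℕ) (P N : Finset (FreeRing (B ⊕ Fin n) × FreeRing (B ⊕ Fin n))),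
    (∃ x : Fin n → A,
      (∀ pq ∈ P, FreeRing.lift (Sum.elim (fun b : B => (b : A)) x) pq.1 =
        FreeRing.lift (Sum.elim (fun b : B => (b : A)) x) pq.2) ∧
      (∀ pq ∈ N, FreeRing.lift (Sum.elim (fun b : B => (b : A)) x) pq.1 ≠
        FreeRing.lift (Sum.elim (fun b : B => (b : A)) x) pq.2)) →
    ∃ y : Fin n → B,
      (∀ pq ∈ P, FreeRing.lift (Sum.elim (fun b : B => (b : A)) (fun j => (y j : A))) pq.1 =
        FreeRing.lift (Sum.elim (fun b : B => (b : A)) (fun j => (y j : A))) pq.2) ∧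
      (∀ pq ∈ N, FreeRing.lift (Sum.elim (fun b : B => (b : A)) (fun j => (y j : A))) pq.1 ≠
        FreeRing.lift (Sum.elim (fun b : B => (b : A)) (fun j => (y j : A))) pq.2)

open Function

/-- The value `x y x² y ⋯ x¹⁰⁰ y` of the word `uWord` in a group. -/
def uVal {P : Type*} [Group P] (x y : P) : P :=
  ((List.range 100).map fun k => x ^ (k + 1) * y).prod

/-- The partial products `∏_{m < n} p^(2m+1) q^(2m+2)`. -/
def altVal {P : Type*} [Group P] (n : ℕ) (p q : P) : P :=
  ((List.range n).map fun m => p ^ (2 * m + 1) * q ^ (2 * m + 2)).prod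

theorem map_uVal {P Q : Type*} [Group P] [Group Q] (f : P →* Q) (x y : P) :
    f (uVal x y) = uVal (f x) (f y) := by
  simp [uVal, map_list_prod, Function.comp_def]

theorem map_altVal {P Q : Type*} [Group P] [Group Q] (f : P →* Q) (n : ℕ) (x y : P) :
    f (altVal n x y) = altVal n (f x) (f y) := by
  simp [altVal, map_list_prod, Function.comp_def]

theorem altVal_succ {P : Type*} [Group P] (n : ℕ) (p q : P) :
    altVal (n + 1) p q = altVal n p q * (p ^ (2 * n + 1) * q ^ (2 * n + 2)) := by
  simp [altVal, List.range_succ]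

theorem lift_mk_uWord {α : Type} {P : Type*} [Group P] (f : α → P) (x y z : α) :
    FreeGroup.lift f (FreeGroup.mk (uWord x y ++ [(z, false)])) =
      uVal (f x) (f y) * (f z)⁻¹ := by
  have key : ∀ n : ℕ, (List.map (fun w : α × Bool => cond w.2 (f w.1) (f w.1)⁻¹)
      ((List.range n).flatMap fun k => List.replicate (k + 1) (x, true) ++ [(y, true)])).prod =
      ((List.range n).map fun k => f x ^ (k + 1) * f y).prod := by
    intro n
    induction n with
    | zero => simp
    | succ n ih =>
      rw [List.range_succ, List.flatMap_append, List.map_append, List.prod_append, ih]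
      simp
  rw [FreeGroup.lift_mk, List.map_append, List.prod_append, uWord, key 100]
  simp [uVal]

theorem exists_amalgam_of_family {H : Type} {F : Bool → Type} [Group H] [∀ b, Group (F b)]
    (φ : ∀ b, H →* F b) (hφ : ∀ b, Injective (φ b)) :
    ∃ (Q : Type) (_ : Group Q) (i : F true →* Q) (j : F false →* Q), Injective i ∧ Injective j ∧
      (∀ h, i (φ true h) = j (φ false h)) ∧
        ∀ a b, i a = j b → ∃ h, φ true h = a ∧ φ false h = b := by
  refine ⟨Monoid.PushoutI φ, inferInstance, Monoid.PushoutI.of (φ := φ) true,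
    Monoid.PushoutI.of (φ := φ) false, Monoid.PushoutI.of_injective hφ true,
    Monoid.PushoutI.of_injective hφ false, fun h => ?_, fun a b hab => ?_⟩
  · exact (Monoid.PushoutI.of_apply_eq_base φ true h).trans
      (Monoid.PushoutI.of_apply_eq_base φ false h).symm
  · have hmem : Monoid.PushoutI.of (φ := φ) true a ∈
        (Monoid.PushoutI.of (φ := φ) true).range ⊓ (Monoid.PushoutI.of (φ := φ) false).range :=
      ⟨⟨a, rfl⟩, ⟨b, hab.symm⟩⟩
    rw [Monoid.PushoutI.inf_of_range_eq_base_range hφ (by decide)] at hmem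
    obtain ⟨h, hh⟩ := hmem
    refine ⟨h, Monoid.PushoutI.of_injective hφ true ?_, Monoid.PushoutI.of_injective hφ false ?_⟩
    · exact (Monoid.PushoutI.of_apply_eq_base φ true h).trans hh
    · exact ((Monoid.PushoutI.of_apply_eq_base φ false h).trans hh).trans hab

/-- Amalgamated products exist: both factors embed, and they meet in the amalgamated subgroup. -/
theorem exists_amalgam {H A B : Type} [hH : Group H] [hA : Group A] [hB : Group B]
    (f : H →* A) (g : H →* B) (hf : Injective f) (hg : Injective g) :
    ∃ (Q : Type) (_ : Group Q) (i : A →* Q) (j : B →* Q), Injective i ∧ Injective j ∧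
      (∀ h, i (f h) = j (g h)) ∧ ∀ a b, i a = j b → ∃ h, f h = a ∧ g h = b :=
  @exists_amalgam_of_family H (fun b => Bool.rec B A b) hH (fun b => Bool.rec hB hA b)
    (fun b => Bool.rec g f b) (fun b => by cases b <;> assumption)

theorem freeGroup_lift_injective_of_leftInverse {α β : Type*} {f : α → FreeGroup β}
    (r : β → FreeGroup α) (h : ∀ a, FreeGroup.lift r (f a) = FreeGroup.of a) :
    Injective (FreeGroup.lift f) := by
  have : (FreeGroup.lift r).comp (FreeGroup.lift f) = MonoidHom.id _ := by
    ext a; simp [h]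
  exact LeftInverse.injective (g := FreeGroup.lift r) fun x => DFunLike.congr_fun this x

/-- Adding a new free factor `ℤ` to a group extends a free basis by one element. -/
theorem lift_inl_optionElim_injective {Y A : Type} [Group A] (φ : Y → A)
    (hφ : Injective (FreeGroup.lift φ)) :
    Injective (FreeGroup.lift fun o : Option Y =>
      (o.elim (Monoid.Coprod.inr (FreeGroup.of ())) fun y => Monoid.Coprod.inl (φ y) :
        Monoid.Coprod A (FreeGroup Unit))) := by
  have hsome : Injective (FreeGroup.lift fun y : Y => FreeGroup.of (some y)) :=
    freeGroup_lift_injective_of_leftInverse (fun o => o.elim 1 FreeGroup.of) (by simp)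
  obtain ⟨Q, _, i, j, -, hj, hij, -⟩ := exists_amalgam _ _ hφ hsome
  let r : Monoid.Coprod A (FreeGroup Unit) →* Q :=
    Monoid.Coprod.lift i (FreeGroup.lift fun _ => j (FreeGroup.of none))
  have : r.comp (FreeGroup.lift fun o : Option Y =>
      (o.elim (Monoid.Coprod.inr (FreeGroup.of ())) fun y => Monoid.Coprod.inl (φ y) :
        Monoid.Coprod A (FreeGroup Unit))) = j := by
    ext o
    cases o with
    | none => simp [r]
    | some y => simpa [r] using hij (FreeGroup.of y)
  refine Injective.of_comp (f := r) ?_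
  rw [← MonoidHom.coe_comp, this]
  exact hj

section PingPong

variable {Γ : Type} {α : Type*} [Group Γ] [MulAction Γ α]

/-- `M` maps `S` off itself in both directions. -/
def MovesOff (S : Set α) (M : Γ) : Prop := ∀ v ∈ S, M • v ∉ S ∧ M⁻¹ • v ∉ S

theorem MovesOff.mul_zpow_mul_zpow {S : Set α} {p q M : Γ}
    (hp : ∀ k : ℤ, k ≠ 0 → ∀ v ∈ S, p ^ k • v ∉ S) (hq : ∀ k : ℤ, k ≠ 0 → ∀ v ∉ S, q ^ k • v ∈ S)
    (hM : MovesOff S M) {i j : ℤ} (hi : i ≠ 0) (hj : j ≠ 0) : MovesOff S (M * (q ^ i * p ^ j)) := by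
  intro v hv
  constructor
  · rw [mul_smul, mul_smul]
    exact (hM _ (hq i hi _ (hp j hj v hv))).1
  · rw [mul_inv_rev, mul_inv_rev, mul_smul, mul_smul, ← zpow_neg, ← zpow_neg]
    exact hp _ (neg_ne_zero.2 hj) _ (hq _ (neg_ne_zero.2 hi) _ (hM v hv).2)

theorem movesOff_zpow_mul_prod {S : Set α} {p q : Γ}
    (hp : ∀ k : ℤ, k ≠ 0 → ∀ v ∈ S, p ^ k • v ∉ S) (hq : ∀ k : ℤ, k ≠ 0 → ∀ v ∉ S, q ^ k • v ∈ S)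
    (c d e : ℕ) (hc : c ≠ 0) (hd : d ≠ 0) (he : e ≠ 0) (n : ℕ) :
    MovesOff S (p ^ c * ((List.range n).map fun m => q ^ (2 * m + d) * p ^ (2 * m + e)).prod) := by
  induction n with
  | zero =>
    intro v hv
    have h1 := hp c (by exact_mod_cast hc) v hv
    have h2 := hp (-c) (by simpa using hc) v hv
    rw [zpow_natCast] at h1
    rw [zpow_neg, zpow_natCast] at h2
    simpa using ⟨h1, h2⟩
  | succ n ih =>
    rw [List.range_succ, List.map_append, List.prod_append, ← mul_assoc]
    have := ih.mul_zpow_mul_zpow hp hq (i := (2 * n + d : ℕ)) (j := (2 * n + e : ℕ))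
      (by omega) (by omega)
    simpa only [zpow_natCast, List.map_cons, List.map_nil, List.prod_singleton] using this

theorem lift_injective_of_movesOff {S : Set α} {p q M N : Γ} (hS : S.Nonempty)
    (hp : ∀ k : ℤ, k ≠ 0 → ∀ v ∈ S, p ^ k • v ∉ S) (hq : ∀ k : ℤ, k ≠ 0 → ∀ v ∉ S, q ^ k • v ∈ S)
    (hM : MovesOff S M) (hN : MovesOff S N) :
    Injective (FreeGroup.lift fun o : Option Bool =>
      o.elim p fun b => cond b (q ^ (1 : ℤ) * N * q ^ (99 : ℤ)) (q ^ (2 : ℤ) * M * q ^ (100 : ℤ))) := by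
  let X : Option Bool → Set α := fun o => o.elim {v | ∀ k : ℕ, p ^ (k : ℤ) • v ∉ S}
    fun b => cond b {v | q ^ (-1 : ℤ) • v ∉ S} {v | q ^ (-2 : ℤ) • v ∉ S}
  let Y : Option Bool → Set α := fun o => o.elim {v | ∃ k : ℕ, p ^ (k + 1 : ℤ) • v ∈ S}
    fun b => cond b {v | q ^ (99 : ℤ) • v ∉ S} {v | q ^ (100 : ℤ) • v ∉ S}
  have hqq : ∀ (i j : ℤ) (v : α), i ≠ j → q ^ i • v ∉ S → q ^ j • v ∉ S → False := by
    intro i j v hij hi hj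
    refine hj ?_
    have := hq (j - i) (sub_ne_zero.2 hij.symm) _ hi
    rwa [← mul_smul, ← zpow_add, sub_add_cancel] at this
  have hq0 : ∀ (i : ℤ) (v : α), i ≠ 0 → q ^ i • v ∉ S → v ∈ S := by
    intro i v hi h
    by_contra hv
    exact h (hq i hi v hv)
  have hp0 : ∀ (k : ℕ) (v : α), p ^ (k + 1 : ℤ) • v ∈ S → v ∉ S := fun k v h hv =>
    hp _ (by omega) v hv h
  have hX : ∀ v, v ∈ X none → v ∉ S := fun v hv => by simpa using hv 0
  obtain ⟨s, hs⟩ := hS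
  have hps : p • s ∉ S := by simpa using hp 1 one_ne_zero s hs
  have hne : ∀ i : ℤ, ∃ v, q ^ i • v ∉ S := fun i =>
    ⟨q ^ (-i) • p • s, by rwa [← mul_smul, ← zpow_add, add_neg_cancel, zpow_zero, one_smul]⟩
  refine FreeGroup.injective_lift_of_ping_pong (G := Γ) (α := α) _ X Y ?_ ?_ ?_ ?_ ?_ ?_
  · rintro (_ | _ | _)
    · refine ⟨p • s, fun k => ?_⟩
      rw [← mul_smul, ← zpow_add_one]
      exact hp _ (by omega) s hs
    · exact hne _
    · exact hne _
  · rintro (_ | _ | _) (_ | _ | _) h <;>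
      first
      | exact absurd rfl h
      | (refine Set.disjoint_left.2 fun v h1 h2 => ?_
         first
         | exact hX v h1 (hq0 _ v (by norm_num) h2)
         | exact hX v h2 (hq0 _ v (by norm_num) h1)
         | exact hqq _ _ v (by norm_num) h1 h2)
  · rintro (_ | _ | _) (_ | _ | _) h <;>
      first
      | exact absurd rfl h
      | (refine Set.disjoint_left.2 fun v h1 h2 => ?_
         first
         | exact hp0 h1.choose v h1.choose_spec (hq0 _ v (by norm_num) h2)
         | exact hp0 h2.choose v h2.choose_spec (hq0 _ v (by norm_num) h1)
         | exact hqq _ _ v (by norm_num) h1 h2)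
  · rintro (_ | _ | _) (_ | _ | _) <;> refine Set.disjoint_left.2 fun v h1 h2 => ?_
    · obtain ⟨k, hk⟩ := h2
      exact h1 (k + 1) (by exact_mod_cast hk)
    all_goals
      first
      | exact hX v h1 (hq0 _ v (by norm_num) h2)
      | exact hp0 h2.choose v h2.choose_spec (hq0 _ v (by norm_num) h1)
      | exact hqq _ _ v (by norm_num) h1 h2
  · rintro (_ | _ | _) _ ⟨v, hv, rfl⟩
    · intro k hk
      refine hv ⟨k, ?_⟩
      have hk' : p ^ (k : ℤ) • p • v ∈ S := hk
      rwa [← mul_smul, ← zpow_add_one] at hk'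
    · have hv' : q ^ (100 : ℤ) • v ∈ S := not_not.1 hv
      simpa [X, mul_smul] using (hM _ hv').1
    · have hv' : q ^ (99 : ℤ) • v ∈ S := not_not.1 hv
      simpa [X, mul_smul] using (hN _ hv').1
  · rintro (_ | _ | _) _ ⟨v, hv, rfl⟩
    · have hv' : ∃ k : ℕ, p ^ (k : ℤ) • v ∈ S := by
        by_contra h
        exact hv fun k hk => h ⟨k, hk⟩
      obtain ⟨k, hk⟩ := hv'
      refine ⟨k, ?_⟩
      simpa [← mul_smul, zpow_add_one] using hk
    · have hv' : q ^ (-2 : ℤ) • v ∈ S := not_not.1 hv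
      have := (hM _ hv').2
      rw [zpow_neg] at this
      simpa [Y, mul_smul] using this
    · have hv' : q ^ (-1 : ℤ) • v ∈ S := not_not.1 hv
      have := (hN _ hv').2
      rw [zpow_neg] at this
      simpa [Y, mul_smul] using this

end PingPong

theorem altVal_add_two {P : Type*} [Group P] (p q : P) (n : ℕ) :
    altVal (n + 2) p q = p * (q ^ 2 *
      (p ^ 3 * ((List.range n).map fun m => q ^ (2 * m + 4) * p ^ (2 * m + 5)).prod) *
        q ^ (2 * n + 4)) := by
  induction n with
  | zero => simp [altVal, List.range_succ, mul_assoc]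
  | succ n ih =>
    rw [altVal_succ, ih, List.range_succ]
    simp [mul_assoc, mul_add]

theorem altVal_add_two' {P : Type*} [Group P] (p q : P) (n : ℕ) :
    altVal (n + 2) q p = q *
      (p ^ 2 * ((List.range n).map fun m => q ^ (2 * m + 3) * p ^ (2 * m + 4)).prod) *
        q ^ (2 * n + 3) * p ^ (2 * n + 4) := by
  induction n with
  | zero => simp [altVal, List.range_succ, mul_assoc]
  | succ n ih =>
    rw [altVal_succ, ih, List.range_succ]
    simp [mul_assoc, mul_add]

/-- Nonzero integer vectors in the plane. -/
abbrev NzVec := {v : ℤ × ℤ // v ≠ 0}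

/-- The transvection `(x, y) ↦ (x + 3 y, y)`. -/
def shearX : Equiv.Perm NzVec where
  toFun v := ⟨(v.1.1 + 3 * v.1.2, v.1.2), by
    obtain ⟨⟨x, y⟩, h⟩ := v
    simp only [ne_eq, Prod.mk_eq_zero] at h ⊢
    omega⟩
  invFun v := ⟨(v.1.1 - 3 * v.1.2, v.1.2), by
    obtain ⟨⟨x, y⟩, h⟩ := v
    simp only [ne_eq, Prod.mk_eq_zero] at h ⊢
    omega⟩
  left_inv v := by ext <;> simp
  right_inv v := by ext <;> simp

/-- The transvection `(x, y) ↦ (x, y + 3 x)`. -/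
def shearY : Equiv.Perm NzVec where
  toFun v := ⟨(v.1.1, v.1.2 + 3 * v.1.1), by
    obtain ⟨⟨x, y⟩, h⟩ := v
    simp only [ne_eq, Prod.mk_eq_zero] at h ⊢
    omega⟩
  invFun v := ⟨(v.1.1, v.1.2 - 3 * v.1.1), by
    obtain ⟨⟨x, y⟩, h⟩ := v
    simp only [ne_eq, Prod.mk_eq_zero] at h ⊢
    omega⟩
  left_inv v := by ext <;> simp
  right_inv v := by ext <;> simp

theorem shearX_zpow (k : ℤ) (v : NzVec) :
    ((shearX ^ k) v).1 = (v.1.1 + 3 * k * v.1.2, v.1.2) := by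
  induction k using Int.induction_on with
  | zero => simp
  | succ k ih =>
    rw [add_comm, zpow_add, zpow_one, Equiv.Perm.mul_apply]
    simp only [shearX, Equiv.coe_fn_mk] at ih ⊢
    rw [ih]
    ext <;> simp; ring
  | pred k ih =>
    rw [sub_eq_add_neg, add_comm, zpow_add, zpow_neg_one, Equiv.Perm.mul_apply]
    change ((shearX.symm ((shearX ^ (-(k : ℤ))) v)).1 = _)
    change (((shearX ^ (-(k : ℤ))) v).1.1 - 3 * ((shearX ^ (-(k : ℤ))) v).1.2,
      ((shearX ^ (-(k : ℤ))) v).1.2) = _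
    rw [ih]
    ext <;> simp; ring

theorem shearY_zpow (k : ℤ) (v : NzVec) :
    ((shearY ^ k) v).1 = (v.1.1, v.1.2 + 3 * k * v.1.1) := by
  induction k using Int.induction_on with
  | zero => simp
  | succ k ih =>
    rw [add_comm, zpow_add, zpow_one, Equiv.Perm.mul_apply]
    simp only [shearY, Equiv.coe_fn_mk] at ih ⊢
    rw [ih]
    ext <;> simp; ring
  | pred k ih =>
    rw [sub_eq_add_neg, add_comm, zpow_add, zpow_neg_one, Equiv.Perm.mul_apply]
    change (((shearY ^ (-(k : ℤ))) v).1.1, ((shearY ^ (-(k : ℤ))) v).1.2 -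
      3 * ((shearY ^ (-(k : ℤ))) v).1.1) = _
    rw [ih]
    ext <;> simp; ring

theorem abs_lt_abs_add_mul {x y k : ℤ} (hy : y ≠ 0) (hk : k ≠ 0) (h : |x| ≤ |y|) :
    |y| < |x + 3 * k * y| := by
  have h1 : 1 ≤ |k| := Int.one_le_abs hk
  have h2 : 1 ≤ |y| := Int.one_le_abs hy
  have h3 : |3 * k * y| = 3 * |k| * |y| := by rw [abs_mul, abs_mul]; rfl
  have h4 : |3 * k * y| ≤ |x + 3 * k * y| + |x| := by
    have := abs_add_le (x + 3 * k * y) (-x)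
    rwa [abs_neg, add_neg_cancel_comm] at this
  nlinarith

/-- In the free group on `p, q` the elements `p`, `altVal 50 p q`, `altVal 50 q p` are free. -/
theorem lift_altVal_injective :
    Injective (FreeGroup.lift fun o : Option Bool =>
      (o.elim (FreeGroup.of false) fun b =>
        cond b (altVal 50 (FreeGroup.of true) (FreeGroup.of false))
          (altVal 50 (FreeGroup.of false) (FreeGroup.of true)) : FreeGroup Bool)) := by
  let S : Set NzVec := {v | |v.1.1| ≤ |v.1.2|}
  have hS : S.Nonempty := ⟨⟨(0, 1), by simp⟩, by simp [S]⟩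
  have hp : ∀ k : ℤ, k ≠ 0 → ∀ v ∈ S, shearX ^ k • v ∉ S := by
    intro k hk v hv
    change ¬ |((shearX ^ k) v).1.1| ≤ |((shearX ^ k) v).1.2|
    rw [shearX_zpow, not_le]
    refine abs_lt_abs_add_mul (fun hy => v.2 ?_) hk hv
    have hx : |v.1.1| ≤ |v.1.2| := hv
    rw [hy, abs_zero, abs_nonpos_iff] at hx
    exact Prod.ext hx hy
  have hq : ∀ k : ℤ, k ≠ 0 → ∀ v ∉ S, shearY ^ k • v ∈ S := by
    intro k hk v hv
    change |((shearY ^ k) v).1.1| ≤ |((shearY ^ k) v).1.2|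
    rw [shearY_zpow]
    have hv' : |v.1.2| < |v.1.1| := not_le.1 hv
    exact (abs_lt_abs_add_mul (abs_pos.1 ((abs_nonneg _).trans_lt hv')) hk hv'.le).le
  have key := lift_injective_of_movesOff hS hp hq
    (movesOff_zpow_mul_prod hp hq 3 4 5 (by norm_num) (by norm_num) (by norm_num) 48)
    (movesOff_zpow_mul_prod hp hq 2 3 4 (by norm_num) (by norm_num) (by norm_num) 48)
  let c : Option Bool → FreeGroup (Option Bool) := fun o => o.elim (FreeGroup.of none) fun b =>
    cond b (FreeGroup.of (some true) * FreeGroup.of none ^ 100)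
      (FreeGroup.of none * FreeGroup.of (some false))
  have hc : Injective (FreeGroup.lift c) :=
    freeGroup_lift_injective_of_leftInverse (fun o => o.elim (FreeGroup.of none) fun b =>
      cond b (FreeGroup.of (some true) * (FreeGroup.of none ^ 100)⁻¹)
        ((FreeGroup.of none)⁻¹ * FreeGroup.of (some false))) (by
          rintro (_ | _ | _) <;> simp [c])
  let r : FreeGroup Bool →* Equiv.Perm NzVec := FreeGroup.lift fun b => cond b shearY shearX
  refine Injective.of_comp (f := r) ?_
  convert key.comp hc
  rw [← MonoidHom.coe_comp, ← MonoidHom.coe_comp]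
  congr 1
  ext o : 1
  rcases o with _ | _ | _
  · simp [r, c]
  · simp only [MonoidHom.comp_apply, FreeGroup.lift_apply_of, Option.elim, cond, map_altVal, r, c,
      map_mul]
    rw [altVal_add_two _ _ 48]
    norm_cast
  · simp only [MonoidHom.comp_apply, FreeGroup.lift_apply_of, Option.elim, cond, map_altVal, r, c,
      map_mul, map_pow]
    rw [altVal_add_two' _ _ 48]
    simp only [zpow_one]
    norm_cast

/-- A finite approximation of a system of equations `u(x, y) = f x`, realised in a group by
pairs of elements which are exchanged by an involution. -/
theorem exists_pair_model {X : Type} (f : X → X) (h : X → ℤ) (D : Finset X)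
    (hD : ∀ x ∈ D, h x < h (f x)) :
    ∃ (P : Type) (_ : Group P) (α : X → Bool → P),
      Injective (FreeGroup.lift fun x => α x false) ∧ (∀ x, Injective (FreeGroup.lift (α x))) ∧
      ∀ x ∈ D, α (f x) false = altVal 50 (α x false) (α x true) ∧
        α (f x) true = altVal 50 (α x true) (α x false) := by
  classical
  induction D using Finset.induction_on_min_value h with
  | empty =>
    refine ⟨FreeGroup (X × Bool), inferInstance, fun x b => FreeGroup.of (x, b), ?_, fun x => ?_,
      by simp⟩
    · exact freeGroup_lift_injective_of_leftInverse (fun y => FreeGroup.of y.1) (by simp)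
    · exact freeGroup_lift_injective_of_leftInverse (fun y => FreeGroup.of y.2) (by simp)
  | insert c s hc hmin ih =>
    obtain ⟨P, _, α, h1, h2, h3⟩ := ih fun x hx => hD x (Finset.mem_insert_of_mem hx)
    obtain ⟨Q, _, i, j, hi, hj, hij, -⟩ := exists_amalgam _ _
      (lift_inl_optionElim_injective (α (f c)) (h2 (f c))) lift_altVal_injective
    have hnone := hij (FreeGroup.of none)
    have hsome := fun b => hij (FreeGroup.of (some b))
    simp only [FreeGroup.lift_apply_of, Option.elim] at hnone hsome
    have hfc : f c ≠ c := fun e => by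
      have := hD c (Finset.mem_insert_self _ _)
      rw [e] at this
      exact lt_irrefl _ this
    have hfs : ∀ x ∈ s, f x ≠ c := fun x hx e => by
      have h4 := hD x (Finset.mem_insert_of_mem hx)
      rw [e] at h4
      exact absurd (hmin x hx) (not_le.2 h4)
    let β : X → Bool → Q := fun x b =>
      if x = c then j (FreeGroup.of b) else i (Monoid.Coprod.inl (α x b))
    have hβc : ∀ b, β c b = j (FreeGroup.of b) := fun b => if_pos rfl
    have hβ : ∀ x b, x ≠ c → β x b = i (Monoid.Coprod.inl (α x b)) := fun x b hx => if_neg hx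
    refine ⟨Q, inferInstance, β, ?_, fun x => ?_, fun x hx => ?_⟩
    · have hr : Injective (FreeGroup.lift fun x : X =>
          FreeGroup.of (if x = c then none else some x)) :=
        freeGroup_lift_injective_of_leftInverse (fun o => o.elim (FreeGroup.of c) FreeGroup.of) (by
          intro x
          by_cases hx : x = c <;> simp [hx])
      have := hi.comp ((lift_inl_optionElim_injective _ h1).comp hr)
      rw [← MonoidHom.coe_comp, ← MonoidHom.coe_comp] at this
      convert this using 2
      ext x
      by_cases hx : x = c
      · subst hx
        simp [hβc, hnone]
      · simp [hβ _ _ hx, hx]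
    · by_cases hx : x = c
      · subst hx
        convert hj using 2
        ext b
        simp [hβc]
      · have := hi.comp ((Monoid.Coprod.inl_injective (N := FreeGroup Unit)).comp (h2 x))
        rw [← MonoidHom.coe_comp, ← MonoidHom.coe_comp] at this
        convert this using 2
        ext b
        simp [hβ _ _ hx]
    · rcases Finset.mem_insert.1 hx with rfl | hx
      · rw [hβ _ _ hfc, hβ _ _ hfc, hβc, hβc, hsome, hsome, ← map_altVal, ← map_altVal]
        exact ⟨rfl, rfl⟩
      · have hxc : x ≠ c := fun e => hc (e ▸ hx)
        rw [hβ _ _ (hfs x hx), hβ _ _ (hfs x hx), hβ _ _ hxc, hβ _ _ hxc, (h3 x hx).1,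
          (h3 x hx).2]
        simp only [map_altVal, and_self]

theorem list_prod_pow_mul_swap {P Q : Type*} [Group P] [Group Q] (d : P × P →* Q) (s : Q)
    (hs : s * s = 1) (hd : ∀ p q, s * d (p, q) * s⁻¹ = d (q, p)) (p q : P) (n : ℕ) :
    ((List.range (2 * n)).map fun k => d (p, q) ^ (k + 1) * s).prod =
      d (altVal n p q, altVal n q p) := by
  have hs' : s⁻¹ = s := inv_eq_of_mul_eq_one_left hs
  have hd' : ∀ (p q : P) (k : ℕ), s * d (p, q) ^ k * s = d (q ^ k, p ^ k) := by
    intro p q k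
    have := hd (p ^ k) (q ^ k)
    rw [hs'] at this
    rw [← map_pow, Prod.pow_mk, this]
  induction n with
  | zero =>
    simp only [mul_zero, List.range_zero, List.map_nil, List.prod_nil, altVal]
    exact (map_one d).symm
  | succ n ih =>
    rw [show 2 * (n + 1) = 2 * n + 1 + 1 by ring, List.range_succ, List.range_succ]
    simp only [List.map_append, List.prod_append, ih, List.map_cons, List.map_nil,
      List.prod_singleton, altVal_succ]
    rw [mul_assoc, mul_assoc, ← mul_assoc s, hd', ← map_pow, ← map_mul, ← map_mul]
    rfl

/-- A finite approximation of a system of equations `u(x, y) = f x` has a solution in a group in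
which the unknowns are free. -/
theorem exists_uVal_model {X : Type} (f : X → X) (h : X → ℤ) (D : Finset X)
    (hD : ∀ x ∈ D, h x < h (f x)) :
    ∃ (Q : Type) (_ : Group Q) (v : X → Q) (y : Q), Injective (FreeGroup.lift v) ∧
      ∀ x ∈ D, uVal (v x) y = v (f x) := by
  obtain ⟨P, _, α, h1, -, h3⟩ := exists_pair_model f h D hD
  let Q := SemidirectProduct (P × P) (MulAut (P × P)) (MonoidHom.id (MulAut (P × P)))
  let d : P × P →* Q := SemidirectProduct.inl
  let s : Q := SemidirectProduct.inr MulEquiv.prodComm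
  have hd : ∀ p q, s * d (p, q) * s⁻¹ = d (q, p) := fun p q => by
    change SemidirectProduct.inr _ * d (p, q) * (SemidirectProduct.inr _)⁻¹ = _
    rw [← map_inv]
    exact (SemidirectProduct.inl_aut (φ := MonoidHom.id (MulAut (P × P))) MulEquiv.prodComm (p, q)).symm
  have hs : s * s = 1 := by
    have : (MulEquiv.prodComm * MulEquiv.prodComm : MulAut (P × P)) = 1 := by
      ext ⟨a, b⟩ <;> rfl
    rw [← map_mul, this, map_one]
  refine ⟨Q, inferInstance, fun x => d (α x false, α x true), s, ?_, fun x hx => ?_⟩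
  · have h2 : FreeGroup.lift (fun x => d (α x false, α x true)) =
        d.comp ((FreeGroup.lift fun x => α x false).prod (FreeGroup.lift fun x => α x true)) := by
      ext x <;> simp
    rw [h2, MonoidHom.coe_comp]
    exact SemidirectProduct.inl_injective.comp fun a b hab => h1 (congrArg Prod.fst hab)
  · refine (list_prod_pow_mul_swap d s hs hd _ _ 50).trans ?_
    rw [← (h3 x hx).1, ← (h3 x hx).2]

theorem exists_finset_mem_normalClosure {F ι : Type*} [Group F] (r : ι → F) (dom : Set ι) {g : F}
    (hg : g ∈ Subgroup.normalClosure (r '' dom)) :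
    ∃ D : Finset ι, ↑D ⊆ dom ∧ g ∈ Subgroup.normalClosure (r '' D) := by
  classical
  let N : Subgroup F :=
    { carrier := {g | ∃ D : Finset ι, ↑D ⊆ dom ∧ g ∈ Subgroup.normalClosure (r '' D)}
      one_mem' := ⟨∅, by simp, one_mem _⟩
      mul_mem' := by
        rintro a b ⟨D, hD, ha⟩ ⟨E, hE, hb⟩
        refine ⟨D ∪ E, by simp [hD, hE], mul_mem ?_ ?_⟩
        · exact Subgroup.normalClosure_mono (Set.image_mono (by simp)) ha
        · exact Subgroup.normalClosure_mono (Set.image_mono (by simp)) hb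
      inv_mem' := by
        rintro a ⟨D, hD, ha⟩
        exact ⟨D, hD, inv_mem ha⟩ }
  have : N.Normal := ⟨by
    rintro a ⟨D, hD, ha⟩ g
    exact ⟨D, hD, Subgroup.normalClosure_normal.conj_mem _ ha g⟩⟩
  refine Subgroup.normalClosure_le_normal (N := N) ?_ hg
  rintro _ ⟨x, hx, rfl⟩
  exact ⟨{x}, by simpa using hx, Subgroup.subset_normalClosure (by simp)⟩

attribute [irreducible] uVal

section Sys

variable {X I : Type} {f : I → X → X} {dom : I → Set X}

/-- The relators `u(x, i) = f i x`, for labels `i` and `x ∈ dom i`. -/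
def sysRels (f : I → X → X) (dom : I → Set X) : Set (FreeGroup (X ⊕ I)) :=
  {r | ∃ i, ∃ x ∈ dom i, r = uVal (FreeGroup.of (Sum.inl x)) (FreeGroup.of (Sum.inr i)) *
    (FreeGroup.of (Sum.inl (f i x)))⁻¹}

/-- The group generated by `X` and `I` subject to `u(x, i) = f i x` for `x ∈ dom i`. -/
abbrev Sys (f : I → X → X) (dom : I → Set X) := PresentedGroup (sysRels f dom)

theorem Sys.rel {i : I} {x : X} (hx : x ∈ dom i) :
    uVal (PresentedGroup.of (Sum.inl x) : Sys f dom) (PresentedGroup.of (Sum.inr i)) =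
      PresentedGroup.of (Sum.inl (f i x)) := by
  have := PresentedGroup.one_of_mem (rels := sysRels f dom) ⟨i, x, hx, rfl⟩
  rw [map_mul, map_uVal, map_inv, mul_inv_eq_one] at this
  exact this

/-- The homomorphism out of `Sys f dom` determined by a solution of the system. -/
def Sys.lift {P : Type*} [Group P] (g : X ⊕ I → P)
    (hg : ∀ i, ∀ x ∈ dom i, uVal (g (Sum.inl x)) (g (Sum.inr i)) = g (Sum.inl (f i x))) :
    Sys f dom →* P :=
  PresentedGroup.toGroup (f := g) (by
    rintro _ ⟨i, x, hx, rfl⟩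
    simp [map_uVal, hg i x hx])

@[simp]
theorem Sys.lift_of {P : Type*} [Group P] (g : X ⊕ I → P)
    (hg : ∀ i, ∀ x ∈ dom i, uVal (g (Sum.inl x)) (g (Sum.inr i)) = g (Sum.inl (f i x)))
    (y : X ⊕ I) : Sys.lift (f := f) (dom := dom) g hg (PresentedGroup.of y) = g y :=
  PresentedGroup.toGroup.of _

theorem Sys.injective_single (f : X → X) (dom : Set X) (h : X → ℤ)
    (hh : ∀ x ∈ dom, h x < h (f x)) :
    Injective (FreeGroup.lift fun x =>
      (PresentedGroup.of (Sum.inl x) : Sys (fun _ : Unit => f) fun _ => dom)) := by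
  rw [injective_iff_map_eq_one]
  intro w hw
  have h1 : FreeGroup.lift (fun x =>
      (PresentedGroup.of (Sum.inl x) : Sys (fun _ : Unit => f) fun _ => dom)) =
      (PresentedGroup.mk _).comp (FreeGroup.map Sum.inl) := by
    ext x; simp; rfl
  rw [h1, MonoidHom.comp_apply, PresentedGroup.mk_eq_one_iff] at hw
  have h2 : sysRels (fun _ : Unit => f) (fun _ => dom) =
      (fun x => uVal (FreeGroup.of (Sum.inl x)) (FreeGroup.of (Sum.inr ())) *
        (FreeGroup.of (Sum.inl (f x)))⁻¹) '' dom := by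
    ext r
    constructor
    · rintro ⟨_, x, hx, rfl⟩
      exact ⟨x, hx, rfl⟩
    · rintro ⟨x, hx, rfl⟩
      exact ⟨(), x, hx, rfl⟩
  rw [h2] at hw
  obtain ⟨D, hD, hw⟩ := exists_finset_mem_normalClosure _ _ hw
  obtain ⟨Q, _, v, y, hv, hvy⟩ := exists_uVal_model f h D fun x hx => hh x (hD hx)
  let F : FreeGroup (X ⊕ Unit) →* Q := FreeGroup.lift (Sum.elim v fun _ => y)
  have hF : FreeGroup.map Sum.inl w ∈ F.ker := by
    refine Subgroup.normalClosure_le_normal ?_ hw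
    rintro _ ⟨x, hx, rfl⟩
    simp [F, MonoidHom.mem_ker, map_uVal, hvy x hx]
  have h3 : F.comp (FreeGroup.map Sum.inl) = FreeGroup.lift v := by
    ext x; simp [F]
  refine hv ?_
  rw [← h3, map_one]
  exact hF

/-- The elements of `X` freely generate a free subgroup of `Sys f dom`. -/
theorem Sys.injective_lift_inl (h : I → X → ℤ) (hh : ∀ i, ∀ x ∈ dom i, h i x < h i (f i x)) :
    Injective (FreeGroup.lift fun x => (PresentedGroup.of (Sum.inl x) : Sys f dom)) := by
  let φ : ∀ i : I, FreeGroup X →* Sys (fun _ : Unit => f i) (fun _ => dom i) := fun i =>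
    FreeGroup.lift fun x => PresentedGroup.of (Sum.inl x)
  have hφ : ∀ i, Injective (φ i) := fun i => Sys.injective_single (f i) (dom i) (h i) (hh i)
  have hof : ∀ i x, Monoid.PushoutI.of (φ := φ) i (PresentedGroup.of (Sum.inl x)) =
      Monoid.PushoutI.base φ (FreeGroup.of x) := fun i x => by
    rw [← Monoid.PushoutI.of_apply_eq_base φ i]
    simp [φ]
  let F : Sys f dom →* Monoid.PushoutI φ :=
    Sys.lift (Sum.elim (fun x => Monoid.PushoutI.base φ (FreeGroup.of x))
      fun i => Monoid.PushoutI.of (φ := φ) i (PresentedGroup.of (Sum.inr ()))) (by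
        intro i x hx
        simp only [Sum.elim_inl, Sum.elim_inr]
        rw [← hof i, ← hof i, ← map_uVal]
        exact congrArg _ (Sys.rel (f := fun _ : Unit => f i) (dom := fun _ => dom i) hx))
  have hF : F.comp (FreeGroup.lift fun x => PresentedGroup.of (Sum.inl x)) =
      Monoid.PushoutI.base φ := by
    ext x; simp [F]
  refine Injective.of_comp (f := F) ?_
  rw [← MonoidHom.coe_comp, hF]
  exact Monoid.PushoutI.base_injective hφ

/-- The map from the system with the label `i` left out to the whole system. -/
def Sys.incl (f : I → X → X) (dom : I → Set X) (i : I) :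
    Sys (fun j : {j // j ≠ i} => f j) (fun j => dom j) →* Sys f dom :=
  Sys.lift (Sum.elim (fun x => PresentedGroup.of (Sum.inl x))
    fun j => PresentedGroup.of (Sum.inr j)) fun _ _ hx => Sys.rel hx

@[simp]
theorem Sys.incl_inl (i : I) (x : X) :
    Sys.incl f dom i (PresentedGroup.of (Sum.inl x)) = PresentedGroup.of (Sum.inl x) :=
  Sys.lift_of _ (fun _ _ hx => Sys.rel hx) _

@[simp]
theorem Sys.incl_inr (i : I) (j : {j // j ≠ i}) :
    Sys.incl f dom i (PresentedGroup.of (Sum.inr j)) = PresentedGroup.of (Sum.inr j.1) :=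
  Sys.lift_of _ (fun _ _ hx => Sys.rel hx) _

theorem Sys.incl_injective (h : I → X → ℤ) (hh : ∀ i, ∀ x ∈ dom i, h i x < h i (f i x)) (i : I) :
    Injective (Sys.incl f dom i) := by
  classical
  obtain ⟨Q, _, α, β, hα, -, hαβ, -⟩ := exists_amalgam _ _
    (Sys.injective_lift_inl (f := fun j : {j // j ≠ i} => f j) (dom := fun j => dom j)
      (fun j => h j) fun j => hh j)
    (Sys.injective_single (f i) (dom i) (h i) (hh i))
  have hx : ∀ x, α (PresentedGroup.of (Sum.inl x)) = β (PresentedGroup.of (Sum.inl x)) :=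
    fun x => by simpa using hαβ (FreeGroup.of x)
  let F : Sys f dom →* Q :=
    Sys.lift (Sum.elim (fun x => α (PresentedGroup.of (Sum.inl x)))
      fun j => if hj : j = i then β (PresentedGroup.of (Sum.inr ()))
        else α (PresentedGroup.of (Sum.inr ⟨j, hj⟩))) (by
      intro j x hxj
      simp only [Sum.elim_inl, Sum.elim_inr]
      by_cases hj : j = i
      · subst hj
        rw [dif_pos rfl, hx, hx, ← map_uVal]
        exact congrArg _ (Sys.rel (f := fun _ : Unit => f j) (dom := fun _ => dom j) hxj)
      · rw [dif_neg hj, ← map_uVal]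
        exact congrArg _ (Sys.rel (f := fun j : {j // j ≠ i} => f j) (i := ⟨j, hj⟩) hxj))
  have hF : F.comp (Sys.incl f dom i) = α := by
    ext y
    rcases y with x | ⟨j, hj⟩
    · simp [F]
    · simp [F, hj]
  refine Injective.of_comp (f := F) ?_
  rw [← MonoidHom.coe_comp, hF]
  exact hα

end Sys

/-- The endomorphism of `Sys f dom` induced by a self-map of `X` compatible with the labels. -/
def Sys.map {X I : Type} {f : I → X → X} {dom : I → Set X} (φ : X → X)
    (hφ : ∀ i x, φ (f i x) = f i (φ x)) (hdom : ∀ i, ∀ x ∈ dom i, φ x ∈ dom i) :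
    Sys f dom →* Sys f dom :=
  Sys.lift (Sum.elim (fun x => PresentedGroup.of (Sum.inl (φ x)))
    fun j => PresentedGroup.of (Sum.inr j)) fun i x hx => by
      simp only [Sum.elim_inl, Sum.elim_inr]
      rw [hφ]
      exact Sys.rel (hdom i x hx)

@[simp]
theorem Sys.map_inl {X I : Type} {f : I → X → X} {dom : I → Set X} (φ : X → X)
    (hφ : ∀ i x, φ (f i x) = f i (φ x)) (hdom : ∀ i, ∀ x ∈ dom i, φ x ∈ dom i) (x : X) :
    Sys.map φ hφ hdom (PresentedGroup.of (Sum.inl x)) = PresentedGroup.of (Sum.inl (φ x)) :=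
  Sys.lift_of _ _ _

@[simp]
theorem Sys.map_inr {X I : Type} {f : I → X → X} {dom : I → Set X} (φ : X → X)
    (hφ : ∀ i x, φ (f i x) = f i (φ x)) (hdom : ∀ i, ∀ x ∈ dom i, φ x ∈ dom i) (j : I) :
    Sys.map φ hφ hdom (PresentedGroup.of (Sum.inr j)) = PresentedGroup.of (Sum.inr j) :=
  Sys.lift_of _ _ _

/-- The vertex set of the tree. -/
abbrev Vtx := ℕ × List ℤ

/-- The vertex map shifting rays down: `(n+1, τ) ↦ (n, τ)` and `(0, τ) ↦ (0, i :: τ)`. -/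
def vDown (i : ℤ) : Vtx → Vtx
  | (0, τ) => (0, i :: τ)
  | (n + 1, τ) => (n, τ)

/-- A partial left inverse of `vDown i`. -/
def vUp (i : ℤ) : Vtx → Vtx
  | (0, []) => (1, [])
  | (0, j :: τ) => if j = i then (0, τ) else (1, j :: τ)
  | (n + 1, τ) => (n + 2, τ)

theorem vDown_parent (i : ℤ) (v : Vtx) :
    vDown i (parent v.1 v.2) = parent (vDown i v).1 (vDown i v).2 := by
  obtain ⟨_ | n, _ | ⟨j, τ⟩⟩ := v <;> rfl

theorem vDown_append (i : ℤ) (v : Vtx) (j : ℤ) :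
    vDown i (v.1, v.2 ++ [j]) = ((vDown i v).1, (vDown i v).2 ++ [j]) := by
  obtain ⟨_ | n, τ⟩ := v <;> rfl

theorem vUp_parent (i : ℤ) (v : Vtx) :
    vUp i (parent v.1 v.2) = parent (vUp i v).1 (vUp i v).2 := by
  obtain ⟨_ | n, _ | ⟨j, _ | ⟨k, τ⟩⟩⟩ := v <;> try rfl
  all_goals by_cases h : j = i <;> simp [parent, vUp, h]

theorem vUp_append (i : ℤ) (v : Vtx) (j : ℤ) (hj : j ≠ i) :
    vUp i (v.1, v.2 ++ [j]) = ((vUp i v).1, (vUp i v).2 ++ [j]) := by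
  obtain ⟨_ | n, _ | ⟨k, τ⟩⟩ := v <;> try rfl
  · simp [vUp, hj]
  · by_cases h : k = i <;> simp [vUp, h]

theorem eventually_vUp_vDown (v : Vtx) : ∀ᶠ i in Filter.cofinite, vUp i (vDown i v) = v := by
  obtain ⟨_ | _ | n, τ⟩ := v
  · exact Filter.Eventually.of_forall fun i => if_pos rfl
  · cases τ with
    | nil => exact Filter.Eventually.of_forall fun i => rfl
    | cons k τ => exact (Filter.eventually_cofinite_ne k).mono fun i hi => if_neg hi.symm
  · exact Filter.Eventually.of_forall fun i => rfl

/-- The label action on two copies of the tree: `inl c` is the letter `a` for the copy `c`, and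
`inr j` is the letter `b_j`. -/
def dblFun : Bool ⊕ ℤ → Vtx × Bool → Vtx × Bool
  | Sum.inl _, x => (parent x.1.1 x.1.2, x.2)
  | Sum.inr j, x => ((x.1.1, x.1.2 ++ [j]), x.2)

/-- The domains of the labels in `dblFun`. -/
def dblDom : Bool ⊕ ℤ → Set (Vtx × Bool)
  | Sum.inl c => {x | x.2 = c}
  | Sum.inr _ => Set.univ

/-- Two copies of `K` amalgamated along the letters `b_j`. -/
abbrev DblK := Sys dblFun dblDom

/-- Height functions which increase along the labels. -/
def dblHeight : Bool ⊕ ℤ → Vtx × Bool → ℤ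
  | Sum.inl _, x => x.1.1 - x.1.2.length
  | Sum.inr _, x => x.1.2.length

theorem dblHeight_lt (l : Bool ⊕ ℤ) (x : Vtx × Bool) (_ : x ∈ dblDom l) :
    dblHeight l x < dblHeight l (dblFun l x) := by
  obtain ⟨⟨n, _ | ⟨j, τ⟩⟩, c⟩ := x <;> cases l <;>
    simp [dblHeight, dblFun, parent]

theorem dblFun_vDown (i : ℤ) (l : Bool ⊕ ℤ) (x : Vtx × Bool) :
    Prod.map (vDown i) id (dblFun l x) = dblFun l (Prod.map (vDown i) id x) := by
  cases l
  · simp [dblFun, vDown_parent]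
  · simp [dblFun, vDown_append]

theorem dblFun_vUp (i : ℤ) (l : Bool ⊕ ℤ) (hl : l ≠ Sum.inr i) (x : Vtx × Bool) :
    Prod.map (vUp i) id (dblFun l x) = dblFun l (Prod.map (vUp i) id x) := by
  rcases l with c | j
  · simp [dblFun, vUp_parent]
  · simp [dblFun, vUp_append i _ j fun h => hl (congrArg _ h)]

theorem map_mem_dblDom (φ : Vtx → Vtx) (l : Bool ⊕ ℤ) (x : Vtx × Bool) (hx : x ∈ dblDom l) :
    Prod.map φ id x ∈ dblDom l := by
  cases l <;> exact hx

/-- The endomorphism of `DblK` induced by `vDown i`. -/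
def dblDown (i : ℤ) : DblK →* DblK :=
  Sys.map (Prod.map (vDown i) id) (dblFun_vDown i) (map_mem_dblDom _)

/-- The group `DblK` with the letter `b_i` left out. -/
abbrev DblKSub (i : ℤ) :=
  Sys (fun l : {l : Bool ⊕ ℤ // l ≠ Sum.inr i} => dblFun l) fun l => dblDom l

/-- The endomorphism of `DblKSub i` induced by `vDown i`. -/
def dblSubDown (i : ℤ) : DblKSub i →* DblKSub i :=
  Sys.map (Prod.map (vDown i) id) (fun l => dblFun_vDown i l) fun l => map_mem_dblDom _ l

/-- The endomorphism of `DblKSub i` induced by `vUp i`. -/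
def dblSubUp (i : ℤ) : DblKSub i →* DblKSub i :=
  Sys.map (Prod.map (vUp i) id) (fun l => dblFun_vUp i l l.2) fun l => map_mem_dblDom _ l

open Classical in
/-- The map from words to `DblKSub i` which deletes the letter `b_i`. -/
noncomputable def dblDelete (i : ℤ) : FreeGroup ((Vtx × Bool) ⊕ (Bool ⊕ ℤ)) →* DblKSub i :=
  FreeGroup.lift (Sum.elim (fun x => PresentedGroup.of (Sum.inl x))
    fun l => if hl : l = Sum.inr i then 1 else PresentedGroup.of (Sum.inr ⟨l, hl⟩))

theorem eventually_incl_dblDelete (w : FreeGroup ((Vtx × Bool) ⊕ (Bool ⊕ ℤ))) :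
    ∀ᶠ i in Filter.cofinite,
      Sys.incl dblFun dblDom (Sum.inr i) (dblDelete i w) = PresentedGroup.mk _ w := by
  induction w using FreeGroup.induction_on with
  | C1 => simp
  | of x =>
    rcases x with x | c | j
    · refine Filter.Eventually.of_forall fun i => ?_
      simp only [dblDelete, FreeGroup.lift_apply_of, Sum.elim_inl, Sys.incl_inl]
      rfl
    · refine Filter.Eventually.of_forall fun i => ?_
      simp only [dblDelete, FreeGroup.lift_apply_of, Sum.elim_inr, reduceCtorEq, dite_false,
        Sys.incl_inr]
      rfl
    · refine (Filter.eventually_cofinite_ne j).mono fun i hi => ?_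
      simp only [dblDelete, FreeGroup.lift_apply_of, Sum.elim_inr, Sum.inr.injEq, hi.symm,
        dite_false, Sys.incl_inr]
      rfl
  | inv_of x ih => exact ih.mono fun i hi => by rw [map_inv, map_inv, hi, map_inv]
  | mul x y hx hy =>
    filter_upwards [hx, hy] with i h1 h2
    rw [map_mul, map_mul, h1, h2, map_mul]

theorem eventually_dblSubUp_dblSubDown (w : FreeGroup ((Vtx × Bool) ⊕ (Bool ⊕ ℤ))) :
    ∀ᶠ i in Filter.cofinite,
      dblSubUp i (dblSubDown i (dblDelete i w)) = dblDelete i w := by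
  induction w using FreeGroup.induction_on with
  | C1 => simp
  | of x =>
    rcases x with ⟨v, c⟩ | l
    · refine (eventually_vUp_vDown v).mono fun i hi => ?_
      simp [dblDelete, dblSubUp, dblSubDown, hi]
    · refine Filter.Eventually.of_forall fun i => ?_
      by_cases h : l = Sum.inr i <;> simp [dblDelete, dblSubUp, dblSubDown, h]
  | inv_of x ih => exact ih.mono fun i hi => by rw [map_inv, map_inv, map_inv, hi]
  | mul x y hx hy =>
    filter_upwards [hx, hy] with i h1 h2
    rw [map_mul, map_mul, map_mul, h1, h2]

theorem dblDown_incl (i : ℤ) (k : DblKSub i) :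
    dblDown i (Sys.incl dblFun dblDom (Sum.inr i) k) =
      Sys.incl dblFun dblDom (Sum.inr i) (dblSubDown i k) := by
  have : (dblDown i).comp (Sys.incl dblFun dblDom (Sum.inr i)) =
      (Sys.incl dblFun dblDom (Sum.inr i)).comp (dblSubDown i) := by
    ext y
    rcases y with x | l <;> simp [dblDown, dblSubDown]
  exact DFunLike.congr_fun this k

theorem eventually_dblDown_ne_one {g : DblK} (hg : g ≠ 1) :
    ∀ᶠ i in Filter.cofinite, dblDown i g ≠ 1 := by
  obtain ⟨w, rfl⟩ := PresentedGroup.mk_surjective _ g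
  filter_upwards [eventually_incl_dblDelete w, eventually_dblSubUp_dblSubDown w] with i h1 h2 h3
  rw [← h1, dblDown_incl, map_eq_one_iff _ (Sys.incl_injective dblHeight dblHeight_lt _)] at h3
  rw [h3, map_one] at h2
  rw [← h2, map_one] at h1
  exact hg h1.symm

/-- The homomorphism out of `K` determined by a solution of its defining relations. -/
def K.lift {P : Type*} [Group P] (g : KGen → P)
    (ha : ∀ n τ, uVal (g (.vert n τ)) (g .a) = g (.vert (parent n τ).1 (parent n τ).2))
    (hb : ∀ n τ i, uVal (g (.vert n τ)) (g (.b i)) = g (.vert n (τ ++ [i]))) : K →* P :=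
  PresentedGroup.toGroup (f := g) (by
    rintro _ ⟨w, ⟨n, τ, rfl⟩ | ⟨n, τ, i, rfl⟩, rfl⟩
    · rw [lift_mk_uWord, ha, mul_inv_cancel]
    · rw [lift_mk_uWord, hb, mul_inv_cancel])

@[simp]
theorem K.lift_of {P : Type*} [Group P] (g : KGen → P)
    (ha : ∀ n τ, uVal (g (.vert n τ)) (g .a) = g (.vert (parent n τ).1 (parent n τ).2))
    (hb : ∀ n τ i, uVal (g (.vert n τ)) (g (.b i)) = g (.vert n (τ ++ [i]))) (x : KGen) :
    K.lift g ha hb (PresentedGroup.of x) = g x :=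
  PresentedGroup.toGroup.of _

theorem uVal_of_of {α : Type} {rels : Set (FreeGroup α)} {x y z : α}
    (h : FreeGroup.mk (uWord x y ++ [(z, false)]) ∈ rels) :
    uVal (PresentedGroup.of x : PresentedGroup rels) (PresentedGroup.of y) =
      PresentedGroup.of z := by
  have h1 : PresentedGroup.mk rels = FreeGroup.lift PresentedGroup.of := by
    ext x; simp; rfl
  have := PresentedGroup.one_of_mem h
  rwa [h1, lift_mk_uWord, mul_inv_eq_one] at this

theorem K.uVal_a (n : ℕ) (τ : List ℤ) :
    uVal (PresentedGroup.of (.vert n τ) : K) (PresentedGroup.of .a) =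
      PresentedGroup.of (.vert (parent n τ).1 (parent n τ).2) :=
  uVal_of_of ⟨_, Or.inl ⟨n, τ, rfl⟩, rfl⟩

theorem K.uVal_b (n : ℕ) (τ : List ℤ) (i : ℤ) :
    uVal (PresentedGroup.of (.vert n τ) : K) (PresentedGroup.of (.b i)) =
      PresentedGroup.of (.vert n (τ ++ [i])) :=
  uVal_of_of ⟨_, Or.inr ⟨n, τ, i, rfl⟩, rfl⟩

/-- The map on generators of `K` induced by a map of vertices. -/
def KGen.vmap (φ : Vtx → Vtx) : KGen → KGen
  | .vert n τ => .vert (φ (n, τ)).1 (φ (n, τ)).2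
  | .a => .a
  | .b i => .b i

/-- The endomorphism of `K` induced by a map of vertices compatible with the labels. -/
def K.map (φ : Vtx → Vtx) (h1 : ∀ v, φ (parent v.1 v.2) = parent (φ v).1 (φ v).2)
    (h2 : ∀ v j, φ (v.1, v.2 ++ [j]) = ((φ v).1, (φ v).2 ++ [j])) : K →* K :=
  K.lift (fun x => PresentedGroup.of (x.vmap φ))
    (fun n τ => by
      simp only [KGen.vmap]
      rw [K.uVal_a, ← h1 (n, τ)])
    (fun n τ i => by
      simp only [KGen.vmap]
      rw [K.uVal_b, h2 (n, τ)])

@[simp]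
theorem K.map_of (φ : Vtx → Vtx) (h1 : ∀ v, φ (parent v.1 v.2) = parent (φ v).1 (φ v).2)
    (h2 : ∀ v j, φ (v.1, v.2 ++ [j]) = ((φ v).1, (φ v).2 ++ [j])) (x : KGen) :
    K.map φ h1 h2 (PresentedGroup.of x) = PresentedGroup.of (x.vmap φ) :=
  K.lift_of _ _ _ _

/-- The endomorphism of `K` induced by `vDown i`. -/
def K.down (i : ℤ) : K →* K := K.map (vDown i) (vDown_parent i) (vDown_append i)

/-- The images in the two copies of `K` in `DblK` of the generators of `K`. -/
def KGen.dbl (c : Bool) : KGen → (Vtx × Bool) ⊕ (Bool ⊕ ℤ)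
  | .vert n τ => Sum.inl ((n, τ), c)
  | .a => Sum.inr (Sum.inl c)
  | .b i => Sum.inr (Sum.inr i)

/-- The two embeddings of `K` in `DblK`. -/
def K.dbl (c : Bool) : K →* DblK :=
  K.lift (fun x => PresentedGroup.of (x.dbl c))
    (fun n τ => Sys.rel (f := dblFun) (dom := dblDom) (i := Sum.inl c) (x := ((n, τ), c)) rfl)
    (fun n τ i => Sys.rel (f := dblFun) (dom := dblDom) (i := Sum.inr i) (x := ((n, τ), c)) trivial)

@[simp]
theorem K.dbl_of (c : Bool) (x : KGen) :
    K.dbl c (PresentedGroup.of x) = PresentedGroup.of (x.dbl c) :=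
  K.lift_of _ _ _ _

/-- The folding of the two copies of `K` in `DblK` into one. -/
def DblK.fold : DblK →* K :=
  Sys.lift (Sum.elim (fun x => PresentedGroup.of (.vert x.1.1 x.1.2)) fun l =>
    PresentedGroup.of (l.elim (fun _ => .a) .b)) (by
      rintro (c | j) ⟨⟨n, τ⟩, d⟩ hx
      · exact K.uVal_a n τ
      · exact K.uVal_b n τ j)

theorem K.fold_dbl (c : Bool) (k : K) : DblK.fold (K.dbl c k) = k := by
  have : DblK.fold.comp (K.dbl c) = MonoidHom.id K := by
    ext x
    cases x <;> simp [KGen.dbl, DblK.fold]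
  exact DFunLike.congr_fun this k

theorem K.dbl_injective (c : Bool) : Injective (K.dbl c) :=
  LeftInverse.injective (K.fold_dbl c)

theorem K.dblDown_dbl (c : Bool) (i : ℤ) (k : K) :
    dblDown i (K.dbl c k) = K.dbl c (K.down i k) := by
  have : (dblDown i).comp (K.dbl c) = (K.dbl c).comp (K.down i) := by
    ext x
    cases x <;> simp [KGen.dbl, dblDown, K.down, KGen.vmap]
  exact DFunLike.congr_fun this k

theorem K.vert_injective (v w : Vtx)
    (h : (PresentedGroup.of (.vert v.1 v.2) : K) = PresentedGroup.of (.vert w.1 w.2)) : v = w := by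
  have h1 := congrArg (K.dbl true) h
  have h2 := Sys.injective_lift_inl dblHeight dblHeight_lt
    (a₁ := FreeGroup.of (v, true)) (a₂ := FreeGroup.of (w, true)) (by simpa [KGen.dbl] using h1)
  exact congrArg Prod.fst (FreeGroup.of_injective h2)

theorem K.eventually_down_ne_one {k : K} (hk : k ≠ 1) :
    ∀ᶠ i in Filter.cofinite, K.down i k ≠ 1 := by
  have h : K.dbl true k ≠ 1 := (map_ne_one_iff _ (K.dbl_injective true)).2 hk
  refine (eventually_dblDown_ne_one h).mono fun i hi h1 => hi ?_
  rw [K.dblDown_dbl, h1, map_one]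

/-- The subgroup of `K` generated by the letters `b_i`. -/
def K.bSubgroup : Subgroup K := Subgroup.closure (Set.range fun i : ℤ => PresentedGroup.of (.b i))

theorem K.dbl_eq_of_mem {k : K} (hk : k ∈ K.bSubgroup) : K.dbl true k = K.dbl false k := by
  have : K.bSubgroup ≤ MonoidHom.eqLocus (K.dbl true) (K.dbl false) := by
    refine (Subgroup.closure_le _).2 ?_
    rintro _ ⟨i, rfl⟩
    change K.dbl true _ = K.dbl false _
    simp [KGen.dbl]
  exact this hk

theorem K.mem_of_dbl_eq {k : K} (hk : K.dbl true k = K.dbl false k) : k ∈ K.bSubgroup := by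
  obtain ⟨Q, _, α, β, -, -, hαβ, hmem⟩ := exists_amalgam K.bSubgroup.subtype K.bSubgroup.subtype
    K.bSubgroup.subtype_injective K.bSubgroup.subtype_injective
  have hb : ∀ i : ℤ, α (PresentedGroup.of (.b i)) = β (PresentedGroup.of (.b i)) := fun i =>
    hαβ ⟨_, Subgroup.subset_closure ⟨i, rfl⟩⟩
  let F : DblK →* Q :=
    Sys.lift (Sum.elim (fun x => cond x.2 (α (PresentedGroup.of (.vert x.1.1 x.1.2)))
      (β (PresentedGroup.of (.vert x.1.1 x.1.2)))) (Sum.elim (fun c =>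
        cond c (α (PresentedGroup.of .a)) (β (PresentedGroup.of .a)))
        fun j => α (PresentedGroup.of (.b j)))) (by
      rintro (c | j) ⟨⟨n, τ⟩, d⟩ hx
      · obtain rfl : d = c := hx
        cases d
        · exact (map_uVal β _ _).symm.trans (congrArg β (K.uVal_a n τ))
        · exact (map_uVal α _ _).symm.trans (congrArg α (K.uVal_a n τ))
      · cases d
        · simp only [Sum.elim_inl, Sum.elim_inr, hb]
          exact (map_uVal β _ _).symm.trans (congrArg β (K.uVal_b n τ j))
        · exact (map_uVal α _ _).symm.trans (congrArg α (K.uVal_b n τ j)))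
  have hα : F.comp (K.dbl true) = α := by
    ext x
    cases x <;> simp [KGen.dbl, F]
  have hβ : F.comp (K.dbl false) = β := by
    ext x
    cases x <;> simp [KGen.dbl, F, hb]
  have h : α k = β k := by
    rw [← hα, ← hβ, MonoidHom.comp_apply, MonoidHom.comp_apply, hk]
  obtain ⟨⟨h, hh⟩, rfl, -⟩ := hmem _ _ h
  exact hh

theorem K.eventually_down_notMem {k : K} (hk : k ∉ K.bSubgroup) :
    ∀ᶠ i in Filter.cofinite, K.down i k ∉ K.bSubgroup := by
  have h : K.dbl true k * (K.dbl false k)⁻¹ ≠ 1 := fun h =>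
    hk (K.mem_of_dbl_eq (mul_inv_eq_one.1 h))
  refine (eventually_dblDown_ne_one h).mono fun i hi h1 => hi ?_
  rw [map_mul, map_inv, K.dblDown_dbl, K.dblDown_dbl, K.dbl_eq_of_mem h1, mul_inv_cancel]

theorem K.down_of_mem {k : K} (hk : k ∈ K.bSubgroup) (i : ℤ) : K.down i k = k := by
  have : K.bSubgroup ≤ MonoidHom.eqLocus (K.down i) (MonoidHom.id K) := by
    refine (Subgroup.closure_le _).2 ?_
    rintro _ ⟨j, rfl⟩
    change K.down i _ = MonoidHom.id K _
    simp [K.down, KGen.vmap]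
  exact this hk

section HNN

variable {M : Type*} [Group M] {A B : Subgroup M} {φ : A ≃* B} {ι : Type*} {l : Filter ι}

theorem eventually_isChain_map (θ : ι → M →* M)
    (hAB : ∀ (u : ℤˣ) (k : M), k ∉ HNNExtension.toSubgroup A B u →
      ∀ᶠ i in l, θ i k ∉ HNNExtension.toSubgroup A B u)
    (L : List (ℤˣ × M))
    (hL : L.IsChain fun a b => a.2 ∈ HNNExtension.toSubgroup A B a.1 → a.1 = b.1) :
    ∀ᶠ i in l, (L.map (Prod.map id (θ i))).IsChain
      fun a b => a.2 ∈ HNNExtension.toSubgroup A B a.1 → a.1 = b.1 := by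
  induction L with
  | nil => simp
  | cons a L ih =>
    cases L with
    | nil => simp
    | cons b L =>
      rw [List.isChain_cons_cons] at hL
      have hab : ∀ᶠ i in l, θ i a.2 ∈ HNNExtension.toSubgroup A B a.1 → a.1 = b.1 := by
        by_cases h : a.2 ∈ HNNExtension.toSubgroup A B a.1
        · exact Filter.Eventually.of_forall fun _ _ => hL.1 h
        · exact (hAB _ _ h).mono fun i hi h' => absurd h' hi
      filter_upwards [ih hL.2, hab] with i h1 h2
      simp only [List.map_cons] at h1 ⊢
      exact List.isChain_cons_cons.2 ⟨h2, h1⟩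

/-- Endomorphisms of an HNN extension which eventually detect the nontriviality of elements of the
base group and their non-membership in the associated subgroups eventually detect the
nontriviality of all elements. -/
theorem eventually_hnn_ne_one (θ : ι → M →* M)
    (Θ : ι → HNNExtension M A B φ →* HNNExtension M A B φ)
    (hof : ∀ i k, Θ i (HNNExtension.of k) = HNNExtension.of (θ i k))
    (ht : ∀ i, Θ i HNNExtension.t = HNNExtension.t)
    (h1 : ∀ k, k ≠ 1 → ∀ᶠ i in l, θ i k ≠ 1)
    (hAB : ∀ (u : ℤˣ) (k : M), k ∉ HNNExtension.toSubgroup A B u →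
      ∀ᶠ i in l, θ i k ∉ HNNExtension.toSubgroup A B u)
    {g : HNNExtension M A B φ} (hg : g ≠ 1) : ∀ᶠ i in l, Θ i g ≠ 1 := by
  obtain ⟨d⟩ := HNNExtension.NormalWord.TransversalPair.nonempty M A B
  obtain ⟨w, rfl⟩ := (HNNExtension.NormalWord.equiv φ d).symm.surjective g
  change w.prod φ ≠ 1 at hg
  change ∀ᶠ i in l, Θ i (w.prod φ) ≠ 1
  have hΘ : ∀ i, Θ i (w.prod φ) = HNNExtension.of (θ i w.head) *
      ((w.toList.map (Prod.map id (θ i))).map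
        fun x => HNNExtension.t ^ (x.1 : ℤ) * HNNExtension.of x.2).prod := by
    intro i
    simp [HNNExtension.NormalWord.ReducedWord.prod, map_list_prod, Function.comp_def, hof, ht]
  by_cases hw : w.toList = []
  · have hhead : w.head ≠ 1 := by
      rintro h
      exact hg (by simp [HNNExtension.NormalWord.ReducedWord.prod, hw, h])
    refine (h1 _ hhead).mono fun i hi h => hi ?_
    rw [hΘ, hw] at h
    refine HNNExtension.of_injective (φ := φ) ?_
    simpa using h
  · refine (eventually_isChain_map θ hAB w.toList w.chain).mono fun i hi h => hw ?_
    have := HNNExtension.ReducedWord.toList_eq_nil_of_mem_of_range φ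
      (w := ⟨θ i w.head, _, hi⟩) ⟨1, by rw [map_one, ← h, hΘ]; rfl⟩
    simpa using this

end HNN

/-- The homomorphism out of `G` determined by a solution of its defining relations. -/
def G.lift {P : Type*} [Group P] (g : K →* P) (s : P)
    (hs : ∀ i, s * g (PresentedGroup.of (.b i)) = g (PresentedGroup.of (.b (i + 1))) * s) :
    G →* P :=
  PresentedGroup.toGroup (f := fun o : GGen => o.elim s fun x => g (PresentedGroup.of x)) (by
    have key : ∀ w : Word KGen, FreeGroup.mk w ∈ KRels →
        FreeGroup.lift (fun o : GGen => o.elim s fun x => g (PresentedGroup.of x))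
          (FreeGroup.mk (w.map fun p => (some p.1, p.2))) = 1 := by
      intro w hw
      have h1 : (FreeGroup.lift fun o : GGen => o.elim s fun x => g (PresentedGroup.of x)).comp
          (FreeGroup.map some) = g.comp (PresentedGroup.mk KRels) := by
        ext x; simp; rfl
      have h2 := DFunLike.congr_fun h1 (FreeGroup.mk w)
      rw [MonoidHom.comp_apply, MonoidHom.comp_apply, PresentedGroup.one_of_mem hw, map_one] at h2
      rw [← h2]
      rfl
    rintro _ ⟨w, ⟨w, hw, rfl⟩ | ⟨i, rfl⟩, rfl⟩
    · exact key w ⟨w, hw, rfl⟩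
    · simp only [FreeGroup.lift_mk, List.map_cons, List.map_nil, List.prod_cons, List.prod_nil,
        cond, Option.elim]
      rw [mul_one, ← mul_assoc, ← mul_assoc, hs]
      group)

@[simp]
theorem G.lift_some {P : Type*} [Group P] (g : K →* P) (s : P)
    (hs : ∀ i, s * g (PresentedGroup.of (.b i)) = g (PresentedGroup.of (.b (i + 1))) * s)
    (x : KGen) : G.lift g s hs (PresentedGroup.of (some x)) = g (PresentedGroup.of x) :=
  PresentedGroup.toGroup.of _

@[simp]
theorem G.lift_none {P : Type*} [Group P] (g : K →* P) (s : P)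
    (hs : ∀ i, s * g (PresentedGroup.of (.b i)) = g (PresentedGroup.of (.b (i + 1))) * s) :
    G.lift g s hs (PresentedGroup.of none) = s :=
  PresentedGroup.toGroup.of _

theorem mk_uWord_some_mem_GRels {x y z : KGen}
    (h : uWord x y ++ [(z, false)] ∈ KRelWords) :
    FreeGroup.mk (uWord (some x) (some y) ++ [(some z, false)]) ∈ GRels := by
  refine ⟨_, Or.inl ⟨_, h, ?_⟩, rfl⟩
  simp [uWord, List.map_flatMap]

/-- The homomorphism from the base group `K` to `G`. -/
def K.toG : K →* G :=
  K.lift (fun x => PresentedGroup.of (some x))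
    (fun n τ => uVal_of_of (mk_uWord_some_mem_GRels (Or.inl ⟨n, τ, rfl⟩)))
    (fun n τ i => uVal_of_of (mk_uWord_some_mem_GRels (Or.inr ⟨n, τ, i, rfl⟩)))

@[simp]
theorem K.toG_of (x : KGen) : K.toG (PresentedGroup.of x) = PresentedGroup.of (some x) :=
  K.lift_of _ _ _ _

theorem G.t_mul_b (i : ℤ) :
    (PresentedGroup.of none : G) * K.toG (PresentedGroup.of (.b i)) =
      K.toG (PresentedGroup.of (.b (i + 1))) * PresentedGroup.of none := by
  have h := PresentedGroup.one_of_mem (rels := GRels) ⟨_, Or.inr ⟨i, rfl⟩, rfl⟩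
  have h1 : PresentedGroup.mk GRels = FreeGroup.lift PresentedGroup.of := by
    ext x; simp; rfl
  rw [h1] at h
  simp only [FreeGroup.lift_mk, List.map_cons, List.map_nil, List.prod_cons, List.prod_nil,
    cond, mul_one] at h
  rw [K.toG_of, K.toG_of, ← mul_inv_eq_one, mul_inv_rev, ← h]
  group

/-- The endomorphism of `G` induced by a map of vertices compatible with the labels. -/
def G.map (φ : Vtx → Vtx) (h1 : ∀ v, φ (parent v.1 v.2) = parent (φ v).1 (φ v).2)
    (h2 : ∀ v j, φ (v.1, v.2 ++ [j]) = ((φ v).1, (φ v).2 ++ [j])) : G →* G :=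
  G.lift (K.toG.comp (K.map φ h1 h2)) (PresentedGroup.of none) fun i => by
    simpa [KGen.vmap] using G.t_mul_b i

@[simp]
theorem G.map_some (φ : Vtx → Vtx) (h1 : ∀ v, φ (parent v.1 v.2) = parent (φ v).1 (φ v).2)
    (h2 : ∀ v j, φ (v.1, v.2 ++ [j]) = ((φ v).1, (φ v).2 ++ [j])) (x : KGen) :
    G.map φ h1 h2 (PresentedGroup.of (some x)) = PresentedGroup.of (some (x.vmap φ)) := by
  simp [G.map]

@[simp]
theorem G.map_none (φ : Vtx → Vtx) (h1 : ∀ v, φ (parent v.1 v.2) = parent (φ v).1 (φ v).2)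
    (h2 : ∀ v j, φ (v.1, v.2 ++ [j]) = ((φ v).1, (φ v).2 ++ [j])) :
    G.map φ h1 h2 (PresentedGroup.of none) = PresentedGroup.of none := by
  simp [G.map]

/-- The endomorphism of `G` induced by `vDown i`. -/
def G.down (i : ℤ) : G →* G := G.map (vDown i) (vDown_parent i) (vDown_append i)

/-- The map on generators of `K` shifting all indices by `c`. -/
def KGen.shift (c : ℤ) : KGen → KGen
  | .vert n τ => .vert n (τ.map (· + c))
  | .a => .a
  | .b i => .b (i + c)

theorem parent_map (n : ℕ) (τ : List ℤ) (f : ℤ → ℤ) :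
    parent n (τ.map f) = ((parent n τ).1, (parent n τ).2.map f) := by
  cases τ <;> simp [parent, List.map_dropLast]

/-- The endomorphism of `K` shifting all indices by `c`. -/
def K.shift (c : ℤ) : K →* K :=
  K.lift (fun x => PresentedGroup.of (x.shift c))
    (fun n τ => by
      simp only [KGen.shift]
      rw [K.uVal_a, parent_map])
    (fun n τ i => by
      simp only [KGen.shift]
      rw [K.uVal_b]
      simp)

@[simp]
theorem K.shift_of (c : ℤ) (x : KGen) :
    K.shift c (PresentedGroup.of x) = PresentedGroup.of (x.shift c) :=
  K.lift_of _ _ _ _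

theorem K.shift_injective : Injective (K.shift 1) := by
  have : (K.shift (-1)).comp (K.shift 1) = MonoidHom.id K := by
    ext x
    cases x <;> simp [KGen.shift, Function.comp_def]
  exact LeftInverse.injective (g := K.shift (-1)) fun k => DFunLike.congr_fun this k

theorem K.map_shift_bSubgroup : K.bSubgroup.map (K.shift 1) = K.bSubgroup := by
  rw [K.bSubgroup, MonoidHom.map_closure, ← Set.range_comp]
  congr 1
  ext k
  constructor
  · rintro ⟨i, rfl⟩
    exact ⟨i + 1, by simp [KGen.shift]⟩
  · rintro ⟨i, rfl⟩
    exact ⟨i - 1, by simp [KGen.shift]⟩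

/-- The group `G` as an HNN extension in the sense of Mathlib. -/
abbrev HNNK := HNNExtension K K.bSubgroup (K.bSubgroup.map (K.shift 1))
  (K.bSubgroup.equivMapOfInjective (K.shift 1) K.shift_injective)

theorem K.mem_toSubgroup (u : ℤˣ) (k : K) :
    k ∈ HNNExtension.toSubgroup K.bSubgroup (K.bSubgroup.map (K.shift 1)) u ↔
      k ∈ K.bSubgroup := by
  rw [K.map_shift_bSubgroup, HNNExtension.toSubgroup, ite_self]

/-- The endomorphism of the HNN extension induced by `vDown i`. -/
noncomputable def HNNK.down (i : ℤ) : HNNK →* HNNK :=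
  HNNExtension.lift (HNNExtension.of.comp (K.down i)) HNNExtension.t fun k => by
    have h : K.shift 1 k.1 ∈ K.bSubgroup :=
      K.map_shift_bSubgroup.le (Subgroup.mem_map_of_mem _ k.2)
    rw [MonoidHom.comp_apply, MonoidHom.comp_apply, K.down_of_mem k.2,
      Subgroup.coe_equivMapOfInjective_apply, K.down_of_mem h]
    exact HNNExtension.t_mul_of k

/-- The isomorphism from `G` to the HNN extension, as a homomorphism. -/
noncomputable def G.toHNN : G →* HNNK :=
  G.lift HNNExtension.of HNNExtension.t fun i => by
    have := HNNExtension.t_mul_of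
      (φ := K.bSubgroup.equivMapOfInjective (K.shift 1) K.shift_injective)
      ⟨PresentedGroup.of (.b i), Subgroup.subset_closure ⟨i, rfl⟩⟩
    rwa [Subgroup.coe_equivMapOfInjective_apply, K.shift_of] at this

@[simp]
theorem G.toHNN_some (x : KGen) :
    G.toHNN (PresentedGroup.of (some x)) = HNNExtension.of (PresentedGroup.of x) :=
  G.lift_some _ _ _ _

@[simp]
theorem G.toHNN_none : G.toHNN (PresentedGroup.of none) = HNNExtension.t :=
  G.lift_none _ _ _

theorem G.toHNN_injective : Injective G.toHNN := by
  have hK : ∀ k ∈ K.bSubgroup, (PresentedGroup.of none : G) * K.toG k =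
      K.toG (K.shift 1 k) * PresentedGroup.of none := by
    have : K.bSubgroup ≤ MonoidHom.eqLocus
        ((MulAut.conj (PresentedGroup.of none : G)).toMonoidHom.comp K.toG)
        (K.toG.comp (K.shift 1)) := by
      refine (Subgroup.closure_le _).2 ?_
      rintro _ ⟨i, rfl⟩
      change MulAut.conj (PresentedGroup.of none : G) (K.toG (PresentedGroup.of (.b i))) =
        K.toG (K.shift 1 (PresentedGroup.of (.b i)))
      rw [MulAut.conj_apply, G.t_mul_b, mul_inv_cancel_right, K.shift_of]
      rfl
    intro k hk
    exact mul_inv_eq_iff_eq_mul.1 (this hk)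
  let F : HNNK →* G := HNNExtension.lift K.toG (PresentedGroup.of none) fun k => by
    rw [Subgroup.coe_equivMapOfInjective_apply]
    exact hK k k.2
  have : F.comp G.toHNN = MonoidHom.id G := by
    ext x
    cases x <;> simp [F]
  exact LeftInverse.injective (g := F) fun k => DFunLike.congr_fun this k

theorem G.toHNN_down (i : ℤ) (g : G) : G.toHNN (G.down i g) = HNNK.down i (G.toHNN g) := by
  have : G.toHNN.comp (G.down i) = (HNNK.down i).comp G.toHNN := by
    ext x
    cases x <;> simp [G.down, HNNK.down, K.down]
  exact DFunLike.congr_fun this g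

theorem G.eventually_down_ne_one {g : G} (hg : g ≠ 1) :
    ∀ᶠ i in Filter.cofinite, G.down i g ≠ 1 := by
  have h := eventually_hnn_ne_one (l := Filter.cofinite) K.down HNNK.down
    (fun i k => by simp [HNNK.down]) (fun i => by simp [HNNK.down])
    (fun k => K.eventually_down_ne_one)
    (fun u k => by
      simp only [K.mem_toSubgroup]
      exact K.eventually_down_notMem)
    ((map_ne_one_iff _ G.toHNN_injective).2 hg)
  refine h.mono fun i hi h1 => hi ?_
  rw [← G.toHNN_down, h1, map_one]

/-- The embedding of the tree into itself raising the level by one. -/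
def vSucc (v : Vtx) : Vtx := (v.1 + 1, v.2)

theorem vSucc_parent (v : Vtx) :
    vSucc (parent v.1 v.2) = parent (vSucc v).1 (vSucc v).2 := by
  obtain ⟨n, _ | _⟩ := v <;> simp [vSucc, parent]

theorem vSucc_append (v : Vtx) (j : ℤ) :
    vSucc (v.1, v.2 ++ [j]) = ((vSucc v).1, (vSucc v).2 ++ [j]) := rfl

/-- The endomorphism of `G` induced by `vSucc`. -/
def G.up : G →* G := G.map vSucc vSucc_parent vSucc_append

theorem G.down_comp_up (i : ℤ) : (G.down i).comp G.up = MonoidHom.id G := by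
  ext x
  rcases x with _ | _ | _ | _ <;> simp [G.down, G.up, KGen.vmap, vSucc, vDown]

theorem K.toG_injective : Injective K.toG := by
  have : G.toHNN.comp K.toG = HNNExtension.of := by
    ext x
    simp
  refine Injective.of_comp (f := G.toHNN) ?_
  rw [← MonoidHom.coe_comp, this]
  exact HNNExtension.of_injective _

theorem G.up_not_surjective : ¬ Surjective G.up := by
  intro h
  have hinj : Injective (G.down 0) := by
    refine Injective.of_comp_right (g := G.up) ?_ h
    rw [← MonoidHom.coe_comp, G.down_comp_up]
    exact injective_id
  have h1 : G.down 0 (K.toG (PresentedGroup.of (.vert 1 [0]))) =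
      G.down 0 (K.toG (PresentedGroup.of (.vert 0 []))) := by
    simp [G.down, KGen.vmap, vDown]
  have := K.vert_injective (1, [0]) (0, []) (K.toG_injective (hinj h1))
  simp at this

section GroupRing

variable {R : Type*} [Ring R]

theorem eventually_mapDomain_ne_zero {M N ι : Type*} {l : Filter ι} (f : ι → M → N)
    (hf : ∀ g h, g ≠ h → ∀ᶠ i in l, f i g ≠ f i h) {z : MonoidAlgebra R M} (hz : z ≠ 0) :
    ∀ᶠ i in l, MonoidAlgebra.mapDomain (f i) z ≠ 0 := by
  have hinj : ∀ᶠ i in l, ∀ g ∈ z.coeff.support, ∀ h ∈ z.coeff.support, f i g = f i h → g = h := by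
    simp only [Filter.eventually_all_finset]
    intro g _ h _
    by_cases hgh : g = h
    · exact Filter.Eventually.of_forall fun _ _ => hgh
    · exact (hf g h hgh).mono fun i hi h' => absurd h' hi
  refine hinj.mono fun i hi h0 => hz (MonoidAlgebra.coeff_injective ?_)
  refine Finsupp.mapDomain_injOn (f := f i) (z.coeff.support : Set M)
    (fun g hg h hh => hi g hg h hh) (subset_refl (z.coeff.support : Set M)) (by simp) ?_
  rw [MonoidAlgebra.coeff_zero, Finsupp.mapDomain_zero]
  exact congrArg MonoidAlgebra.coeff h0

/-- A subring is existentially closed as soon as finitely many nonzero elements can always be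
kept nonzero by a retraction onto it. -/
theorem existentiallyClosedSubring_of_retract {A : Type*} [Ring A] (B : Subring A)
    (h : ∀ S : Finset A, 0 ∉ S → ∃ ρ : A →+* B, (∀ b : B, ρ b = b) ∧ ∀ z ∈ S, ρ z ≠ 0) :
    ExistentiallyClosedSubring B := by
  classical
  rintro n P N ⟨x, hP, hN⟩
  let e : FreeRing (B ⊕ Fin n) →+* A := FreeRing.lift (Sum.elim (fun b : B => (b : A)) x)
  obtain ⟨ρ, hρ, hS⟩ := h (N.image fun pq => e pq.1 - e pq.2) (by
    simp only [Finset.mem_image, not_exists, not_and]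
    exact fun pq hpq h0 => hN pq hpq (sub_eq_zero.1 h0))
  have key : ∀ p, FreeRing.lift (Sum.elim (fun b : B => (b : A)) fun j => (ρ (x j) : A)) p =
      ρ (e p) := by
    have : FreeRing.lift (Sum.elim (fun b : B => (b : A)) fun j => (ρ (x j) : A)) =
        B.subtype.comp (ρ.comp e) := by
      refine FreeRing.hom_ext ?_
      rintro (b | j) <;> simp [e, hρ]
    exact fun p => DFunLike.congr_fun this p
  refine ⟨fun j => ρ (x j), fun pq hpq => ?_, fun pq hpq h0 => ?_⟩
  · rw [key, key]
    exact congrArg _ (congrArg ρ (hP pq hpq))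
  · rw [key, key] at h0
    refine hS _ (Finset.mem_image_of_mem _ hpq) ?_
    rw [map_sub, sub_eq_zero]
    exact Subtype.ext h0

end GroupRing

theorem G.eventually_down_ne {g h : G} (hgh : g ≠ h) :
    ∀ᶠ i in Filter.cofinite, G.down i g ≠ G.down i h := by
  refine (G.eventually_down_ne_one (g := g * h⁻¹) (by rwa [Ne, mul_inv_eq_one])).mono
    fun i hi h' => hi ?_
  rw [map_mul, map_inv, h', mul_inv_cancel]

/-- For any nontrivial finitely generated ring `R`, the group ring `R[G]` is self-reflective:
it contains a proper subring isomorphic to `R[G]` which is existentially closed in `R[G]`. -/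
theorem stmt14 {R : Type*} [Ring R] [Nontrivial R]
    (hfg : ∃ s : Finset R, Subring.closure (s : Set R) = ⊤) :
    ∃ B : Subring (MonoidAlgebra R G), B ≠ ⊤ ∧
      Nonempty (B ≃+* MonoidAlgebra R G) ∧ ExistentiallyClosedSubring B := by
  let σ : MonoidAlgebra R G →+* MonoidAlgebra R G := MonoidAlgebra.mapDomainRingHom R G.up
  let θ (i : ℤ) : MonoidAlgebra R G →+* MonoidAlgebra R G :=
    MonoidAlgebra.mapDomainRingHom R (G.down i)
  have hθσ : ∀ i, LeftInverse (θ i) σ := fun i z => by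
    have : (θ i).comp σ = RingHom.id _ := by
      rw [← MonoidAlgebra.mapDomainRingHom_comp, G.down_comp_up,
        MonoidAlgebra.mapDomainRingHom_id]
    exact DFunLike.congr_fun this z
  refine ⟨σ.range, fun htop => G.up_not_surjective fun g => ?_,
    ⟨(RingEquiv.ofLeftInverse (hθσ 0)).symm⟩, existentiallyClosedSubring_of_retract _ fun S hS => ?_⟩
  · obtain ⟨z, hz⟩ := RingHom.range_eq_top.1 htop (MonoidAlgebra.single g 1)
    by_contra hg
    have h0 := congrArg (fun w => MonoidAlgebra.coeff w g) hz
    have h1 : (σ z).coeff g = 0 := Finsupp.mapDomain_of_notMem_range _ _ hg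
    simp [h1] at h0
  · have hev : ∀ᶠ i in Filter.cofinite, ∀ z ∈ S, θ i z ≠ 0 :=
      (Filter.eventually_all_finset S).2 fun z hz =>
        eventually_mapDomain_ne_zero (fun i => G.down i) (fun _ _ => G.eventually_down_ne)
          (ne_of_mem_of_not_mem hz hS)
    obtain ⟨i, hi⟩ := hev.exists
    refine ⟨σ.rangeRestrict.comp (θ i), ?_, fun z hz h0 => hi z hz ?_⟩
    · rintro ⟨_, z, rfl⟩
      exact Subtype.ext (congrArg σ (hθσ i z))
    · refine (hθσ 0).injective ?_
      rw [map_zero]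
      exact congrArg Subtype.val h0
end
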